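/- arXiv:2211.04394 — 2 statements merged into one kernel-verified Lean document; each statement's English description precedes it below -/
import Mathlib

section
/- With à the trivial square-zero extension algebra constructed from the basic finite dimensional algebra A, injectives generate for the opposite algebra Ãᵒᵖ. -/
open TrivSqZeroExt MulOpposite

universe u

section Construction

variable (k : Type u) [Field k] (n : ℕ) (A : Type u) [Ring A] [Algebra k A]

/-- The algebra `B`, a product of `n` copies of the dual numbers `k[ℓ]/(ℓ²)`. -/
abbrev ConstrB : Type u := Fin n → DualNumber k

/-- The projection `B → (Fin n → k)` killing the radical of each dual-number factor. -/
noncomputable def constrBproj : ConstrB k n →ₐ[k] (Fin n → k) :=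
  Pi.algHom k (fun _ => k) fun i => (TrivSqZeroExt.fstHom k k k).comp (Pi.evalAlgHom k _ i)

/-- The left `(A × B)`-module structure on `M = A/rad A ≅ Fin n → k`:
`(a, b)` acts on the left through the projection `B → Fin n → k`. -/
noncomputable def constrLeftModule : Module (A × ConstrB k n) (Fin n → k) :=
  Module.compHom _ ((constrBproj k n).comp (AlgHom.snd k A (ConstrB k n))).toRingHom

variable (π : A →ₐ[k] (Fin n → k))

/-- The right `(A × B)`-module structure on `M = A/rad A ≅ Fin n → k`:
`(a, b)` acts on the right through `π : A → A/rad A ≅ Fin n → k`. -/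
noncomputable def constrRightModule : Module (A × ConstrB k n)ᵐᵒᵖ (Fin n → k) :=
  Module.compHom _ ((π.toRingHom.comp (RingHom.fst A (ConstrB k n))).fromOpposite
    fun _ _ => Commute.all _ _)

/-- The two actions on `M` commute. -/
noncomputable def constrSMulCommClass :
    letI := constrLeftModule k n A
    letI := constrRightModule k n A π
    SMulCommClass (A × ConstrB k n) (A × ConstrB k n)ᵐᵒᵖ (Fin n → k) :=
  letI := constrLeftModule k n A
  letI := constrRightModule k n A π
  ⟨fun _ _ _ => mul_left_comm _ _ _⟩

end Construction


open CategoryTheory Limits Pretriangulated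

/-- `InjectivesGenerate Λ` : injectives generate for the ring `Λ`, i.e. the smallest
triangulated subcategory of the unbounded derived category of right `Λ`-modules that
contains all the injective modules and is closed under set-indexed coproducts is the
whole derived category.  Subcategories are encoded as sets of objects `S` which are
closed under isomorphism, shifts, extensions (hence are triangulated subcategories)
and coproducts. -/
def InjectivesGenerate (Λ : Type u) [Ring Λ] : Prop :=
  letI : HasDerivedCategory (ModuleCat.{u} Λᵐᵒᵖ) := HasDerivedCategory.standard _
  ∀ S : Set (DerivedCategory (ModuleCat.{u} Λᵐᵒᵖ)),
    (∀ X Y, (X ≅ Y) → X ∈ S → Y ∈ S) →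
    (∀ X ∈ S, ∀ m : ℤ, X⟦m⟧ ∈ S) →
    (∀ T ∈ distinguishedTriangles, T.obj₁ ∈ S → T.obj₃ ∈ S → T.obj₂ ∈ S) →
    (∀ (I : Type u) (f : I → DerivedCategory (ModuleCat.{u} Λᵐᵒᵖ)) (c : Cofan f),
      IsColimit c → (∀ i, f i ∈ S) → c.pt ∈ S) →
    (∀ M : ModuleCat.{u} Λᵐᵒᵖ, Injective M →
      (DerivedCategory.singleFunctor (ModuleCat.{u} Λᵐᵒᵖ) 0).obj M ∈ S) →
    ∀ X, X ∈ S

universe v w w'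




noncomputable section

namespace InjGen

section Coprod

variable {C : Type u} [Category.{v} C] [Abelian C] {ι : Type w} [HasColimitsOfShape (Discrete ι) C]

/-- family of complexes as a complex of functors -/
def famC (F : ι → CochainComplex C ℤ) : CochainComplex (Discrete ι ⥤ C) ℤ where
  X n := Discrete.functor fun i => (F i).X n
  d n m := Discrete.natTrans fun i => (F i.as).d n m
  shape n m h := by
    ext i
    exact (F i.as).shape n m h
  d_comp_d' n m l _ _ := by
    ext i
    exact (F i.as).d_comp_d n m l

def famMap {F G : ι → CochainComplex C ℤ} (s : ∀ i, F i ⟶ G i) : famC F ⟶ famC G where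
  f n := Discrete.natTrans fun i => (s i.as).f n
  comm' n m _ := by
    ext i
    exact (s i.as).comm n m

def bigC (F : ι → CochainComplex C ℤ) : CochainComplex C ℤ where
  X n := ∐ fun i => (F i).X n
  d n m := Limits.Sigma.map fun i => (F i).d n m
  shape n m h := by
    apply Limits.Sigma.hom_ext; intro i
    simp [(F i).shape n m h]
  d_comp_d' n m l _ _ := by
    apply Limits.Sigma.hom_ext; intro i
    simp

def bι (F : ι → CochainComplex C ℤ) (i : ι) (n : ℤ) : (F i).X n ⟶ (bigC F).X n :=
  Limits.Sigma.ι (fun i => (F i).X n) i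

def bdesc (F : ι → CochainComplex C ℤ) (n : ℤ) {Y : C} (g : ∀ i, (F i).X n ⟶ Y) :
    (bigC F).X n ⟶ Y := Limits.Sigma.desc g

@[simp]
lemma bι_desc (F : ι → CochainComplex C ℤ) (n : ℤ) {Y : C} (g : ∀ i, (F i).X n ⟶ Y) (i : ι) :
    bι F i n ≫ bdesc F n g = g i := Limits.Sigma.ι_desc _ _

@[simp]
lemma bι_desc_assoc (F : ι → CochainComplex C ℤ) (n : ℤ) {Y Z : C} (g : ∀ i, (F i).X n ⟶ Y) (i : ι)
    (h : Y ⟶ Z) :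
    bι F i n ≫ bdesc F n g ≫ h = g i ≫ h := by
  rw [← Category.assoc, bι_desc]

lemma b_ext (F : ι → CochainComplex C ℤ) (n : ℤ) {Y : C} {f g : (bigC F).X n ⟶ Y}
    (h : ∀ i, bι F i n ≫ f = bι F i n ≫ g) : f = g := Limits.Sigma.hom_ext _ _ h

@[simp]
lemma bι_d (F : ι → CochainComplex C ℤ) (i : ι) (n m : ℤ) :
    bι F i n ≫ (bigC F).d n m = (F i).d n m ≫ bι F i m :=
  Limits.Sigma.ι_map (f := fun i => (F i).X n) (g := fun i => (F i).X m) (fun i => (F i).d n m) i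

@[simp]
lemma bι_d_assoc (F : ι → CochainComplex C ℤ) (i : ι) (n m : ℤ) {Z : C} (h : (bigC F).X m ⟶ Z) :
    bι F i n ≫ (bigC F).d n m ≫ h = (F i).d n m ≫ bι F i m ≫ h := by
  rw [← Category.assoc, bι_d, Category.assoc]

def bigInj (F : ι → CochainComplex C ℤ) (i : ι) : F i ⟶ bigC F where
  f n := bι F i n
  comm' n m _ := by simp

@[simp] lemma bigInj_f (F : ι → CochainComplex C ℤ) (i : ι) (n : ℤ) :
    (bigInj F i).f n = bι F i n := rfl

def bigDesc (F : ι → CochainComplex C ℤ) {Y : CochainComplex C ℤ} (g : ∀ i, F i ⟶ Y) :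
    bigC F ⟶ Y where
  f n := bdesc F n fun i => (g i).f n
  comm' n m _ := by
    apply b_ext; intro i
    simp

@[simp] lemma bigDesc_f (F : ι → CochainComplex C ℤ) {Y : CochainComplex C ℤ}
    (g : ∀ i, F i ⟶ Y) (n : ℤ) : (bigDesc F g).f n = bdesc F n fun i => (g i).f n := rfl

@[simp]
lemma bigInj_desc (F : ι → CochainComplex C ℤ) {Y : CochainComplex C ℤ} (g : ∀ i, F i ⟶ Y) (i : ι) :
    bigInj F i ≫ bigDesc F g = g i := by
  ext n
  simp

@[simp]
lemma bigInj_desc_assoc (F : ι → CochainComplex C ℤ) {Y Z : CochainComplex C ℤ}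
    (g : ∀ i, F i ⟶ Y) (i : ι) (h : Y ⟶ Z) :
    bigInj F i ≫ bigDesc F g ≫ h = g i ≫ h := by
  rw [← Category.assoc, bigInj_desc]

lemma big_hom_ext (F : ι → CochainComplex C ℤ) {Y : CochainComplex C ℤ} {f g : bigC F ⟶ Y}
    (h : ∀ i, bigInj F i ≫ f = bigInj F i ≫ g) : f = g := by
  ext n
  apply b_ext
  intro i
  exact congr_arg (fun k => HomologicalComplex.Hom.f k n) (h i)

def bigMap {F G : ι → CochainComplex C ℤ} (s : ∀ i, F i ⟶ G i) : bigC F ⟶ bigC G :=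
  bigDesc F fun i => s i ≫ bigInj G i

lemma bigInj_map {F G : ι → CochainComplex C ℤ} (s : ∀ i, F i ⟶ G i) (i : ι) :
    bigInj F i ≫ bigMap s = s i ≫ bigInj G i := bigInj_desc _ _ _

def bigHomotopy (F : ι → CochainComplex C ℤ) {Y : CochainComplex C ℤ} (f : bigC F ⟶ Y)
    (h : ∀ i, Homotopy (bigInj F i ≫ f) 0) : Homotopy f 0 where
  hom n m := bdesc F n fun i => (h i).hom n m
  zero n m hnm := by
    apply b_ext; intro i
    simp [(h i).zero n m hnm]
  comm n := by
    apply b_ext; intro i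
    have := (h i).comm n
    rw [dNext_eq _ (show (ComplexShape.up ℤ).Rel n (n+1) by simp),
      prevD_eq _ (show (ComplexShape.up ℤ).Rel (n-1) n by simp)] at this ⊢
    simp at this
    simp [this]

variable [HasExactColimitsOfShape (Discrete ι) C]

instance {F G : ι → CochainComplex C ℤ} (s : ∀ i, F i ⟶ G i) [∀ i, QuasiIso (s i)] :
    QuasiIso (bigMap s) := by
  have h1 : QuasiIso (famMap s) := by
    rw [HomologicalComplex.quasiIso_iff_evaluation]
    rintro ⟨i⟩
    exact inferInstanceAs (QuasiIso (s i))
  exact inferInstanceAs (QuasiIso (((colim (J := Discrete ι) (C := C)).mapHomologicalComplex _).map (famMap s)))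

open DerivedCategory

variable [HasDerivedCategory.{w'} C]

lemma exists_qis_of_Q_eq_zero {X Y : CochainComplex C ℤ} (h : X ⟶ Y) (hh : Q.map h = 0) :
    ∃ (X' : CochainComplex C ℤ) (s : X' ⟶ X), QuasiIso s ∧ Nonempty (Homotopy (s ≫ h) 0) := by
  have e := quotientCompQhIso C
  have h0 : Qh.map ((HomotopyCategory.quotient C (ComplexShape.up ℤ)).map h) = Qh.map 0 := by
    have := e.hom.naturality h
    have h2 : (HomotopyCategory.quotient C (ComplexShape.up ℤ) ⋙ Qh).map h = 0 := by
      rw [← cancel_mono (e.hom.app Y), this, hh]; simp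
    simpa using h2
  rw [MorphismProperty.map_eq_iff_precomp Qh (HomotopyCategory.quasiIso C (ComplexShape.up ℤ))] at h0
  obtain ⟨Z, s, hs, h1⟩ := h0
  obtain ⟨X', rfl⟩ := HomotopyCategory.quotient_obj_surjective Z
  obtain ⟨s, rfl⟩ := (HomotopyCategory.quotient C (ComplexShape.up ℤ)).map_surjective s
  refine ⟨X', s, ?_, ⟨HomotopyCategory.homotopyOfEq _ _ ?_⟩⟩
  · exact (HomotopyCategory.quotient_map_mem_quasiIso_iff s).mp hs |> (HomologicalComplex.mem_quasiIso_iff _).mp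
  · simpa using h1

lemma big_Q_ext (F : ι → CochainComplex C ℤ) {Y : DerivedCategory C}
    (f : Q.obj (bigC F) ⟶ Y) (hf : ∀ i, Q.map (bigInj F i) ≫ f = 0) : f = 0 := by
  obtain ⟨Y, ⟨e⟩⟩ : ∃ Y', Nonempty (Q.obj Y' ≅ Y) := ⟨_, ⟨Q.objObjPreimageIso Y⟩⟩
  rename_i _ Y0
  suffices f ≫ e.inv = 0 by
    rw [← cancel_mono e.inv, this]; simp
  have hf' : ∀ i, Q.map (bigInj F i) ≫ f ≫ e.inv = 0 := fun i => by
    rw [← Category.assoc, hf i]; simp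
  generalize f ≫ e.inv = f' at hf'
  obtain ⟨Y', g, s, hs, rfl⟩ := left_fac f'
  have hg : ∀ i, Q.map (bigInj F i ≫ g) = 0 := fun i => by
    rw [← cancel_mono (inv (Q.map s))]
    simpa using hf' i
  choose X' t ht H using fun i => exists_qis_of_Q_eq_zero _ (hg i)
  have H2 : Homotopy (bigMap t ≫ g) 0 := bigHomotopy _ _ fun i =>
    (Homotopy.ofEq (by rw [← Category.assoc, bigInj_map, Category.assoc])).trans (H i).some
  have H3 := Q_map_eq_of_homotopy _ H2
  have : IsIso (Q.map (bigMap t)) := by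
    rw [isIso_Q_map_iff_quasiIso]; infer_instance
  rw [Functor.map_comp, Functor.map_zero] at H3
  have : Q.map g = 0 := by
    rw [← cancel_epi (Q.map (bigMap t)), H3]; simp
  simp [this]

lemma big_Q_exists (F : ι → CochainComplex C ℤ) {Y : DerivedCategory C}
    (f : ∀ i, Q.obj (F i) ⟶ Y) : ∃ g : Q.obj (bigC F) ⟶ Y, ∀ i, Q.map (bigInj F i) ≫ g = f i := by
  obtain ⟨Y, ⟨e⟩⟩ : ∃ Y', Nonempty (Q.obj Y' ≅ Y) := ⟨_, ⟨Q.objObjPreimageIso Y⟩⟩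
  choose X' s hs g hg using fun i => right_fac (f i ≫ e.inv)
  have : ∀ i, QuasiIso (s i) := fun i => by
    rw [← isIso_Q_map_iff_quasiIso]; infer_instance
  have : IsIso (Q.map (bigMap s)) := by
    rw [isIso_Q_map_iff_quasiIso]; infer_instance
  refine ⟨inv (Q.map (bigMap s)) ≫ Q.map (bigDesc _ g) ≫ e.hom, fun i => ?_⟩
  rw [← cancel_mono e.inv, hg i, ← cancel_epi (Q.map (s i))]
  have h1 : Q.map (s i) ≫ Q.map (bigInj F i) = Q.map (bigInj _ i) ≫ Q.map (bigMap s) := by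
    rw [← Functor.map_comp, ← Functor.map_comp, bigInj_map]
  simp [reassoc_of% h1, ← Functor.map_comp]

lemma big_Q_ext' (F : ι → CochainComplex C ℤ) {Y : DerivedCategory C}
    {f g : Q.obj (bigC F) ⟶ Y} (hf : ∀ i, Q.map (bigInj F i) ≫ f = Q.map (bigInj F i) ≫ g) :
    f = g := by
  rw [← sub_eq_zero]
  apply big_Q_ext
  intro i
  rw [Preadditive.comp_sub, sub_eq_zero, hf]

def bigCofan (F : ι → CochainComplex C ℤ) : Cofan fun i => (Q (C := C)).obj (F i) :=
  Cofan.mk (Q.obj (bigC F)) fun i => Q.map (bigInj F i)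

def bigCofanIsColimit (F : ι → CochainComplex C ℤ) : IsColimit (bigCofan F) :=
  Cofan.IsColimit.mk _ (fun s => (big_Q_exists F s.inj).choose)
    (fun s => (big_Q_exists F s.inj).choose_spec)
    (fun s m hm => by
      exact big_Q_ext' F fun i => (hm i).trans ((big_Q_exists F s.inj).choose_spec i).symm)

end Coprod
end InjGen
end


noncomputable section

namespace InjGen


open DerivedCategory

section Loc

variable {R : Type u} [Ring R] [HasDerivedCategory.{w'} (ModuleCat.{u} R)]

structure Loc (S : Set (DerivedCategory (ModuleCat.{u} R))) : Prop where
  iso : ∀ X Y, (X ≅ Y) → X ∈ S → Y ∈ S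
  shift : ∀ X ∈ S, ∀ m : ℤ, X⟦m⟧ ∈ S
  ext : ∀ T ∈ distinguishedTriangles, T.obj₁ ∈ S → T.obj₃ ∈ S → T.obj₂ ∈ S
  coprod : ∀ (I : Type u) (f : I → DerivedCategory (ModuleCat.{u} R)) (c : Cofan f),
      IsColimit c → (∀ i, f i ∈ S) → c.pt ∈ S

def InS (S : Set (DerivedCategory (ModuleCat.{u} R))) (M : ModuleCat.{u} R) : Prop :=
  (singleFunctor (ModuleCat.{u} R) 0).obj M ∈ S

variable {S : Set (DerivedCategory (ModuleCat.{u} R))} (hS : Loc S)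
include hS

lemma Loc.ext₁ (T) (hT : T ∈ distinguishedTriangles) (h2 : T.obj₂ ∈ S) (h3 : T.obj₃ ∈ S) :
    T.obj₁ ∈ S :=
  hS.ext T.invRotate (inv_rot_of_distTriang _ hT) (hS.shift _ h3 _) h2

lemma Loc.ext₃ (T) (hT : T ∈ distinguishedTriangles) (h1 : T.obj₁ ∈ S) (h2 : T.obj₂ ∈ S) :
    T.obj₃ ∈ S :=
  hS.ext T.rotate (rot_of_distTriang _ hT) h2 (hS.shift _ h1 _)

lemma Loc.qis {X Y : CochainComplex (ModuleCat.{u} R) ℤ} (f : X ⟶ Y) [QuasiIso f] :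
    Q.obj X ∈ S ↔ Q.obj Y ∈ S :=
  ⟨hS.iso _ _ (asIso (Q.map f)), hS.iso _ _ (asIso (Q.map f)).symm⟩

lemma Loc.ses₂ {X : ShortComplex (CochainComplex (ModuleCat.{u} R) ℤ)} (h : X.ShortExact)
    (h1 : Q.obj X.X₁ ∈ S) (h3 : Q.obj X.X₃ ∈ S) : Q.obj X.X₂ ∈ S :=
  hS.ext _ (triangleOfSES_distinguished h) h1 h3

lemma Loc.ses₁ {X : ShortComplex (CochainComplex (ModuleCat.{u} R) ℤ)} (h : X.ShortExact)
    (h1 : Q.obj X.X₂ ∈ S) (h3 : Q.obj X.X₃ ∈ S) : Q.obj X.X₁ ∈ S :=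
  hS.ext₁ _ (triangleOfSES_distinguished h) h1 h3

lemma Loc.ses₃ {X : ShortComplex (CochainComplex (ModuleCat.{u} R) ℤ)} (h : X.ShortExact)
    (h1 : Q.obj X.X₁ ∈ S) (h3 : Q.obj X.X₂ ∈ S) : Q.obj X.X₃ ∈ S :=
  hS.ext₃ _ (triangleOfSES_distinguished h) h1 h3

lemma Loc.big {ι : Type u} (F : ι → CochainComplex (ModuleCat.{u} R) ℤ)
    (h : ∀ i, Q.obj (F i) ∈ S) : Q.obj (bigC F) ∈ S :=
  hS.coprod _ _ _ (bigCofanIsColimit F) h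

lemma Loc.retract' {X Y W : DerivedCategory (ModuleCat.{u} R)} (i : X ⟶ Y) (r : Y ⟶ X)
    (hir : i ≫ r = 𝟙 X) (hY : Y ∈ S) (w : ULift.{u} ℕ → (Y ⟶ W))
    (hc : IsColimit (Cofan.mk W w)) : X ∈ S := by
  have hW : W ∈ S := hS.coprod _ _ _ hc fun _ => hY
  have hext : ∀ {Z} {f g : W ⟶ Z}, (∀ n, w n ≫ f = w n ≫ g) → f = g := fun h =>
    Cofan.IsColimit.hom_ext hc _ _ h
  have hdesc : ∀ {Z} (g : ULift.{u} ℕ → (Y ⟶ Z)), ∃ f : W ⟶ Z, ∀ n, w n ≫ f = g n := fun g =>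
    ⟨Cofan.IsColimit.desc hc g, fun n => Cofan.IsColimit.fac hc g n⟩
  obtain ⟨a, ha⟩ := hdesc fun n => (r ≫ i) ≫ w ⟨n.down + 1⟩ + (𝟙 Y - r ≫ i) ≫ w n
  obtain ⟨b, hb⟩ := hdesc (Z := X ⊞ W) fun n => match n with
    | ⟨0⟩ => r ≫ biprod.inl + (𝟙 Y - r ≫ i) ≫ w ⟨0⟩ ≫ biprod.inr
    | ⟨n+1⟩ => (r ≫ i) ≫ w ⟨n⟩ ≫ biprod.inr + (𝟙 Y - r ≫ i) ≫ w ⟨n+1⟩ ≫ biprod.inr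
  have hb0 := hb ⟨0⟩
  have hbs := fun n => hb ⟨n+1⟩
  simp only at hb0 hbs
  have ha' : ∀ n, w n ≫ a = _ := ha
  have hri : ∀ {Z} (f : X ⟶ Z), i ≫ r ≫ f = f := fun f => by
    rw [← Category.assoc, hir, Category.id_comp]
  have e : X ⊞ W ≅ W :=
    { hom := biprod.desc (i ≫ w ⟨0⟩) a
      inv := b
      hom_inv_id := by
        apply biprod.hom_ext'
        · simp [hb0, hri]
        · simp only [biprod.inr_desc_assoc, Category.comp_id]
          apply hext
          rintro ⟨n⟩
          rw [← Category.assoc, ha']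
          rcases n with _ | n
          · simp [hb0, hbs, hri]
          · simp [hbs, hri]
      inv_hom_id := by
        apply hext
        rintro ⟨n⟩
        rw [← Category.assoc]
        rcases n with _ | n
        · simp [hb0, ha', hri]
        · simp [hbs, ha', hri] }
  exact hS.ext₁ _ (binaryBiproductTriangle_distinguished X W) (hS.iso _ _ e.symm hW) hW

lemma Loc.retract {X Y : DerivedCategory (ModuleCat.{u} R)} (i : X ⟶ Y) (r : Y ⟶ X)
    (hir : i ≫ r = 𝟙 X) (hY : Y ∈ S) : X ∈ S := by
  let e := Q.objObjPreimageIso Y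
  have hY' := hS.iso _ _ e.symm hY
  exact hS.retract' (i ≫ e.inv) (e.hom ≫ r) (by simpa using hir) hY' _
    (bigCofanIsColimit (fun _ : ULift.{u} ℕ => Q.objPreimage Y))

lemma Loc.single {M : ModuleCat.{u} R} (hM : InS S M) (i : ℤ) :
    Q.obj ((HomologicalComplex.single (ModuleCat.{u} R) (ComplexShape.up ℤ) i).obj M) ∈ S := by
  have e := ((singleFunctors (ModuleCat.{u} R)).shiftIso (-i) i 0 (by simp)).app M
  exact hS.iso _ _ e (hS.shift _ hM _)

lemma Loc.zeroDiff (X : CochainComplex (ModuleCat.{u} R) ℤ) (hd : ∀ i j, X.d i j = 0)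
    (hX : ∀ i, InS S (X.X i)) : Q.obj X ∈ S := by
  let F : ULift.{u} ℤ → CochainComplex (ModuleCat.{u} R) ℤ := fun i =>
    (HomologicalComplex.single (ModuleCat.{u} R) (ComplexShape.up ℤ) i.down).obj (X.X i.down)
  have hF : Q.obj (bigC F) ∈ S := hS.big F fun i => hS.single (hX _) _
  have hFd : ∀ i n m, (F i).d n m = 0 := fun i n m => rfl
  let φ : bigC F ⟶ X := bigDesc F fun i =>
    HomologicalComplex.mkHomFromSingle (𝟙 (X.X i.down)) (fun _ _ => by rw [hd, comp_zero])
  let ψ : X ⟶ bigC F :=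
    { f := fun n => (HomologicalComplex.singleObjXSelf (ComplexShape.up ℤ) n (X.X n)).inv ≫
        bι F ⟨n⟩ n
      comm' := fun n m _ => by
        rw [hd, zero_comp, Category.assoc, bι_d, hFd, zero_comp, comp_zero] }
  have e : bigC F ≅ X :=
    { hom := φ
      inv := ψ
      hom_inv_id := by
        ext1 n
        apply b_ext
        rintro ⟨i⟩
        by_cases h : n = i
        · subst h
          simp [φ, ψ]
        · exact (HomologicalComplex.isZero_single_obj_X (ComplexShape.up ℤ) i (X.X i) n h).eq_of_src _ _
      inv_hom_id := by
        ext1 n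
        simp [φ, ψ] }
  exact hS.iso _ _ (Q.mapIso e) hF

end Loc
end InjGen
end


noncomputable section

namespace InjGen


open DerivedCategory

section Elts

variable {R : Type u} [Ring R] {ι : Type u} (F : ι → CochainComplex (ModuleCat.{u} R) ℤ)

open Classical in
def bIso (n : ℤ) : (bigC F).X n ≅ ModuleCat.of R (DirectSum ι fun i => (F i).X n) :=
  ModuleCat.coprodIsoDirectSum (fun i => (F i).X n)

open Classical in
lemma bι_bIso (i : ι) (n : ℤ) :
    bι F i n ≫ (bIso F n).hom = ModuleCat.ofHom (DirectSum.lof R ι (fun i => (F i).X n) i) :=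
  ModuleCat.ι_coprodIsoDirectSum_hom (fun i => (F i).X n) i

def bproj (i : ι) (n : ℤ) : (bigC F).X n ⟶ (F i).X n :=
  (bIso F n).hom ≫ ModuleCat.ofHom (DirectSum.component R ι (fun i => (F i).X n) i)

lemma bι_bproj (i : ι) (n : ℤ) : bι F i n ≫ bproj F i n = 𝟙 _ := by
  classical
  rw [bproj, ← Category.assoc, bι_bIso]
  ext x
  simp

lemma bι_bproj_ne {i j : ι} (h : i ≠ j) (n : ℤ) : bι F i n ≫ bproj F j n = 0 := by
  classical
  rw [bproj, ← Category.assoc, bι_bIso]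
  ext x
  simp [DirectSum.component.of, h]

lemma b_sep {n : ℤ} (x : (bigC F).X n) (hx : ∀ i, (bproj F i n).hom x = 0) : x = 0 := by
  have : (bIso F n).hom.hom x = 0 := DFinsupp.ext fun i => hx i
  have h2 : (bIso F n).inv.hom ((bIso F n).hom.hom x) = x := by
    rw [← ModuleCat.comp_apply]; simp
  rw [← h2, this, map_zero]

lemma b_induction {n : ℤ} {P : (bigC F).X n → Prop} (h0 : P 0)
    (hι : ∀ i x, P ((bι F i n).hom x)) (hadd : ∀ x y, P x → P y → P (x + y)) (x) : P x := by
  classical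
  have h2 : (bIso F n).inv.hom ((bIso F n).hom.hom x) = x := by
    rw [← ModuleCat.comp_apply]; simp
  rw [← h2]
  induction (bIso F n).hom.hom x using DirectSum.induction_on with
  | zero => rwa [map_zero]
  | of i y =>
    have : bι F i n = ModuleCat.ofHom (DirectSum.lof R ι (fun i => (F i).X n) i) ≫
      (bIso F n).inv := by rw [← bι_bIso]; simp
    have h3 := hι i y
    rw [this] at h3
    exact h3
  | add y z hy hz => rw [map_add]; exact hadd _ _ hy hz

end Elts

section Sub

variable {R : Type u} [Ring R] 

lemma shortExact_of {X Y Z : CochainComplex (ModuleCat.{u} R) ℤ} (f : X ⟶ Y) (g : Y ⟶ Z)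
    (w : f ≫ g = 0)
    (hinj : ∀ i, Function.Injective (f.f i).hom) (hsurj : ∀ i, Function.Surjective (g.f i).hom)
    (hex : ∀ i x, (g.f i).hom x = 0 → ∃ y, (f.f i).hom y = x) :
    (ShortComplex.mk f g w).ShortExact := by
  apply HomologicalComplex.shortExact_of_degreewise_shortExact
  intro i
  refine ModuleCat.shortComplex_shortExact _ ?_ (hinj i) (hsurj i)
  intro x
  constructor
  · exact hex i x
  · rintro ⟨y, rfl⟩
    have := congr_arg (fun k : X ⟶ Z => (k.f i).hom y) w
    exact this

variable (X : CochainComplex (ModuleCat.{u} R) ℤ)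

structure SubC where
  N : ∀ i, Submodule R (X.X i)
  hN : ∀ i j, N i ≤ (N j).comap (X.d i j).hom

variable {X}

def SubC.toC (s : SubC X) : CochainComplex (ModuleCat.{u} R) ℤ where
  X i := ModuleCat.of R (s.N i)
  d i j := ModuleCat.ofHom ((X.d i j).hom.restrict (s.hN i j))
  shape i j h := by
    ext x
    simp [X.shape i j h]
  d_comp_d' i j l _ _ := by
    ext x
    have : (X.d i j ≫ X.d j l).hom x.1 = 0 := by simp
    exact this

def SubC.incl (s : SubC X) : s.toC ⟶ X where
  f i := ModuleCat.ofHom (s.N i).subtype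
  comm' i j _ := rfl

def SubC.mapLE {s t : SubC X} (h : ∀ i, s.N i ≤ t.N i) : s.toC ⟶ t.toC where
  f i := ModuleCat.ofHom (Submodule.inclusion (h i))
  comm' i j _ := rfl

def SubC.quot (s t : SubC X) : CochainComplex (ModuleCat.{u} R) ℤ where
  X i := ModuleCat.of R (t.N i ⧸ (s.N i).comap (t.N i).subtype)
  d i j := ModuleCat.ofHom (Submodule.mapQ _ _ ((X.d i j).hom.restrict (t.hN i j)) (by
    intro x hx
    exact s.hN i j hx))
  shape i j h := by
    ext x
    refine (Submodule.Quotient.mk_eq_zero _).mpr ?_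
    simp [X.shape i j h]
  d_comp_d' i j l _ _ := by
    ext x
    have : (X.d i j ≫ X.d j l).hom x.1 = 0 := by simp
    refine (Submodule.Quotient.mk_eq_zero _).mpr ?_
    have h2 : (X.d j l).hom ((X.d i j).hom x.1) ∈ s.N l := by
      have : (X.d j l).hom ((X.d i j).hom x.1) = 0 := this
      rw [this]; exact zero_mem _
    exact h2

def SubC.toQuot (s t : SubC X) : t.toC ⟶ s.quot t where
  f i := ModuleCat.ofHom (Submodule.mkQ _)
  comm' i j _ := rfl

lemma SubC.ses {s t : SubC X} (h : ∀ i, s.N i ≤ t.N i) :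
    (ShortComplex.mk (SubC.mapLE h) (SubC.toQuot s t) (by
      ext i x
      exact (Submodule.Quotient.mk_eq_zero _).mpr x.2)).ShortExact := by
  apply shortExact_of
  · intro i
    exact Submodule.inclusion_injective (h i)
  · intro i
    exact Submodule.mkQ_surjective _
  · intro i x hx
    exact ⟨⟨x.1, (Submodule.Quotient.mk_eq_zero ((s.N i).comap (t.N i).subtype)).mp hx⟩, rfl⟩

end Sub


section Filt

variable {R : Type u} [Ring R] [HasDerivedCategory.{w'} (ModuleCat.{u} R)]
variable {S : Set (DerivedCategory (ModuleCat.{u} R))} (hS : Loc S)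
variable {X : CochainComplex (ModuleCat.{u} R) ℤ}

section
variable (s : ℕ → SubC X) (hs : ∀ m i, (s m).N i ≤ (s (m+1)).N i)

abbrev fam : ULift.{u} ℕ → CochainComplex (ModuleCat.{u} R) ℤ := fun m => (s m.down).toC

def tel : bigC (fam s) ⟶ bigC (fam s) := bigDesc _ fun m =>
  bigInj (fam s) m - SubC.mapLE (hs m.down) ≫ bigInj (fam s) ⟨m.down+1⟩

def telEnd : bigC (fam s) ⟶ X := bigDesc _ fun m => (s m.down).incl

lemma tel_telEnd : tel s hs ≫ telEnd s = 0 := by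
  apply big_hom_ext
  intro m
  simp only [tel, telEnd, bigInj_desc_assoc, Preadditive.sub_comp, bigInj_desc, Category.assoc,
    comp_zero]
  exact sub_self _

lemma bι_tel (m i) : bι (fam s) m i ≫ (tel s hs).f i =
    bι (fam s) m i - (SubC.mapLE (hs m.down)).f i ≫ bι (fam s) ⟨m.down+1⟩ i := by
  simp [tel]

lemma tel_bproj_zero (i) : (tel s hs).f i ≫ bproj (fam s) ⟨0⟩ i = bproj (fam s) ⟨0⟩ i := by
  apply b_ext
  rintro ⟨m⟩
  rw [← Category.assoc, bι_tel, Preadditive.sub_comp, Category.assoc,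
    bι_bproj_ne (fam s) (i := ⟨m+1⟩) (j := ⟨0⟩) (by simp), comp_zero, sub_zero]

lemma tel_bproj_succ (m i) : (tel s hs).f i ≫ bproj (fam s) ⟨m+1⟩ i =
    bproj (fam s) ⟨m+1⟩ i - bproj (fam s) ⟨m⟩ i ≫ (SubC.mapLE (hs m)).f i := by
  apply b_ext
  rintro ⟨j⟩
  rw [← Category.assoc, bι_tel, Preadditive.sub_comp, Category.assoc, Preadditive.comp_sub]
  congr 1
  by_cases h : j = m
  · subst h
    rw [bι_bproj, ← Category.assoc, bι_bproj, Category.comp_id, Category.id_comp]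
  · rw [bι_bproj_ne _ (by simpa using h), ← Category.assoc, bι_bproj_ne _ (by simpa using h),
      comp_zero, zero_comp]

lemma tel_inj (i) : Function.Injective ((tel s hs).f i).hom := by
  rw [injective_iff_map_eq_zero]
  intro x hx
  apply b_sep
  rintro ⟨m⟩
  induction m with
  | zero => rw [← tel_bproj_zero s hs, ModuleCat.hom_comp, LinearMap.comp_apply, hx, map_zero]
  | succ m ih =>
    have := congr_arg (fun k => (ModuleCat.Hom.hom k) x) (tel_bproj_succ s hs m i)
    simp only [ModuleCat.hom_comp, LinearMap.comp_apply, hx, map_zero, ModuleCat.hom_sub,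
      LinearMap.sub_apply, ih, sub_zero] at this
    exact this.symm

lemma tel_push (i : ℤ) (m : ℕ) (z : (s m).toC.X i) (m' : ℕ) (h : m ≤ m') :
    ∃ (z' : (s m').toC.X i) (x : (bigC (fam s)).X i),
      (bι (fam s) ⟨m⟩ i).hom z = ((tel s hs).f i).hom x + (bι (fam s) ⟨m'⟩ i).hom z' := by
  induction m', h using Nat.le_induction with
  | base => exact ⟨z, 0, by simp⟩
  | succ m' h ih =>
    obtain ⟨z', x, e⟩ := ih
    refine ⟨((SubC.mapLE (hs m')).f i).hom z', x + (bι (fam s) ⟨m'⟩ i).hom z', ?_⟩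
    rw [e, map_add, add_assoc]
    congr 1
    have : ((tel s hs).f i).hom ((bι (fam s) ⟨m'⟩ i).hom z') = (bι (fam s) ⟨m'⟩ i).hom z' -
        (bι (fam s) ⟨m'+1⟩ i).hom (((SubC.mapLE (hs m')).f i).hom z') :=
      congr_arg (fun k => (ModuleCat.Hom.hom k) z') (bι_tel s hs ⟨m'⟩ i)
    rw [this]
    exact (sub_add_cancel _ _).symm

lemma tel_repr (i : ℤ) (y : (bigC (fam s)).X i) : ∃ (m : ℕ) (z : (s m).toC.X i)
    (x : (bigC (fam s)).X i), y = ((tel s hs).f i).hom x + (bι (fam s) ⟨m⟩ i).hom z := by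
  induction y using b_induction with
  | h0 => exact ⟨0, 0, 0, by simp⟩
  | hι m z => exact ⟨m.down, z, 0, by simp⟩
  | hadd y y' hy hy' =>
    obtain ⟨m, z, x, rfl⟩ := hy
    obtain ⟨m', z', x', rfl⟩ := hy'
    obtain ⟨w, t, e⟩ := tel_push s hs i m z (max m m') (le_max_left _ _)
    obtain ⟨w', t', e'⟩ := tel_push s hs i m' z' (max m m') (le_max_right _ _)
    refine ⟨max m m', w + w', x + t + (x' + t'), ?_⟩
    rw [e, e']
    simp only [map_add]
    abel

lemma telEnd_ι (i : ℤ) (m : ℕ) (z : (s m).toC.X i) :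
    ((telEnd s).f i).hom ((bι (fam s) ⟨m⟩ i).hom z) = ((s m).incl.f i).hom z := by
  have : bι (fam s) ⟨m⟩ i ≫ (telEnd s).f i = ((s m).incl).f i := by simp [telEnd]
  exact congr_arg (fun k => (ModuleCat.Hom.hom k) z) this

lemma tel_ses (hex : ∀ i x, ∃ m, x ∈ (s m).N i) :
    (ShortComplex.mk (tel s hs) (telEnd s) (tel_telEnd s hs)).ShortExact := by
  apply shortExact_of
  · exact tel_inj s hs
  · intro i x
    obtain ⟨m, hm⟩ := hex i x
    exact ⟨_, telEnd_ι s i m ⟨x, hm⟩⟩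
  · intro i y hy
    obtain ⟨m, z, x, rfl⟩ := tel_repr s hs i y
    have h0 : ((telEnd s).f i).hom (((tel s hs).f i).hom x) = 0 :=
      congr_arg (fun k : bigC (fam s) ⟶ X => (k.f i).hom x) (tel_telEnd s hs)
    rw [map_add, h0, zero_add, telEnd_ι] at hy
    have : z = 0 := Subtype.ext (by exact hy)
    subst this
    exact ⟨x, by simp⟩

end

include hS in
lemma Loc.zero {Y : DerivedCategory (ModuleCat.{u} R)} (hY : IsZero Y) : Y ∈ S :=
  hS.coprod PEmpty (fun _ => Y) (Cofan.mk Y fun i => i.elim)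
    (Cofan.IsColimit.mk _ (fun _ => 0) (fun _ j => j.elim) (fun _ _ _ => hY.eq_of_src _ _))
    (fun i => i.elim)

include hS in
lemma Loc.inS_zero (M : ModuleCat.{u} R) [Subsingleton M] : InS S M :=
  hS.zero (Functor.map_isZero _ (ModuleCat.isZero_of_subsingleton M))

include hS in
lemma Loc.inS_iso {M N : ModuleCat.{u} R} (e : M ≅ N) (h : InS S M) : InS S N :=
  hS.iso _ _ ((singleFunctor (ModuleCat.{u} R) 0).mapIso e) h

include hS in
lemma Loc.filt (N : ℕ → ∀ i, Submodule R (X.X i)) (h0 : ∀ i, N 0 i = ⊥)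
    (hmono : ∀ m i, N m i ≤ N (m+1) i)
    (hd : ∀ m i j, N (m+1) i ≤ (N m j).comap (X.d i j).hom)
    (hex : ∀ i x, ∃ m, x ∈ N m i)
    (hq : ∀ m i, InS S (ModuleCat.of R (N (m+1) i ⧸ (N m i).comap (N (m+1) i).subtype))) :
    Q.obj X ∈ S := by
  let s : ℕ → SubC X := fun m => ⟨N m, fun i j => (hmono m i).trans (hd m i j)⟩
  have hs : ∀ m, Q.obj (s m).toC ∈ S := by
    intro m
    induction m with
    | zero =>
      refine hS.zeroDiff _ ?_ fun i => ?_
      · intro i j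
        have : Subsingleton ((s 0).N j) := by
          rw [show (s 0).N j = ⊥ from h0 j]; infer_instance
        ext x
        exact Subsingleton.elim (α := (s 0).N j) _ _
      · have : Subsingleton ((s 0).toC.X i) := by
          change Subsingleton (N 0 i)
          rw [h0 i]; infer_instance
        exact hS.inS_zero _
    | succ m ih =>
      refine hS.ses₂ (SubC.ses (s := s m) (t := s (m+1)) (hmono m)) ih ?_
      refine hS.zeroDiff _ ?_ (hq m)
      intro i j
      ext x
      obtain ⟨x, rfl⟩ := Submodule.Quotient.mk_surjective ((N m i).comap (N (m+1) i).subtype) x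
      refine (Submodule.Quotient.mk_eq_zero ((N m j).comap (N (m+1) j).subtype)).mpr ?_
      exact hd m i j x.2
  exact hS.ses₃ (tel_ses s hmono hex) (hS.big _ fun m => hs m.down) (hS.big _ fun m => hs m.down)

include hS in
lemma Loc.inS_equiv {M N : Type u} [AddCommGroup M] [Module R M] [AddCommGroup N] [Module R N]
    (e : M ≃ₗ[R] N) (h : InS S (ModuleCat.of R M)) : InS S (ModuleCat.of R N) :=
  hS.inS_iso e.toModuleIso h

section
variable {M : Type u} [AddCommGroup M] [Module R M] (N : Submodule R M)

lemma subSES : (ShortComplex.mk (ModuleCat.ofHom N.subtype) (ModuleCat.ofHom N.mkQ) (by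
    ext x
    exact (Submodule.Quotient.mk_eq_zero N).mpr x.2)).ShortExact :=
  ModuleCat.shortComplex_shortExact _ (LinearMap.exact_subtype_mkQ N) N.injective_subtype
    N.mkQ_surjective

include hS in
lemma Loc.inS_sub₂ (h1 : InS S (ModuleCat.of R N)) (h3 : InS S (ModuleCat.of R (M ⧸ N))) :
    InS S (ModuleCat.of R M) :=
  hS.ext _ (subSES N).singleTriangle_distinguished h1 h3

include hS in
lemma Loc.inS_sub₃ (h1 : InS S (ModuleCat.of R N)) (h2 : InS S (ModuleCat.of R M)) :
    InS S (ModuleCat.of R (M ⧸ N)) :=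
  hS.ext₃ _ (subSES N).singleTriangle_distinguished h1 h2

end

include hS in
lemma Loc.inS_retract {M N : Type u} [AddCommGroup M] [Module R M] [AddCommGroup N] [Module R N]
    (i : M →ₗ[R] N) (r : N →ₗ[R] M) (h : r ∘ₗ i = LinearMap.id) (hN : InS S (ModuleCat.of R N)) :
    InS S (ModuleCat.of R M) := by
  refine hS.retract ((singleFunctor (ModuleCat.{u} R) 0).map (ModuleCat.ofHom i))
    ((singleFunctor (ModuleCat.{u} R) 0).map (ModuleCat.ofHom r)) ?_ hN
  rw [← Functor.map_comp, ← ModuleCat.ofHom_comp, h]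
  exact CategoryTheory.Functor.map_id _ _

include hS in
lemma Loc.inS_finsupp {M : Type u} [AddCommGroup M] [Module R M] (ι : Type u)
    (hM : InS S (ModuleCat.of R M)) : InS S (ModuleCat.of R (ι →₀ M)) := by
  let F : ι → CochainComplex (ModuleCat.{u} R) ℤ := fun i =>
    (HomologicalComplex.single (ModuleCat.{u} R) (ComplexShape.up ℤ) 0).obj (ModuleCat.of R M)
  have hF : Q.obj (bigC F) ∈ S := hS.big F fun i => hM
  let φ : bigC F ⟶ (HomologicalComplex.single (ModuleCat.{u} R) (ComplexShape.up ℤ) 0).obj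
      (ModuleCat.of R (ι →₀ M)) := bigDesc F fun i =>
    (HomologicalComplex.single (ModuleCat.{u} R) (ComplexShape.up ℤ) 0).map
      (ModuleCat.ofHom (Finsupp.lsingle i))
  have hFd : ∀ n m, (bigC F).d n m = 0 := fun n m => by
    apply b_ext
    intro i
    rw [bι_d, show (F i).d n m = 0 from rfl, zero_comp, comp_zero]
  let f : ModuleCat.of R (ι →₀ M) ⟶ (bigC F).X 0 := ModuleCat.ofHom
    (Finsupp.lsum ℕ fun i => ((HomologicalComplex.singleObjXSelf (ComplexShape.up ℤ) 0
      (ModuleCat.of R M)).inv ≫ bι F i 0).hom)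
  have hf : ∀ i, ModuleCat.ofHom (Finsupp.lsingle (R := R) i) ≫ f =
      (HomologicalComplex.singleObjXSelf (ComplexShape.up ℤ) 0
      (ModuleCat.of R M)).inv ≫ bι F i 0 := by
    intro i
    ext x
    exact Finsupp.sum_single_index (map_zero _)
  have hext : ∀ {Z : ModuleCat.{u} R} {g h : ModuleCat.of R (ι →₀ M) ⟶ Z},
      (∀ i, ModuleCat.ofHom (Finsupp.lsingle (R := R) i) ≫ g =
        ModuleCat.ofHom (Finsupp.lsingle (R := R) i) ≫ h) → g = h := by
    intro Z g h hgh
    apply ModuleCat.hom_ext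
    apply Finsupp.lhom_ext'
    intro i
    exact congr_arg ModuleCat.Hom.hom (hgh i)
  let ψ : (HomologicalComplex.single (ModuleCat.{u} R) (ComplexShape.up ℤ) 0).obj
      (ModuleCat.of R (ι →₀ M)) ⟶ bigC F :=
    HomologicalComplex.mkHomFromSingle f (fun _ _ => by rw [hFd, comp_zero])
  have e : bigC F ≅ (HomologicalComplex.single (ModuleCat.{u} R) (ComplexShape.up ℤ) 0).obj
      (ModuleCat.of R (ι →₀ M)) :=
    { hom := φ
      inv := ψ
      hom_inv_id := by
        ext1 n
        apply b_ext
        intro i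
        by_cases h : n = 0
        · subst h
          simp [φ, ψ, HomologicalComplex.single_map_f_self]
          rw [hf]; simp
        · exact (HomologicalComplex.isZero_single_obj_X (ComplexShape.up ℤ) 0 _ n h).eq_of_src _ _
      inv_hom_id := by
        apply HomologicalComplex.from_single_hom_ext
        simp [φ, ψ] 
        rw [← cancel_epi (HomologicalComplex.singleObjXSelf (ComplexShape.up ℤ) 0
          (ModuleCat.of R (ι →₀ M))).inv]
        apply hext
        intro i
        simp only [Iso.inv_hom_id_assoc, Category.comp_id]
        rw [← Category.assoc, hf, Category.assoc, bι_desc, HomologicalComplex.single_map_f_self]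
        simp }
  exact hS.iso _ _ (Q.mapIso e) hF

include hS in
lemma Loc.all (h : ∀ M : ModuleCat.{u} R, InS S M) (Y : DerivedCategory (ModuleCat.{u} R)) :
    Y ∈ S := by
  refine hS.iso _ _ (Q.objObjPreimageIso Y) ?_
  let X := Q.objPreimage Y
  refine hS.filt (X := X) (fun m i => match m with
    | 0 => ⊥
    | 1 => LinearMap.ker (X.d i (i+1)).hom
    | _ => ⊤) ?_ ?_ ?_ ?_ ?_
  · intro i; rfl
  · rintro (_|_|m) i <;> simp
  · have hk : ∀ i j x, x ∈ LinearMap.ker (X.d i (i+1)).hom → (X.d i j).hom x = 0 := by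
      intro i j x hx
      by_cases hij : i + 1 = j
      · subst hij; exact hx
      · rw [X.shape i j hij]; rfl
    rintro (_|_|m) i j
    · intro x hx
      exact hk i j x hx
    · rintro x -
      have : (X.d i j ≫ X.d j (j+1)).hom x = 0 := by simp
      exact this
    · simp
  · intro i x
    exact ⟨2, trivial⟩
  · intro m i
    exact h _

end Filt

end InjGen
end


noncomputable section

namespace InjGen


open DerivedCategory

section Nilp
variable {R : Type u} [Ring R] [HasDerivedCategory.{w'} (ModuleCat.{u} R)]
variable {S : Set (DerivedCategory (ModuleCat.{u} R))} (hS : Loc S)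
  (J : Ideal R) [J.IsTwoSided] [IsSemisimpleRing (R ⧸ J)]
  (hJ : InS S (ModuleCat.of R (R ⧸ J)))
include hS hJ

lemma Loc.torsion (M : Type u) [AddCommGroup M] [Module R M]
    (hM : ∀ r ∈ J, ∀ x : M, r • x = 0) : InS S (ModuleCat.of R M) := by
  have ht : Module.IsTorsionBySet R M J := fun x r => hM r r.2 x
  letI := ht.module
  haveI : IsScalarTower R (R ⧸ J) M := inferInstance
  obtain ⟨s, hs⟩ := Module.projective_def'.mp (Module.projective_of_isSemisimpleRing (R ⧸ J) M)
  refine hS.inS_retract (s.restrictScalars R)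
    ((Finsupp.linearCombination (R ⧸ J) (id : M → M)).restrictScalars R) ?_
    (hS.inS_finsupp M hJ)
  ext x
  exact congr_arg (fun f => f x) hs

lemma Loc.nilp (m : ℕ) : ∀ (M : Type u) [AddCommGroup M] [Module R M],
    (∀ r ∈ J ^ m, ∀ x : M, r • x = 0) → InS S (ModuleCat.of R M) := by
  induction m with
  | zero =>
    intro M _ _ h
    have h1J : (1 : R) ∈ J ^ 0 := by
      rw [Submodule.pow_zero]
      exact Submodule.one_le.mp le_rfl
    have : Subsingleton M := ⟨fun x y => by
      have h1 := h 1 h1J x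
      have h2 := h 1 h1J y
      rw [one_smul] at h1 h2
      rw [h1, h2]⟩
    exact hS.inS_zero _
  | succ m ih =>
    intro M _ _ h
    refine hS.inS_sub₂ (J • (⊤ : Submodule R M)) (ih _ ?_) (hS.torsion J hJ _ ?_)
    · rintro r hr ⟨x, hx⟩
      apply Subtype.ext
      change r • x = 0
      induction hx using Submodule.smul_induction_on' with
      | smul j hj y hy =>
        rw [smul_smul]
        refine h _ ?_ _
        rw [Submodule.pow_succ]
        exact Ideal.mul_mem_mul hr hj
      | add x hx y hy h1 h2 => rw [smul_add, h1, h2, add_zero]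
    · intro r hr x
      obtain ⟨x, rfl⟩ := Submodule.Quotient.mk_surjective _ x
      exact (Submodule.Quotient.mk_eq_zero _).mpr (Submodule.smul_mem_smul hr trivial)

lemma Loc.all_of_nilp (hn : IsNilpotent J) (Y) : Y ∈ S := by
  obtain ⟨m, hm⟩ := hn
  refine hS.all (fun M => hS.nilp J hJ m M ?_) Y
  intro r hr x
  rw [hm] at hr
  rw [show r = 0 from hr, zero_smul]

end Nilp

lemma nilp_of_le {R : Type u} [Ring R] [IsArtinianRing R] (J : Ideal R)
    (h : J ≤ Ideal.jacobson ⊥) : IsNilpotent J := by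
  obtain ⟨m, hm⟩ := IsArtinianRing.isNilpotent_jacobson_bot (R := R)
  refine ⟨m, le_bot_iff.mp ?_⟩
  rw [← Submodule.zero_eq_bot, ← hm]
  exact Ideal.pow_right_mono h m

end InjGen
end


noncomputable section

namespace InjGen


open DerivedCategory

section Per
variable {R : Type u} [Ring R] {I : Type u} [AddCommGroup I] [Module R I]
  (d : I →ₗ[R] I) (hd : ∀ x, d (d x) = 0)

def perD (i j : ℤ) : I →ₗ[R] I := if i + 1 = j ∧ i < 0 then d else 0

lemma perD_zero {i j : ℤ} (h : ¬ (i + 1 = j ∧ i < 0)) : perD d i j = 0 := if_neg h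
lemma perD_eq {i j : ℤ} (h : i + 1 = j ∧ i < 0) : perD d i j = d := if_pos h

include hd in
lemma perD_perD (i j l : ℤ) (x : I) : perD d j l (perD d i j x) = 0 := by
  by_cases h : i + 1 = j ∧ i < 0
  · by_cases h' : j + 1 = l ∧ j < 0
    · rw [perD_eq d h, perD_eq d h', hd]
    · rw [perD_zero d h']; rfl
  · rw [perD_zero d h]; simp

def perC : CochainComplex (ModuleCat.{u} R) ℤ where
  X _ := ModuleCat.of R I
  d i j := ModuleCat.ofHom (perD d i j)
  shape i j h := by
    rw [perD_zero d (fun h' => h h'.1)]; rfl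
  d_comp_d' i j l _ _ := by
    ext x
    exact perD_perD d hd i j l x

def perφ : (perC d hd).X 0 ⟶ ModuleCat.of R (LinearMap.range d) := ModuleCat.ofHom d.rangeRestrict

def perToT : perC d hd ⟶ (HomologicalComplex.single (ModuleCat.{u} R) (ComplexShape.up ℤ) 0).obj
    (ModuleCat.of R (LinearMap.range d)) :=
  HomologicalComplex.mkHomToSingle (perφ d hd) (fun i hi => by
    ext x
    have hi : i + 1 = 0 := hi
    change d (perD d i 0 x) = 0
    rw [perD_eq d ⟨hi, by lia⟩]
    exact hd x)

variable (K : Submodule R I) (hK : LinearMap.range d ≤ K)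
  (hK1 : ∀ y, ∃ x ∈ K, d x = d y) (hK2 : ∀ x ∈ K, d x = 0 → x ∈ LinearMap.range d)

def perSubD : SubC (perC d hd) where
  N i := if i ≤ 0 then K else ⊥
  hN i j := by
    intro x hx
    change perD d i j x ∈ (if j ≤ 0 then K else ⊥ : Submodule R I)
    by_cases h : i + 1 = j ∧ i < 0
    · rw [perD_eq d h, if_pos (by lia)]
      exact hK ⟨x, rfl⟩
    · rw [perD_zero d h]; exact zero_mem _

def perSubE : SubC (perC d hd) where
  N i := if i < 0 then K else if i = 0 then LinearMap.range d else ⊥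
  hN i j := by
    intro x hx
    change perD d i j x ∈ (if j < 0 then K else if j = 0 then LinearMap.range d else ⊥ :
      Submodule R I)
    by_cases h : i + 1 = j ∧ i < 0
    · rw [perD_eq d h]
      split_ifs with h1 h2
      · exact hK ⟨x, rfl⟩
      · exact ⟨x, rfl⟩
      · lia
    · rw [perD_zero d h]; exact zero_mem _

lemma perLE (i : ℤ) : (perSubE d hd K hK).N i ≤ (perSubD d hd K hK).N i := by
  change (if i < 0 then K else if i = 0 then LinearMap.range d else ⊥ :
      Submodule R I) ≤ (if i ≤ 0 then K else ⊥ : Submodule R I)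
  split_ifs with h1 h2 h3 h4 h5
  · exact le_rfl
  · lia
  · exact hK
  · lia
  · exact bot_le
  · exact bot_le

def perG : (perSubD d hd K hK).toC ⟶
    (HomologicalComplex.single (ModuleCat.{u} R) (ComplexShape.up ℤ) 0).obj
    (ModuleCat.of R (LinearMap.range d)) := (perSubD d hd K hK).incl ≫ perToT d hd


abbrev perσ : ((HomologicalComplex.single (ModuleCat.{u} R) (ComplexShape.up ℤ) 0).obj
    (ModuleCat.of R (LinearMap.range d))).X 0 ≅ ModuleCat.of R (LinearMap.range d) :=
  HomologicalComplex.singleObjXSelf (ComplexShape.up ℤ) 0 (ModuleCat.of R (LinearMap.range d))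

lemma perG_f : (perG d hd K hK).f 0 ≫ (perσ d).hom =
    ((perSubD d hd K hK).incl.f 0) ≫ perφ d hd := by
  rw [perG, HomologicalComplex.comp_f, perToT, HomologicalComplex.mkHomToSingle_f]
  simp

lemma perG_f_apply (x) : (perσ d).hom.hom (((perG d hd K hK).f 0).hom x) =
    d.rangeRestrict x.1 := by
  exact congr_arg (fun f => f.hom x) (perG_f d hd K hK)

lemma perσ_inj (x) (h : (perσ d).hom.hom x = 0) : x = 0 := by
  have h2 : (perσ d).inv.hom ((perσ d).hom.hom x) = x := by
    rw [← ModuleCat.comp_apply]; simp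
  rw [← h2, h, map_zero]

lemma perG_zero (x) (h : ((perG d hd K hK).f 0).hom x = 0) : d x.1 = 0 := by
  have h1 := perG_f_apply d hd K hK x
  rw [h, map_zero] at h1
  exact congr_arg Subtype.val h1.symm

lemma perE_perG : SubC.mapLE (perLE d hd K hK) ≫ perG d hd K hK = 0 := by
  refine HomologicalComplex.hom_ext _ _ fun i => ?_
  by_cases hi : i = 0
  · subst hi
    ext x
    apply perσ_inj
    have h1 := perG_f_apply d hd K hK (((SubC.mapLE (perLE d hd K hK)).f 0).hom x)
    refine h1.trans ?_
    apply Subtype.ext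
    obtain ⟨y, hy⟩ : x.1 ∈ LinearMap.range d := x.2
    change d x.1 = 0
    rw [← hy]; exact hd y
  · have := HomologicalComplex.isZero_single_obj_X (ComplexShape.up ℤ) 0
      (ModuleCat.of R (LinearMap.range d)) i hi
    exact this.eq_of_tgt _ _

include hK1 hK2 in
lemma per_ses : (ShortComplex.mk _ _ (perE_perG d hd K hK)).ShortExact := by
  apply shortExact_of
  · intro i
    exact Submodule.inclusion_injective (perLE d hd K hK i)
  · intro i y
    by_cases hi : i = 0
    · subst hi
      obtain ⟨z, hz⟩ := ((perσ d).hom.hom y).2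
      obtain ⟨x, hxK, hx⟩ := hK1 z
      refine ⟨⟨x, hxK⟩, ?_⟩
      rw [← sub_eq_zero]
      apply perσ_inj
      rw [map_sub, sub_eq_zero]
      refine (perG_f_apply d hd K hK ⟨x, hxK⟩).trans ?_
      apply Subtype.ext
      exact hx.trans hz
    · have := HomologicalComplex.isZero_single_obj_X (ComplexShape.up ℤ) 0
        (ModuleCat.of R (LinearMap.range d)) i hi
      have := ModuleCat.subsingleton_of_isZero this
      exact ⟨0, Subsingleton.elim _ _⟩
  · intro i x hx
    suffices h : x.1 ∈ (perSubE d hd K hK).N i from ⟨⟨x.1, h⟩, rfl⟩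
    have hx2 : x.1 ∈ (if i ≤ 0 then K else ⊥ : Submodule R I) := x.2
    change x.1 ∈ (if i < 0 then K else if i = 0 then LinearMap.range d else ⊥ : Submodule R I)
    by_cases hi : i = 0
    · subst hi
      have := perG_zero d hd K hK x hx
      rw [if_neg (by lia), if_pos rfl]
      rw [if_pos (by lia)] at hx2
      exact hK2 _ hx2 this
    · by_cases hi2 : i < 0
      · rw [if_pos hi2]; rwa [if_pos (by lia)] at hx2
      · rw [if_neg hi2, if_neg hi]; rwa [if_neg (by lia)] at hx2

include hK1 hK2 in
lemma perE_exact (i : ℤ) : ((perSubE d hd K hK).toC).ExactAt i := by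
  rw [HomologicalComplex.exactAt_iff' _ (i-1) i (i+1) (by simp) (by simp),
    ShortComplex.moduleCat_exact_iff]
  intro x hx
  have hx2 : x.1 ∈ (if i < 0 then K else if i = 0 then LinearMap.range d else ⊥ :
    Submodule R I) := x.2
  have hx3 : perD d i (i+1) x.1 = 0 := congr_arg Subtype.val hx
  suffices h : ∃ y ∈ (perSubE d hd K hK).N (i-1), perD d (i-1) i y = x.1 by
    obtain ⟨y, hy, h⟩ := h
    exact ⟨⟨y, hy⟩, Subtype.ext h⟩
  by_cases hi : i ≤ 0
  · have hr : x.1 ∈ LinearMap.range d := by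
      split_ifs at hx2 with h1 h2
      · rw [perD_eq d ⟨rfl, h1⟩] at hx3
        exact hK2 _ hx2 hx3
      · exact hx2
      · lia
    obtain ⟨z, hz⟩ := hr
    obtain ⟨y, hyK, hy⟩ := hK1 z
    refine ⟨y, ?_, ?_⟩
    · change y ∈ (if i - 1 < 0 then K else if i - 1 = 0 then LinearMap.range d else ⊥ :
        Submodule R I)
      rw [if_pos (show i - 1 < 0 by lia)]; exact hyK
    · rw [perD_eq d ⟨by lia, by lia⟩]
      exact hy.trans hz
  · rw [if_neg (by lia), if_neg (by lia)] at hx2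
    have hx4 : (x.1 : I) = 0 := (Submodule.mem_bot R (M := I)).mp hx2
    exact ⟨0, zero_mem _, (map_zero (perD d (i-1) i)).trans hx4.symm⟩

end Per

lemma Q_isZero {R : Type u} [Ring R] [HasDerivedCategory.{w'} (ModuleCat.{u} R)]
    (E : CochainComplex (ModuleCat.{u} R) ℤ) (h : ∀ i, E.ExactAt i) : IsZero (Q.obj E) := by
  have : QuasiIso (0 : E ⟶ E) := by
    rw [quasiIso_iff]
    intro i
    rw [quasiIsoAt_iff_isIso_homologyMap]
    have hz := (HomologicalComplex.exactAt_iff_isZero_homology _ _).mp (h i)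
    exact ⟨0, hz.eq_of_src _ _, hz.eq_of_src _ _⟩
  have h2 : IsIso (Q.map (0 : E ⟶ E)) := inferInstance
  rw [Functor.map_zero] at h2
  rw [IsZero.iff_id_eq_zero]
  have := IsIso.hom_inv_id (0 : Q.obj E ⟶ Q.obj E)
  rw [← this, zero_comp]

section Per2
variable {R : Type u} [Ring R] [HasDerivedCategory.{w'} (ModuleCat.{u} R)]
variable {S : Set (DerivedCategory (ModuleCat.{u} R))} (hS : Loc S)
  {I : Type u} [AddCommGroup I] [Module R I]
  (d : I →ₗ[R] I) (hd : ∀ x, d (d x) = 0)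
  (hI : InS S (ModuleCat.of R I))

include hS hI in
lemma Loc.per_piece (A B : Submodule R I) (hA : A = ⊥ ∨ A = ⊤) (hB : B = ⊥ ∨ B = ⊤) :
    InS S (ModuleCat.of R (A ⧸ B.comap A.subtype)) := by
  rcases hA with rfl | rfl
  · exact hS.inS_zero _
  · rcases hB with rfl | rfl
    · refine hS.inS_equiv ?_ hI
      exact ((Submodule.quotEquivOfEqBot _ (by simp)).trans Submodule.topEquiv).symm
    · have : Subsingleton ((⊤ : Submodule R I) ⧸ (⊤ : Submodule R I).comap
        (⊤ : Submodule R I).subtype) := by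
        rw [Submodule.Quotient.subsingleton_iff]; simp
      exact hS.inS_zero _

def perN (m : ℕ) (i : ℤ) : Submodule R I := if 0 < m ∧ 0 < (m:ℤ) + i then ⊤ else ⊥

lemma perN_or (m i) : perN (R := R) (I := I) m i = ⊥ ∨ perN (R := R) (I := I) m i = ⊤ := by
  unfold perN; split_ifs <;> simp

include hS hI in
lemma Loc.perC_mem : Q.obj (perC d hd) ∈ S := by
  refine hS.filt (X := perC d hd) (fun m i => perN (R := R) (I := I) m i) ?_ ?_ ?_ ?_ ?_
  · intro i; exact if_neg (by lia)
  · intro m i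
    change perN (R := R) (I := I) m i ≤ perN (R := R) (I := I) (m+1) i
    unfold perN
    split_ifs
    · exact le_rfl
    · lia
    · exact bot_le
    · exact bot_le
  · intro m i j (x : I) hx
    have hx : x ∈ perN (R := R) (I := I) (m+1) i := hx
    change perD d i j x ∈ perN (R := R) (I := I) m j
    by_cases h : i + 1 = j ∧ i < 0
    · unfold perN at hx ⊢
      by_cases hm : 0 < m + 1 ∧ 0 < ((m + 1 : ℕ) : ℤ) + i
      · rw [if_pos (by lia)]; trivial
      · rw [if_neg hm] at hx
        rw [(Submodule.mem_bot R).mp hx, map_zero]; exact zero_mem _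
    · rw [perD_zero d h]; exact zero_mem _
  · intro i x
    refine ⟨i.natAbs + 1, ?_⟩
    change x ∈ perN (R := R) (I := I) (i.natAbs + 1) i
    unfold perN
    rw [if_pos (by lia)]; trivial
  · intro m i
    exact hS.per_piece hI _ _ (perN_or _ _) (perN_or _ _)

include hS hI hd in
lemma Loc.per (K : Submodule R I) (hK : LinearMap.range d ≤ K)
    (hK1 : ∀ y, ∃ x ∈ K, d x = d y) (hK2 : ∀ x ∈ K, d x = 0 → x ∈ LinearMap.range d) :
    InS S (ModuleCat.of R (LinearMap.range d)) := by
  have hses := per_ses d hd K hK hK1 hK2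
  have hz := Q_isZero _ (perE_exact d hd K hK hK1 hK2)
  have hiso : IsIso (Q.map (perG d hd K hK)) :=
    (Triangle.isZero₁_iff_isIso₂ _ (triangleOfSES_distinguished hses)).mp hz
  have h1 : Q.obj ((HomologicalComplex.single (ModuleCat.{u} R) (ComplexShape.up ℤ) 0).obj
    (ModuleCat.of R (LinearMap.range d))) ∈ S := by
    refine hS.retract (inv (Q.map (perG d hd K hK)) ≫ Q.map (perSubD d hd K hK).incl)
      (Q.map (perToT d hd)) ?_ (hS.perC_mem d hd hI)
    rw [Category.assoc, ← Functor.map_comp]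
    exact IsIso.inv_hom_id _
  exact hS.iso _ _ (Iso.refl _) h1

end Per2
end InjGen
end


noncomputable section

namespace InjGen


open DerivedCategory

structure Dat (k : Type u) [Field k] (n : ℕ) (R : Type u) [Ring R] [Algebra k R] where
  p : R →+* (Fin n → k)
  q : R →+* (Fin n → k)
  c : R →+ (Fin n → k)
  μ : R →+ (Fin n → k)
  c_mul : ∀ x y, c (x * y) = q x * c y + c x * q y
  μ_mul : ∀ x y, μ (x * y) = q x * μ y + μ x * p y
  q_alg : ∀ a i, q (algebraMap k R a) i = a
  c_alg : ∀ a, c (algebraMap k R a) = 0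
  μ_alg : ∀ a, μ (algebraMap k R a) = 0
  M : Fin n → R
  E : Fin n → R
  U : Fin n → R
  M_mul : ∀ i y, M i * y = p y i • M i
  E_mul : ∀ i y, E i * y = q y i • E i
  U_mul : ∀ i y, U i * y = q y i • U i + c y i • E i + μ y i • M i
  qM : ∀ i, q (M i) i = 0
  cM : ∀ i, c (M i) i = 0
  μM : ∀ i, μ (M i) i = 1
  qE : ∀ i, q (E i) i = 0
  cE : ∀ i, c (E i) i = 1
  μE : ∀ i, μ (E i) i = 0
  qU : ∀ i, q (U i) i = 1
  cU : ∀ i, c (U i) i = 0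
  μU : ∀ i, μ (U i) i = 0
  surj : ∀ s t, ∃ x, p x = s ∧ q x = t
  rad : ∀ x, p x = 0 → q x = 0 → ∃ z, z * (x + 1) = 1

section
variable {k : Type u} [Field k] {n : ℕ} {R : Type u} [Ring R] [Algebra k R] (D : Dat k n R)

@[ext] structure Dat.I (D : Dat k n R) : Type u where
  s : Fin n → k
  b : Fin n → k
  e : Fin n → k

lemma Dat.c_one : D.c 1 = 0 := by simpa using D.c_alg 1
lemma Dat.μ_one : D.μ 1 = 0 := by simpa using D.μ_alg 1

def Dat.eqv (D : Dat k n R) : D.I ≃ (Fin n → k) × (Fin n → k) × (Fin n → k) where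
  toFun x := (x.s, x.b, x.e)
  invFun x := ⟨x.1, x.2.1, x.2.2⟩

instance : AddCommGroup D.I := D.eqv.addCommGroup

@[simp] lemma Dat.add_s (x y : D.I) : (x + y).s = x.s + y.s := rfl
@[simp] lemma Dat.add_b (x y : D.I) : (x + y).b = x.b + y.b := rfl
@[simp] lemma Dat.add_e (x y : D.I) : (x + y).e = x.e + y.e := rfl
@[simp] lemma Dat.zero_s : (0 : D.I).s = 0 := rfl
@[simp] lemma Dat.zero_b : (0 : D.I).b = 0 := rfl
@[simp] lemma Dat.zero_e : (0 : D.I).e = 0 := rfl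

instance : SMul R D.I := ⟨fun x y => ⟨D.p x * y.s, D.q x * y.b, D.q x * y.e + D.c x * y.b + D.μ x * y.s⟩⟩

@[simp] lemma Dat.smul_s (r : R) (y : D.I) : (r • y).s = D.p r * y.s := rfl
@[simp] lemma Dat.smul_b (r : R) (y : D.I) : (r • y).b = D.q r * y.b := rfl
@[simp] lemma Dat.smul_e (r : R) (y : D.I) :
  (r • y).e = D.q r * y.e + D.c r * y.b + D.μ r * y.s := rfl

instance : Module R D.I where
  one_smul x := by
    apply Dat.I.ext <;> simp [D.c_one, D.μ_one]
  mul_smul r t x := by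
    apply Dat.I.ext
    · simp [mul_assoc]
    · simp [mul_assoc]
    · simp [D.c_mul, D.μ_mul]; ring
  smul_zero r := by apply Dat.I.ext <;> simp
  smul_add r x y := by
    apply Dat.I.ext
    · simp [mul_add]
    · simp [mul_add]
    · simp; ring
  zero_smul r := by apply Dat.I.ext <;> simp
  add_smul r x y := by
    apply Dat.I.ext
    · simp [add_mul]
    · simp [add_mul]
    · simp; ring

lemma Dat.baer : Module.Baer R D.I := by
  intro L f
  have hsm : ∀ (a : k) (x : R), a • x = algebraMap k R a * x := fun a x => Algebra.smul_def a x
  let g : Fin n → (L.restrictScalars k) →ₗ[k] k := fun i =>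
    { toFun := fun x => (f ⟨x.1, x.2⟩).e i
      map_add' := fun x y => by
        have : f ⟨(x + y).1, (x+y).2⟩ = f ⟨x.1, x.2⟩ + f ⟨y.1, y.2⟩ := by
          rw [← map_add]; rfl
        rw [this]; rfl
      map_smul' := fun a x => by
        have : f ⟨(a • x).1, (a • x).2⟩ = algebraMap k R a • f ⟨x.1, x.2⟩ := by
          rw [← map_smul]; congr 1; apply Subtype.ext; exact hsm a x
        rw [this, D.smul_e, D.c_alg, D.μ_alg]
        simp [D.q_alg] }
  have hg : ∀ i x hx, g i ⟨x, hx⟩ = (f ⟨x, hx⟩).e i := fun _ _ _ => rfl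
  choose h hh using fun i => LinearMap.exists_extend (g i)
  have hh' : ∀ i x (hx : x ∈ L), h i x = (f ⟨x, hx⟩).e i := fun i x hx =>
    LinearMap.congr_fun (hh i) ⟨x, hx⟩
  refine ⟨{ toFun := fun x => ⟨fun i => h i (D.M i * x), fun i => h i (D.E i * x),
              fun i => h i (D.U i * x)⟩
            map_add' := fun x y => by
              apply Dat.I.ext <;> funext i <;> simp [mul_add]
            map_smul' := fun y x => by
              apply Dat.I.ext <;> funext i
              · simp [← mul_assoc, D.M_mul]
              · simp [← mul_assoc, D.E_mul]
              · change h i (D.U i * (y * x)) = D.q y i * h i (D.U i * x) + D.c y i * h i (D.E i * x) +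
                  D.μ y i * h i (D.M i * x)
                rw [← mul_assoc, D.U_mul, add_mul, add_mul, smul_mul_assoc, smul_mul_assoc,
                  smul_mul_assoc, map_add, map_add, map_smul, map_smul, map_smul]
                rfl }, ?_⟩
  intro x hx
  have key : ∀ r : R, ∀ i, h i (r * x) = (r • f ⟨x, hx⟩).e i := fun r i => by
    rw [hh' i _ (L.mul_mem_left r hx), ← map_smul]; rfl
  apply Dat.I.ext <;> funext i
  · simp [key, D.qM, D.cM, D.μM]
  · simp [key, D.qE, D.cE, D.μE]
  · simp [key, D.qU, D.cU, D.μU]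

lemma Dat.inj : Injective (ModuleCat.of R D.I) := by
  have := D.baer.injective
  exact Module.injective_object_of_injective_module R D.I

def Dat.d : D.I →ₗ[R] D.I where
  toFun x := ⟨0, 0, x.b⟩
  map_add' x y := by apply Dat.I.ext <;> simp
  map_smul' r x := by apply Dat.I.ext <;> simp

lemma Dat.mem_range (x : D.I) : x ∈ LinearMap.range D.d ↔ x.s = 0 ∧ x.b = 0 := by
  constructor
  · rintro ⟨y, rfl⟩; exact ⟨rfl, rfl⟩
  · rintro ⟨h1, h2⟩
    refine ⟨⟨0, x.e, 0⟩, ?_⟩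
    apply Dat.I.ext
    · exact h1.symm
    · exact h2.symm
    · rfl

def Dat.K : Submodule R D.I where
  carrier := {x | x.s = 0}
  add_mem' {x y} hx hy := by
    change x.s + y.s = 0
    rw [show x.s = 0 from hx, show y.s = 0 from hy, add_zero]
  zero_mem' := rfl
  smul_mem' r x hx := by
    change D.p r * x.s = 0
    rw [show x.s = 0 from hx, mul_zero]

def Dat.ρ : R →+* (Fin n → k) × (Fin n → k) := D.p.prod D.q

def Dat.ψ : R →ₗ[R] D.I ⧸ LinearMap.range D.d :=
  (LinearMap.range D.d).mkQ ∘ₗ LinearMap.toSpanSingleton R D.I ⟨1, 1, 0⟩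

lemma Dat.ψ_surj : Function.Surjective D.ψ := by
  intro y
  obtain ⟨y, rfl⟩ := Submodule.mkQ_surjective _ y
  obtain ⟨x, h1, h2⟩ := D.surj y.s y.b
  refine ⟨x, ?_⟩
  refine (Submodule.Quotient.eq _).mpr ?_
  rw [D.mem_range]
  have : ∀ a b : D.I, a - b = a + -b := sub_eq_add_neg
  constructor
  · change D.p x * 1 - y.s = 0
    rw [h1]; simp
  · change D.q x * 1 - y.b = 0
    rw [h2]; simp

lemma Dat.ψ_ker : LinearMap.ker D.ψ = (RingHom.ker D.ρ : Ideal R) := by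
  ext x
  rw [LinearMap.mem_ker]
  refine (Submodule.Quotient.mk_eq_zero _).trans ?_
  rw [D.mem_range, RingHom.mem_ker]
  change D.p x * 1 = 0 ∧ D.q x * 1 = 0 ↔ (D.p x, D.q x) = 0
  simp

theorem Dat.main (D : Dat k n R) [FiniteDimensional k R] [HasDerivedCategory.{w'} (ModuleCat.{u} R)]
    {S : Set (DerivedCategory (ModuleCat.{u} R))} (hS : Loc S)
    (hinj : ∀ M : ModuleCat.{u} R, Injective M → InS S M) (Y) : Y ∈ S := by
  have hI := hinj _ D.inj
  have hT : InS S (ModuleCat.of R (LinearMap.range D.d)) := by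
    refine hS.per D.d (fun _ => rfl) hI D.K ?_ ?_ ?_
    · rintro _ ⟨x, rfl⟩; rfl
    · intro y; exact ⟨⟨0, y.b, 0⟩, rfl, rfl⟩
    · intro x hx h
      rw [D.mem_range]
      exact ⟨hx, congr_arg Dat.I.e h⟩
  have hQ := hS.inS_sub₃ _ hT hI
  have hJ : InS S (ModuleCat.of R (R ⧸ RingHom.ker D.ρ)) :=
    hS.inS_equiv (((Submodule.quotEquivOfEq _ _ D.ψ_ker).symm.trans
      (D.ψ.quotKerEquivOfSurjective D.ψ_surj)).symm) hQ
  have hs : Function.Surjective D.ρ := by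
    rintro ⟨a, b⟩
    obtain ⟨x, h1, h2⟩ := D.surj a b
    exact ⟨x, Prod.ext h1 h2⟩
  have : IsSemisimpleRing (R ⧸ RingHom.ker D.ρ) :=
    (RingHom.quotientKerEquivOfSurjective hs).symm.isSemisimpleRing
  have : IsArtinianRing R := IsArtinianRing.of_finite k R
  refine hS.all_of_nilp (RingHom.ker D.ρ) hJ (nilp_of_le _ ?_) Y
  intro x hx
  have : D.ρ x = 0 := hx
  rw [Ideal.mem_jacobson_iff]
  intro y
  have h2 : D.ρ (y * x) = 0 := by rw [map_mul, this, mul_zero]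
  obtain ⟨z, hz⟩ := D.rad (y * x) (congr_arg Prod.fst h2) (congr_arg Prod.snd h2)
  refine ⟨z, ?_⟩
  rw [Submodule.mem_bot, ← hz]
  noncomm_ring

/-- transport along the double opposite -/
def Dat.op2 (D : Dat k n R) : Dat k n Rᵐᵒᵖᵐᵒᵖ where
  p := D.p.comp (RingEquiv.opOp R).symm.toRingHom
  q := D.q.comp (RingEquiv.opOp R).symm.toRingHom
  c := D.c.comp (RingEquiv.opOp R).symm.toRingHom.toAddMonoidHom
  μ := D.μ.comp (RingEquiv.opOp R).symm.toRingHom.toAddMonoidHom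
  c_mul x y := D.c_mul _ _
  μ_mul x y := D.μ_mul _ _
  q_alg a i := D.q_alg a i
  c_alg a := D.c_alg a
  μ_alg a := D.μ_alg a
  M i := op (op (D.M i))
  E i := op (op (D.E i))
  U i := op (op (D.U i))
  M_mul i y := congr_arg (fun x => op (op x)) (D.M_mul i (unop (unop y)))
  E_mul i y := congr_arg (fun x => op (op x)) (D.E_mul i (unop (unop y)))
  U_mul i y := congr_arg (fun x => op (op x)) (D.U_mul i (unop (unop y)))
  qM := D.qM
  cM := D.cM
  μM := D.μM
  qE := D.qE
  cE := D.cE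
  μE := D.μE
  qU := D.qU
  cU := D.cU
  μU := D.μU
  surj s t := by
    obtain ⟨x, h1, h2⟩ := D.surj s t
    exact ⟨op (op x), h1, h2⟩
  rad x h1 h2 := by
    obtain ⟨z, hz⟩ := D.rad (unop (unop x)) h1 h2
    exact ⟨op (op z), congr_arg (fun x => op (op x)) hz⟩
end
end InjGen
end

noncomputable section

namespace InjGen

section Concrete
variable (k : Type u) [Field k] (n : ℕ) (A : Type u) [Ring A] [Algebra k A]
  (π : A →ₐ[k] (Fin n → k))
  [Module (A × ConstrB k n) (Fin n → k)] [Module (A × ConstrB k n)ᵐᵒᵖ (Fin n → k)]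
  [SMulCommClass (A × ConstrB k n) (A × ConstrB k n)ᵐᵒᵖ (Fin n → k)]
  (hl : ∀ (x : A × ConstrB k n) (m : Fin n → k), x • m = constrBproj k n x.2 * m)
  (hr : ∀ (x : A × ConstrB k n) (m : Fin n → k), op x • m = m * π x.1)

abbrev AT := TrivSqZeroExt (A × ConstrB k n) (Fin n → k)

lemma constrBproj_apply (b : ConstrB k n) (i : Fin n) : constrBproj k n b i = (b i).fst := rfl

include hl in
lemma tower1 : IsScalarTower k (A × ConstrB k n) (Fin n → k) := ⟨fun a x m => by
  rw [hl, hl]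
  simp⟩

include hr in
lemma tower2 : IsScalarTower k (A × ConstrB k n)ᵐᵒᵖ (Fin n → k) := ⟨fun a x m => by
  induction x using MulOpposite.rec' with | _ x =>
  rw [← MulOpposite.op_smul, hr, hr]
  simp⟩

variable [FiniteDimensional k A] [IsScalarTower k (A × ConstrB k n) (Fin n → k)]
  [IsScalarTower k (A × ConstrB k n)ᵐᵒᵖ (Fin n → k)]

lemma finAT : Module.Finite k (AT k n A) := by
  have : Module.Finite k (DualNumber k) := inferInstanceAs (Module.Finite k (k × k))
  exact inferInstanceAs (Module.Finite k ((A × ConstrB k n) × (Fin n → k)))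

lemma unit_fst (hker : RingHom.ker π = Ideal.jacobson (⊥ : Ideal A)) (x : A × ConstrB k n)
    (h1 : π x.1 = 0) (h2 : constrBproj k n x.2 = 0) : IsUnit (x + 1) := by
  apply IsNilpotent.isUnit_add_one
  have : IsArtinianRing A := IsArtinianRing.of_finite k A
  obtain ⟨m, hm⟩ := IsArtinianRing.isNilpotent_jacobson_bot (R := A)
  have h3 : x.1 ^ m = 0 := by
    have : x.1 ∈ Ideal.jacobson (⊥ : Ideal A) := by rw [← hker]; exact h1
    have := Ideal.pow_mem_pow this m
    rw [hm] at this
    exact this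
  have h4 : x.2 ^ 2 = 0 := by
    funext i
    have : (x.2 i).fst = 0 := congr_fun h2 i
    rw [sq]
    apply TrivSqZeroExt.ext <;> simp [this]
  refine ⟨m + 2, ?_⟩
  refine Prod.ext ?_ ?_
  · simp [pow_add, h3]
  · simp [pow_add, h4]

open Classical in
def datAT (hsurj : Function.Surjective π)
    (hker : RingHom.ker π = Ideal.jacobson (⊥ : Ideal A)) : Dat k n (AT k n A) where
  p := (π.toRingHom.comp (RingHom.fst A (ConstrB k n))).comp
    (TrivSqZeroExt.fstHom k (A × ConstrB k n) (Fin n → k)).toRingHom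
  q := ((constrBproj k n).toRingHom.comp (RingHom.snd A (ConstrB k n))).comp
    (TrivSqZeroExt.fstHom k (A × ConstrB k n) (Fin n → k)).toRingHom
  c := { toFun := fun x i => (x.fst.2 i).snd
         map_zero' := rfl
         map_add' := fun _ _ => rfl }
  μ := { toFun := fun x => x.snd
         map_zero' := rfl
         map_add' := fun _ _ => rfl }
  c_mul x y := by
    funext i
    change (((x * y).fst.2 i)).snd = (x.fst.2 i).fst * (y.fst.2 i).snd +
      (x.fst.2 i).snd * (y.fst.2 i).fst
    simp [mul_comm]
  μ_mul x y := by
    change (x * y).snd = constrBproj k n x.fst.2 * y.snd + x.snd * π y.fst.1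
    rw [TrivSqZeroExt.snd_mul, hl, hr]
  q_alg a i := by
    change (((algebraMap k (AT k n A) a).fst.2 i)).fst = a
    rfl
  c_alg a := rfl
  μ_alg a := rfl
  M i := inr (Pi.single i 1)
  E i := inl (0, Pi.single i (inr 1))
  U i := inl (0, Pi.single i (inl 1))
  M_mul i y := by
    change inr (Pi.single i 1) * y = π y.fst.1 i • inr (Pi.single i 1)
    apply TrivSqZeroExt.ext
    · simp
    · rw [TrivSqZeroExt.snd_mul, hl, hr]
      funext j
      by_cases h : j = i
      · subst h; simp
      · simp [h]
  E_mul i y := by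
    change inl (0, Pi.single i (inr 1)) * y = (y.fst.2 i).fst • inl (0, Pi.single i (inr 1))
    apply TrivSqZeroExt.ext
    · refine Prod.ext ?_ ?_
      · simp
      · funext j
        by_cases h : j = i
        · subst h
          apply TrivSqZeroExt.ext <;> simp
        · simp [h]
    · rw [TrivSqZeroExt.snd_mul, hl, hr]
      funext j
      by_cases h : j = i
      · subst h; simp [constrBproj_apply]
      · simp [h, constrBproj_apply]
  U_mul i y := by
    change inl (0, Pi.single i (inl 1)) * y = (y.fst.2 i).fst • inl (0, Pi.single i (inl 1)) +
      (y.fst.2 i).snd • inl (0, Pi.single i (inr 1)) + y.snd i • inr (Pi.single i 1)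
    apply TrivSqZeroExt.ext
    · refine Prod.ext ?_ ?_
      · simp
      · funext j
        by_cases h : j = i
        · subst h
          apply TrivSqZeroExt.ext <;> simp
        · simp [h]
    · rw [TrivSqZeroExt.snd_mul, hl, hr]
      funext j
      by_cases h : j = i
      · subst h; simp [constrBproj_apply]
      · simp [h, constrBproj_apply]
  qM i := rfl
  cM i := rfl
  μM i := by
    change (Pi.single i 1 : Fin n → k) i = 1
    simp
  qE i := by
    change ((Pi.single i (inr 1) : ConstrB k n) i).fst = 0
    simp
  cE i := by
    change ((Pi.single i (inr 1) : ConstrB k n) i).snd = 1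
    simp
  μE i := rfl
  qU i := by
    change ((Pi.single i (inl 1) : ConstrB k n) i).fst = 1
    simp
  cU i := by
    change ((Pi.single i (inl 1) : ConstrB k n) i).snd = 0
    simp
  μU i := rfl
  surj s t := by
    obtain ⟨a, ha⟩ := hsurj s
    exact ⟨inl (a, fun i => inl (t i)), ha, rfl⟩
  rad x h1 h2 := by
    have h : IsUnit (x + 1) := by
      rw [TrivSqZeroExt.isUnit_iff_isUnit_fst]
      exact unit_fst k n A π hker x.fst h1 h2
    obtain ⟨u, hu⟩ := h
    exact ⟨↑u⁻¹, by rw [← hu, Units.inv_mul]⟩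

end Concrete

theorem concrete (k : Type u) [Field k] (n : ℕ) (A : Type u) [Ring A] [Algebra k A]
  (π : A →ₐ[k] (Fin n → k))
  [Module (A × ConstrB k n) (Fin n → k)] [Module (A × ConstrB k n)ᵐᵒᵖ (Fin n → k)]
  [SMulCommClass (A × ConstrB k n) (A × ConstrB k n)ᵐᵒᵖ (Fin n → k)]
  (hl : ∀ (x : A × ConstrB k n) (m : Fin n → k), x • m = constrBproj k n x.2 * m)
  (hr : ∀ (x : A × ConstrB k n) (m : Fin n → k), op x • m = m * π x.1)
  [FiniteDimensional k A] (hsurj : Function.Surjective π)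
    (hker : RingHom.ker π = Ideal.jacobson (⊥ : Ideal A)) :
    InjectivesGenerate (TrivSqZeroExt (A × ConstrB k n) (Fin n → k))ᵐᵒᵖ := by
  have := tower1 k n A hl
  have := tower2 k n A π hr
  have := finAT k n A
  letI : HasDerivedCategory (ModuleCat.{u} (AT k n A)ᵐᵒᵖᵐᵒᵖ) := HasDerivedCategory.standard _
  have : Module.Finite k (AT k n A)ᵐᵒᵖᵐᵒᵖ :=
    Module.Finite.equiv (AlgEquiv.opOp k (AT k n A)).toLinearEquiv
  intro S h1 h2 h3 h4 h5 X
  exact (datAT k n A π hl hr hsurj hker).op2.main ⟨h1, h2, h3, h4⟩ h5 X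

end InjGen
end

theorem injectives_generate_constr_op
    (k : Type u) [Field k] [IsAlgClosed k] (n : ℕ)
    (A : Type u) [Ring A] [Algebra k A] [FiniteDimensional k A]
    (π : A →ₐ[k] (Fin n → k)) (hsurj : Function.Surjective π)
    (hker : RingHom.ker π = Ideal.jacobson (⊥ : Ideal A)) :
    letI := constrLeftModule k n A
    letI := constrRightModule k n A π
    letI := constrSMulCommClass k n A π
    InjectivesGenerate (TrivSqZeroExt (A × ConstrB k n) (Fin n → k))ᵐᵒᵖ := by
  letI := constrLeftModule k n A
  letI := constrRightModule k n A π
  letI := constrSMulCommClass k n A π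
  exact InjGen.concrete k n A π (fun _ _ => rfl) (fun _ _ => mul_comm _ _) hsurj hker
end

section
/- Injectives generate for all finite dimensional algebras if and only if injective generation is left-right symmetric. Precisely: (for every field k and every finite dimensional k-algebra Λ, injectives generate for Λ) if and only if (for every field k and every finite dimensional k-algebra Λ, injectives generate for Λ implies injectives generate for Λᵒᵖ). -/
universe u

open CategoryTheory Limits Pretriangulated

universe v w
set_option linter.unusedVariables false
set_option linter.unusedSectionVars false

namespace IG

section
variable {C : Type u} [Category.{v} C] [Abelian C] {I : Type w} [HasColimitsOfShape (Discrete I) C]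

/-- complex of functors from a family of complexes -/
noncomputable def famC (X : I → CochainComplex C ℤ) :
    HomologicalComplex (Discrete I ⥤ C) (ComplexShape.up ℤ) where
  X n := Discrete.functor (fun i => (X i).X n)
  d n m := Discrete.natTrans (fun i => (X i.as).d n m)
  shape n m h := by
    ext ⟨i⟩; exact (X i).shape n m h
  d_comp_d' n m k _ _ := by
    ext ⟨i⟩; exact (X i).d_comp_d n m k

noncomputable def famMap {X Y : I → CochainComplex C ℤ} (s : ∀ i, X i ⟶ Y i) :
    famC X ⟶ famC Y where
  f n := Discrete.natTrans (fun i => (s i.as).f n)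
  comm' n m _ := by
    ext ⟨i⟩; exact (s i).comm n m

lemma famMap_qis {X Y : I → CochainComplex C ℤ} (s : ∀ i, X i ⟶ Y i) (hs : ∀ i, QuasiIso (s i)) :
    QuasiIso (famMap s) := by
  rw [HomologicalComplex.quasiIso_iff_evaluation]
  rintro ⟨i⟩
  exact hs i

noncomputable def famι (X : I → CochainComplex C ℤ) (i : I) :
    X i ⟶ ((colim.mapHomologicalComplex _).obj (famC X)) where
  f := fun n => colimit.ι ((famC X).X n) ⟨i⟩
  comm' := fun n m _ => ι_colimMap ((famC X).d n m) ⟨i⟩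

noncomputable def famDesc (X : I → CochainComplex C ℤ) (t : CochainComplex C ℤ)
    (g : ∀ i, X i ⟶ t) : ((colim.mapHomologicalComplex _).obj (famC X)) ⟶ t where
  f := fun n => colimit.desc ((famC X).X n) (Cocone.mk (t.X n)
        (Discrete.natTrans (fun i => (g i.as).f n)))
  comm' := fun n m _ => by
    apply colimit.hom_ext
    rintro ⟨i⟩
    refine (colimit.ι_desc_assoc _ _ _).trans ?_
    refine Eq.trans ?_ (ι_colimMap_assoc ((famC X).d n m) ⟨i⟩ _).symm
    have h := colimit.ι_desc (F := (famC X).X m)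
      (Cocone.mk (t.X m) (Discrete.natTrans (fun i => (g i.as).f m))) ⟨i⟩
    refine Eq.trans ?_ (congrArg (fun z => (X i).d n m ≫ z) h.symm)
    exact (g i).comm n m

lemma famι_desc (X : I → CochainComplex C ℤ) (t : CochainComplex C ℤ)
    (g : ∀ i, X i ⟶ t) (i : I) : famι X i ≫ famDesc X t g = g i := by
  ext n
  exact colimit.ι_desc (F := (famC X).X n) _ _

lemma fam_ext (X : I → CochainComplex C ℤ) (t : CochainComplex C ℤ)
    (g h : ((colim.mapHomologicalComplex _).obj (famC X)) ⟶ t)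
    (e : ∀ i, famι X i ≫ g = famι X i ≫ h) : g = h := by
  ext n
  apply colimit.hom_ext
  rintro ⟨i⟩
  exact HomologicalComplex.congr_hom (e i) n

lemma famι_map {X Y : I → CochainComplex C ℤ} (s : ∀ i, X i ⟶ Y i) (i : I) :
    famι X i ≫ (colim.mapHomologicalComplex _).map (famMap s) = s i ≫ famι Y i := by
  ext n
  exact ι_colimMap ((famMap s).f n) ⟨i⟩

lemma qis_coprod [HasExactColimitsOfShape (Discrete I) C]
    {X Y : I → CochainComplex C ℤ} (s : ∀ i, X i ⟶ Y i) (hs : ∀ i, QuasiIso (s i))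
    {c : Cofan X} (hc : IsColimit c) {c' : Cofan Y} (hc' : IsColimit c')
    (f : c.pt ⟶ c'.pt) (hf : ∀ i, c.inj i ≫ f = s i ≫ c'.inj i) : QuasiIso f := by
  have := famMap_qis s hs
  have h : QuasiIso ((colim.mapHomologicalComplex _).map (famMap s)) := inferInstance
  have key : ∀ (X : I → CochainComplex C ℤ) (c : Cofan X) (hc : IsColimit c),
      ∃ e : ((colim.mapHomologicalComplex _).obj (famC X)) ≅ c.pt,
        ∀ i, famι X i ≫ e.hom = c.inj i := by
    intro X c hc
    refine ⟨⟨famDesc X _ c.inj, Cofan.IsColimit.desc hc (famι X), ?_, ?_⟩, famι_desc _ _ _⟩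
    · apply fam_ext
      intro i
      simp [reassoc_of% (famι_desc X)]
    · apply Cofan.IsColimit.hom_ext hc
      intro i
      simp [famι_desc]
  obtain ⟨e, he⟩ := key X c hc
  obtain ⟨e', he'⟩ := key Y c' hc'
  refine ((HomologicalComplex.quasiIso C (ComplexShape.up ℤ)).arrow_mk_iso_iff ?_).1 h
  refine Arrow.isoMk e e' ?_
  apply fam_ext
  intro i
  dsimp
  rw [reassoc_of% (he i), hf i, reassoc_of% (famι_map s i), he']

lemma acyclic_iff_qis (Y : CochainComplex C ℤ) : Y.Acyclic ↔ QuasiIso (0 : Y ⟶ Y) := by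
  rw [quasiIso_iff]
  refine forall_congr' fun n => ?_
  rw [HomologicalComplex.exactAt_iff_isZero_homology, quasiIsoAt_iff_isIso_homologyMap,
    HomologicalComplex.homologyMap_zero]
  refine ⟨fun h => ⟨0, h.eq_of_src _ _, h.eq_of_src _ _⟩, fun h => ?_⟩
  rw [IsZero.iff_id_eq_zero]
  obtain ⟨g, h1, -⟩ := h
  rw [← h1, zero_comp]

lemma acyclic_coprod [HasExactColimitsOfShape (Discrete I) C]
    {X : I → CochainComplex C ℤ} (h : ∀ i, (X i).Acyclic)
    {c : Cofan X} (hc : IsColimit c) : c.pt.Acyclic := by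
  rw [acyclic_iff_qis]
  exact qis_coprod (fun i => (0 : X i ⟶ X i)) (fun i => (acyclic_iff_qis _).1 (h i)) hc hc 0
    (by simp)

end
end IG
namespace IG
section
variable {C : Type u} [Category.{v} C] [Abelian C] [HasDerivedCategory C]

lemma acyclic_iff_isZero_Q (X : CochainComplex C ℤ) :
    X.Acyclic ↔ IsZero (DerivedCategory.Q.obj X) := by
  rw [acyclic_iff_qis, ← DerivedCategory.isIso_Q_map_iff_quasiIso, Functor.map_zero]
  refine ⟨fun h => ?_, fun h => ⟨0, h.eq_of_src _ _, h.eq_of_src _ _⟩⟩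
  rw [IsZero.iff_id_eq_zero]
  obtain ⟨g, h1, -⟩ := h
  rw [← h1, zero_comp]

lemma Q_map_eq_zero {X Y : CochainComplex C ℤ} (g : X ⟶ Y)
    (hg : DerivedCategory.Q.map g = 0) :
    ∃ (W : CochainComplex C ℤ) (_ : W.Acyclic) (a : X ⟶ W) (b : W ⟶ Y), a ≫ b = g := by
  have h : DerivedCategory.Qh.map ((HomotopyCategory.quotient _ _).map g) =
      DerivedCategory.Qh.map ((HomotopyCategory.quotient _ _).map 0) := by
    rw [← cancel_mono ((DerivedCategory.quotientCompQhIso C).hom.app Y)]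
    rw [DerivedCategory.quotientCompQhIso_hom_naturality,
      DerivedCategory.quotientCompQhIso_hom_naturality, hg]
    simp
  rw [MorphismProperty.map_eq_iff_precomp DerivedCategory.Qh
    (HomotopyCategory.quasiIso C (ComplexShape.up ℤ))] at h
  obtain ⟨X', t, ht, h⟩ := h
  obtain ⟨X', rfl⟩ := HomotopyCategory.quotient_obj_surjective X'
  obtain ⟨t, rfl⟩ := (HomotopyCategory.quotient _ _).map_surjective t
  rw [← Functor.map_comp, ← Functor.map_comp] at h
  have H := HomotopyCategory.homotopyOfEq _ _ h
  have hq : QuasiIso t := (HomotopyCategory.quotient_map_mem_quasiIso_iff t).1 ht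
  have H' : Homotopy (t ≫ g) 0 := H.trans (Homotopy.ofEq (by simp))
  refine ⟨CochainComplex.mappingCone t, ?_, CochainComplex.mappingCone.inr t,
    CochainComplex.mappingCone.desc t (CochainComplex.HomComplex.Cochain.ofHomotopy H') g
      (by simp), by simp⟩
  rw [acyclic_iff_isZero_Q]
  have : IsIso (DerivedCategory.Q.map t) := inferInstance
  exact (Triangle.isZero₃_iff_isIso₁ _
    (DerivedCategory.mappingCone_triangle_distinguished t)).2 this

variable {I : Type w} [HasColimitsOfShape (Discrete I) C] [HasExactColimitsOfShape (Discrete I) C]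

lemma Q_coprod_uniq {X : I → CochainComplex C ℤ} {c : Cofan X} (hc : IsColimit c)
    {Y : CochainComplex C ℤ}
    (φ : DerivedCategory.Q.obj c.pt ⟶ DerivedCategory.Q.obj Y)
    (h : ∀ i, DerivedCategory.Q.map (c.inj i) ≫ φ = 0) : φ = 0 := by
  obtain ⟨Y', g, s, hs, rfl⟩ := DerivedCategory.left_fac φ
  have h' : ∀ i, DerivedCategory.Q.map (c.inj i ≫ g) = 0 := fun i => by
    have := h i
    rw [← cancel_mono (inv (DerivedCategory.Q.map s)), Functor.map_comp, Category.assoc, this,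
      zero_comp]
  choose W hW a b hab using fun i => Q_map_eq_zero _ (h' i)
  have : HasColimit (Discrete.functor W) := inferInstance
  have hz := (acyclic_iff_isZero_Q _).1 (acyclic_coprod hW (colimit.isColimit (Discrete.functor W)))
  have e : g = Cofan.IsColimit.desc hc (fun i => a i ≫ Sigma.ι W i) ≫ Sigma.desc b := by
    apply Cofan.IsColimit.hom_ext hc
    intro i
    simp [hab]
  have e2 : DerivedCategory.Q.map g = 0 := by
    rw [e, Functor.map_comp]
    rw [hz.eq_of_src (DerivedCategory.Q.map (Sigma.desc b)) 0, comp_zero]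
  rw [e2, zero_comp]

lemma Q_coprod_exists {X : I → CochainComplex C ℤ} {c : Cofan X} (hc : IsColimit c)
    {Y : CochainComplex C ℤ}
    (φ : ∀ i, DerivedCategory.Q.obj (X i) ⟶ DerivedCategory.Q.obj Y) :
    ∃ ψ : DerivedCategory.Q.obj c.pt ⟶ DerivedCategory.Q.obj Y,
      ∀ i, DerivedCategory.Q.map (c.inj i) ≫ ψ = φ i := by
  choose X' s hs g hφ using fun i => DerivedCategory.right_fac (φ i)
  have hs' : ∀ i, QuasiIso (s i) := fun i => (DerivedCategory.isIso_Q_map_iff_quasiIso C _).1 (hs i)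
  let d := colimit.isColimit (Discrete.functor X')
  let t : (∐ X') ⟶ c.pt := Sigma.desc (fun i => s i ≫ c.inj i)
  have ht : QuasiIso t := qis_coprod s hs' d hc t (fun i => Sigma.ι_desc _ _)
  refine ⟨inv (DerivedCategory.Q.map t) ≫ DerivedCategory.Q.map (Sigma.desc g), fun i => ?_⟩
  rw [hφ i, ← cancel_epi (DerivedCategory.Q.map (s i)), IsIso.hom_inv_id_assoc,
    ← Functor.map_comp_assoc]
  have : s i ≫ c.inj i = Sigma.ι X' i ≫ t := by simp [t]
  rw [this, Functor.map_comp_assoc, IsIso.hom_inv_id_assoc, ← Functor.map_comp, Sigma.ι_desc]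

/-- The localization functor sends coproducts to coproducts. -/
noncomputable def QCofanIsColimit {X : I → CochainComplex C ℤ} {c : Cofan X} (hc : IsColimit c) :
    IsColimit (Cofan.mk (DerivedCategory.Q.obj c.pt) (fun i => DerivedCategory.Q.map (c.inj i)) :
      Cofan (fun i => DerivedCategory.Q.obj (X i))) := by
  have ex : ∀ (Z : DerivedCategory C) (φ : ∀ i, DerivedCategory.Q.obj (X i) ⟶ Z),
      ∃ ψ : DerivedCategory.Q.obj c.pt ⟶ Z, ∀ i, DerivedCategory.Q.map (c.inj i) ≫ ψ = φ i := by
    intro Z φ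
    let e := DerivedCategory.Q.objObjPreimageIso Z
    obtain ⟨ψ, hψ⟩ := Q_coprod_exists hc (fun i => φ i ≫ e.inv)
    exact ⟨ψ ≫ e.hom, fun i => by rw [reassoc_of% (hψ i)]; simp⟩
  have un : ∀ (Z : DerivedCategory C) (ψ ψ' : DerivedCategory.Q.obj c.pt ⟶ Z),
      (∀ i, DerivedCategory.Q.map (c.inj i) ≫ ψ = DerivedCategory.Q.map (c.inj i) ≫ ψ') →
      ψ = ψ' := by
    intro Z ψ ψ' h
    let e := DerivedCategory.Q.objObjPreimageIso Z
    rw [← cancel_mono e.inv, ← sub_eq_zero, ← Preadditive.sub_comp]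
    apply Q_coprod_uniq hc
    intro i
    rw [Preadditive.sub_comp, Preadditive.comp_sub, reassoc_of% (h i), sub_self]
  exact Cofan.IsColimit.mk _ (fun t => (ex t.pt t.inj).choose)
    (fun t i => (ex t.pt t.inj).choose_spec i)
    (fun t m hm => un _ _ _ (fun i => (hm i).trans ((ex t.pt t.inj).choose_spec i).symm))
end
end IG

namespace IG

section
variable {D : Type*} [Category D] [Preadditive D] [HasBinaryBiproducts D]
  (A B : D) (c : Cofan (fun _ : ULift.{u} ℕ => A ⊞ B)) (hc : IsColimit c)

noncomputable def swβ : c.pt ⟶ c.pt := Cofan.IsColimit.desc hc (fun n => match n with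
  | ⟨0⟩ => biprod.snd ≫ biprod.inr ≫ c.inj ⟨0⟩
  | ⟨n+1⟩ => biprod.fst ≫ biprod.inl ≫ c.inj ⟨n⟩ + biprod.snd ≫ biprod.inr ≫ c.inj ⟨n+1⟩)
noncomputable def swσ : c.pt ⟶ c.pt := Cofan.IsColimit.desc hc (fun n =>
  biprod.fst ≫ biprod.inl ≫ c.inj ⟨n.down+1⟩ + biprod.snd ≫ biprod.inr ≫ c.inj n)
noncomputable def swρ : c.pt ⟶ A := Cofan.IsColimit.desc hc (fun n => match n with
  | ⟨0⟩ => biprod.fst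
  | ⟨_+1⟩ => 0)
lemma swβ0 : c.inj ⟨0⟩ ≫ swβ A B c hc = biprod.snd ≫ biprod.inr ≫ c.inj ⟨0⟩ := by
  simp [swβ]
lemma swβ1 (n : ℕ) : c.inj ⟨n+1⟩ ≫ swβ A B c hc =
    biprod.fst ≫ biprod.inl ≫ c.inj ⟨n⟩ + biprod.snd ≫ biprod.inr ≫ c.inj ⟨n+1⟩ := by
  simp [swβ]
lemma swσ' (n : ℕ) : c.inj ⟨n⟩ ≫ swσ A B c hc =
    biprod.fst ≫ biprod.inl ≫ c.inj ⟨n+1⟩ + biprod.snd ≫ biprod.inr ≫ c.inj ⟨n⟩ := by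
  simp [swσ]
lemma swρ0 : c.inj ⟨0⟩ ≫ swρ A B c hc = biprod.fst := by
  simp [swρ]
lemma swρ1 (n : ℕ) : c.inj ⟨n+1⟩ ≫ swρ A B c hc = 0 := by
  simp [swρ]

noncomputable def swSC : ShortComplex D :=
  ShortComplex.mk (biprod.inl ≫ c.inj ⟨0⟩) (swβ A B c hc) (by simp [swβ0])

lemma bip_tot {Z : D} (x : A ⊞ B ⟶ Z) :
    biprod.fst ≫ biprod.inl ≫ x + biprod.snd ≫ biprod.inr ≫ x = x := by
  have h := congrArg (fun z => z ≫ x) (biprod.total (X := A) (Y := B))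
  rwa [Preadditive.add_comp, Category.id_comp, Category.assoc, Category.assoc] at h

lemma sw1 : swσ A B c hc ≫ swβ A B c hc = 𝟙 c.pt := by
  apply Cofan.IsColimit.hom_ext hc
  rintro ⟨n⟩
  rw [reassoc_of% (swσ' A B c hc n)]
  cases n with
  | zero => simp [swβ0, swβ1, bip_tot]
  | succ n => simp [swβ1, bip_tot]

lemma sw2 : swρ A B c hc ≫ biprod.inl ≫ c.inj ⟨0⟩ + swβ A B c hc ≫ swσ A B c hc = 𝟙 c.pt := by
  apply Cofan.IsColimit.hom_ext hc
  rintro ⟨n⟩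
  rw [Preadditive.comp_add]
  cases n with
  | zero =>
    rw [reassoc_of% (swρ0 A B c hc), reassoc_of% (swβ0 A B c hc), swσ']
    simp [bip_tot]
  | succ n =>
    rw [reassoc_of% (swρ1 A B c hc), reassoc_of% (swβ1 A B c hc)]
    simp [swσ', bip_tot]

noncomputable def swSplit : (swSC A B c hc).Splitting where
  r := swρ A B c hc
  s := swσ A B c hc
  f_r := by simp [swSC, swρ0]
  s_g := sw1 A B c hc
  id := sw2 A B c hc
end

variable {R : Type u} [Ring R] [HasDerivedCategory.{w} (ModuleCat.{u} R)]

abbrev Ch (R : Type u) [Ring R] := CochainComplex (ModuleCat.{u} R) ℤ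

structure IsLoc (S : Set (DerivedCategory (ModuleCat.{u} R))) : Prop where
  iso : ∀ X Y, (X ≅ Y) → X ∈ S → Y ∈ S
  shift : ∀ X ∈ S, ∀ m : ℤ, X⟦m⟧ ∈ S
  ext : ∀ T ∈ distinguishedTriangles, T.obj₁ ∈ S → T.obj₃ ∈ S → T.obj₂ ∈ S
  coprod : ∀ (I : Type u) (f : I → DerivedCategory (ModuleCat.{u} R)) (c : Cofan f),
      IsColimit c → (∀ i, f i ∈ S) → c.pt ∈ S

variable {S : Set (DerivedCategory (ModuleCat.{u} R))}

def InS (S : Set (DerivedCategory (ModuleCat.{u} R))) (X : Ch R) : Prop :=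
  DerivedCategory.Q.obj X ∈ S

def MInS (S : Set (DerivedCategory (ModuleCat.{u} R))) (M : ModuleCat.{u} R) : Prop :=
  InS S ((HomologicalComplex.single _ _ (0 : ℤ)).obj M)

namespace IsLoc
variable (hS : IsLoc S)
include hS

lemma qis {X Y : Ch R} (f : X ⟶ Y) [QuasiIso f] : InS S X ↔ InS S Y :=
  ⟨hS.iso _ _ (asIso (DerivedCategory.Q.map f)), hS.iso _ _ (asIso (DerivedCategory.Q.map f)).symm⟩

lemma iso' {X Y : Ch R} (e : X ≅ Y) : InS S X ↔ InS S Y := hS.qis e.hom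

lemma of₃₂ (T) (hT : T ∈ distinguishedTriangles) (h3 : T.obj₃ ∈ S) (h2 : T.obj₂ ∈ S) : T.obj₁ ∈ S :=
  hS.ext _ (inv_rot_of_distTriang _ hT) (hS.shift _ h3 _) h2

lemma of₁₂ (T) (hT : T ∈ distinguishedTriangles) (h1 : T.obj₁ ∈ S) (h2 : T.obj₂ ∈ S) : T.obj₃ ∈ S :=
  hS.ext _ (rot_of_distTriang _ hT) h2 (hS.shift _ h1 _)

lemma ses₂ {T : ShortComplex (Ch R)} (hT : T.ShortExact) (h1 : InS S T.X₁) (h3 : InS S T.X₃) :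
    InS S T.X₂ := hS.ext _ (DerivedCategory.triangleOfSES_distinguished hT) h1 h3
lemma ses₁ {T : ShortComplex (Ch R)} (hT : T.ShortExact) (h2 : InS S T.X₂) (h3 : InS S T.X₃) :
    InS S T.X₁ := hS.of₃₂ _ (DerivedCategory.triangleOfSES_distinguished hT) h3 h2
lemma ses₃ {T : ShortComplex (Ch R)} (hT : T.ShortExact) (h1 : InS S T.X₁) (h2 : InS S T.X₂) :
    InS S T.X₃ := hS.of₁₂ _ (DerivedCategory.triangleOfSES_distinguished hT) h1 h2

lemma cop {I : Type u} {X : I → Ch R} {c : Cofan X} (hc : IsColimit c) (h : ∀ i, InS S (X i)) :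
    InS S c.pt := hS.coprod _ _ _ (QCofanIsColimit hc) h

lemma zero {X : DerivedCategory (ModuleCat.{u} R)} (hX : IsZero X) : X ∈ S :=
  hS.coprod PEmpty (fun _ => X) (Cofan.mk X (fun _ => 𝟙 X))
    (Cofan.IsColimit.mk _ (fun t => 0) (fun t i => i.elim) (fun t m _ => hX.eq_of_src _ _))
    (fun i => i.elim)

lemma acyclic {X : Ch R} (hX : X.Acyclic) : InS S X := hS.zero ((acyclic_iff_isZero_Q X).1 hX)

lemma single (n m : ℤ) {M : ModuleCat.{u} R}
    (h : InS S ((HomologicalComplex.single _ _ n).obj M)) :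
    InS S ((HomologicalComplex.single _ _ m).obj M) :=
  hS.iso _ _ (((DerivedCategory.singleFunctors _).shiftIso (n - m) m n (by simp)).app M)
    (hS.shift _ h _)

lemma biprod_left {A B : Ch R} (h : InS S (A ⊞ B)) : InS S A := by
  let c := colimit.cocone (Discrete.functor (fun _ : ULift.{u} ℕ => A ⊞ B))
  have hc : IsColimit c := colimit.isColimit _
  have := hS.cop hc (fun _ => h)
  exact hS.ses₁ (swSplit A B c hc).shortExact this this

lemma retract' {A X : Ch R} (i : DerivedCategory.Q.obj A ⟶ DerivedCategory.Q.obj X)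
    (r : DerivedCategory.Q.obj X ⟶ DerivedCategory.Q.obj A) (h : i ≫ r = 𝟙 _)
    (hX : InS S X) : InS S A := by
  obtain ⟨Z, p, q, hT⟩ := distinguished_cocone_triangle i
  have : Mono i := mono_of_mono_fac h
  have hz : q = 0 := Triangle.mor₃_eq_zero_of_mono₁ _ hT this
  obtain ⟨e, -, -⟩ := exists_iso_binaryBiproduct_of_distTriang _ hT hz
  let B := DerivedCategory.Q.objPreimage Z
  have : PreservesBinaryBiproduct A B (DerivedCategory.Q (C := ModuleCat.{u} R)) :=
    (preservesBinaryBiproducts_of_preservesBiproducts _).preserves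
  have f : DerivedCategory.Q.obj X ≅ DerivedCategory.Q.obj (A ⊞ B) :=
    e ≪≫ biprod.mapIso (Iso.refl _) (DerivedCategory.Q.objObjPreimageIso Z).symm ≪≫
      (DerivedCategory.Q.mapBiprod A B).symm
  exact hS.biprod_left (hS.iso _ _ f hX)

/-- if `R ⟶ C ⟶ T` is a quasi-isomorphism, then `T` is a retract of `C` -/
lemma retract {A X T : Ch R} (i : A ⟶ X) (p : X ⟶ T) [QuasiIso (i ≫ p)] (hX : InS S X) :
    InS S T := by
  refine hS.retract' (inv (DerivedCategory.Q.map (i ≫ p)) ≫ DerivedCategory.Q.map i)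
    (DerivedCategory.Q.map p) ?_ hX
  rw [Category.assoc, ← Functor.map_comp, IsIso.inv_hom_id]

end IsLoc
end IG
namespace IG

variable {R : Type u} [Ring R]

lemma ses_mk (T : ShortComplex (Ch R)) (hi : ∀ n, Function.Injective (T.f.f n).hom)
    (hs : ∀ n, Function.Surjective (T.g.f n).hom)
    (he : ∀ n (x : T.X₂.X n), (T.g.f n).hom x = 0 → ∃ y, (T.f.f n).hom y = x) : T.ShortExact := by
  apply HomologicalComplex.shortExact_of_degreewise_shortExact
  intro n
  have h1 : Mono (T.f.f n) := (ModuleCat.mono_iff_injective _).2 (hi n)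
  have h2 : Epi (T.g.f n) := (ModuleCat.epi_iff_surjective _).2 (hs n)
  exact
    { exact := (ShortComplex.moduleCat_exact_iff _).2 (he n)
      mono_f := h1
      epi_g := h2 }

section
variable {I : Type u} {M : I → ModuleCat.{u} R} {c : Cofan M} (hc : IsColimit c)

include hc in
lemma cofan_ind (p : c.pt → Prop) (h0 : p 0) (h1 : ∀ i y, p ((c.inj i).hom y))
    (h2 : ∀ x y, p x → p y → p (x + y)) (x : c.pt) : p x := by
  have : (⨆ i, LinearMap.range (c.inj i).hom) = ⊤ := by
    have e : ModuleCat.ofHom (Submodule.mkQ (⨆ i, LinearMap.range (c.inj i).hom)) = 0 := by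
      apply Cofan.IsColimit.hom_ext hc
      intro i
      ext y
      simp only [ModuleCat.hom_comp, ModuleCat.hom_ofHom, LinearMap.comp_apply, comp_zero,
        ModuleCat.hom_zero, LinearMap.zero_apply]
      rw [Submodule.mkQ_apply, Submodule.Quotient.mk_eq_zero]
      exact Submodule.mem_iSup_of_mem i ⟨y, rfl⟩
    have e' := congrArg ModuleCat.Hom.hom e
    rw [ModuleCat.hom_ofHom, ModuleCat.hom_zero] at e'
    rw [← Submodule.ker_mkQ (⨆ i, LinearMap.range (c.inj i).hom), e', LinearMap.ker_zero]
  have hx : x ∈ (⨆ i, LinearMap.range (c.inj i).hom) := by rw [this]; trivial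
  induction hx using Submodule.iSup_induction' with
  | mem i y hy => obtain ⟨z, rfl⟩ := hy; exact h1 i z
  | zero => exact h0
  | add x y _ _ hx hy => exact h2 x y hx hy

open Classical in
noncomputable def cproj (i : I) : c.pt ⟶ M i :=
  Cofan.IsColimit.desc hc (fun j => if h : j = i then eqToHom (by rw [h]) else 0)

lemma cproj_self (i : I) (y) : (cproj hc i).hom ((c.inj i).hom y) = y := by
  have : c.inj i ≫ cproj hc i = 𝟙 _ := by simp [cproj]
  exact congrArg (fun f => f.hom y) this

lemma cproj_ne (i j : I) (h : j ≠ i) (y) : (cproj hc i).hom ((c.inj j).hom y) = 0 := by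
  have : c.inj j ≫ cproj hc i = 0 := by simp [cproj, h]
  exact congrArg (fun f => f.hom y) this

open Classical in
lemma cproj_inj (x : c.pt) (h : ∀ i, (cproj hc i).hom x = 0) : x = 0 := by
  have : ∃ s : Finset I, ∀ t, s ⊆ t → x = ∑ i ∈ t, (c.inj i).hom ((cproj hc i).hom x) := by
    refine cofan_ind hc (fun x => ∃ s : Finset I, ∀ t, s ⊆ t →
      x = ∑ i ∈ t, (c.inj i).hom ((cproj hc i).hom x)) ?_ ?_ ?_ x
    · exact ⟨∅, fun t _ => by simp⟩
    · intro i y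
      refine ⟨{i}, fun t ht => ?_⟩
      rw [Finset.sum_eq_single i]
      · rw [cproj_self]
      · intro j _ hj
        rw [cproj_ne hc j i hj.symm, map_zero]
      · intro h; exact (h (ht (by simp))).elim
    · rintro x y ⟨s, hs⟩ ⟨s', hs'⟩
      refine ⟨s ∪ s', fun t ht => ?_⟩
      have a := hs t (Finset.union_subset_left ht)
      have b := hs' t (Finset.union_subset_right ht)
      simp only [map_add, Finset.sum_add_distrib]
      rw [← a, ← b]
  obtain ⟨s, hs⟩ := this
  rw [hs s (le_refl _)]
  simp [h]
end

section
variable {F : ULift.{u} ℕ → ModuleCat.{u} R} (t : ∀ n : ℕ, F ⟨n⟩ ⟶ F ⟨n+1⟩)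
  {c : Cofan F} (hc : IsColimit c)
  (s : c.pt ⟶ c.pt) (hs : ∀ n, c.inj ⟨n⟩ ≫ s = c.inj ⟨n⟩ - t n ≫ c.inj ⟨n+1⟩)

include hs in
lemma tele_s (n : ℕ) (y) : s.hom ((c.inj ⟨n⟩).hom y) = (c.inj ⟨n⟩).hom y - (c.inj ⟨n+1⟩).hom ((t n).hom y) :=
  congrArg (fun f => f.hom y) (hs n)

include hc hs in
lemma tele_inj : Function.Injective s.hom := by
  rw [injective_iff_map_eq_zero]
  intro x hx
  have e0 : ∀ x, (cproj hc ⟨0⟩).hom (s.hom x) = (cproj hc ⟨0⟩).hom x := by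
    intro x
    refine cofan_ind hc (fun x => (cproj hc ⟨0⟩).hom (s.hom x) = (cproj hc ⟨0⟩).hom x) (by simp)
      ?_ (fun x y hx hy => by simp [hx, hy]) x
    rintro ⟨n⟩ y
    rw [tele_s t s hs, map_sub, cproj_ne hc ⟨0⟩ ⟨n+1⟩ (by simp), sub_zero]
  have e1 : ∀ n x, (cproj hc ⟨n+1⟩).hom (s.hom x) =
      (cproj hc ⟨n+1⟩).hom x - (t n).hom ((cproj hc ⟨n⟩).hom x) := by
    intro n x
    refine cofan_ind hc (fun x => (cproj hc ⟨n+1⟩).hom (s.hom x) =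
      (cproj hc ⟨n+1⟩).hom x - (t n).hom ((cproj hc ⟨n⟩).hom x)) (by simp)
      ?_ (fun x y hx hy => by simp only [map_add, hx, hy]; abel) x
    rintro ⟨m⟩ y
    rw [tele_s t s hs, map_sub]
    by_cases h : m = n
    · subst h
      rw [cproj_self, cproj_self]
    · rw [cproj_ne hc ⟨n+1⟩ ⟨m+1⟩ (by simpa using h), cproj_ne hc ⟨n⟩ ⟨m⟩ (by simpa using h),
        map_zero]
  apply cproj_inj hc
  rintro ⟨n⟩
  induction n with
  | zero => rw [← e0, hx, map_zero]
  | succ n ih =>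
    have := e1 n x
    rwa [hx, map_zero, ih, map_zero, sub_zero, eq_comm] at this

include hs in
lemma tele_raise (n k : ℕ) (y : F ⟨n⟩) : ∃ y' : F ⟨n+k⟩, ∃ z,
    (c.inj ⟨n⟩).hom y = (c.inj ⟨n+k⟩).hom y' + s.hom z := by
  induction k with
  | zero => exact ⟨y, 0, by simp⟩
  | succ k ih =>
    obtain ⟨y', z, h⟩ := ih
    refine ⟨(t (n+k)).hom y', z + (c.inj ⟨n+k⟩).hom y', ?_⟩
    change _ = (c.inj ⟨n+k+1⟩).hom ((t (n+k)).hom y') + _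
    rw [map_add, tele_s t s hs, h]
    abel

include hs in
lemma tele_raise' (n m : ℕ) (h : n ≤ m) (y : F ⟨n⟩) : ∃ y' : F ⟨m⟩, ∃ z,
    (c.inj ⟨n⟩).hom y = (c.inj ⟨m⟩).hom y' + s.hom z := by
  obtain ⟨k, rfl⟩ := Nat.exists_eq_add_of_le h
  exact tele_raise t s hs n k y

include hc hs in
lemma tele_ex (x : c.pt) : ∃ n : ℕ, ∃ y : F ⟨n⟩, ∃ z, x = (c.inj ⟨n⟩).hom y + s.hom z := by
  refine cofan_ind hc (fun x => ∃ n : ℕ, ∃ y : F ⟨n⟩, ∃ z, x = (c.inj ⟨n⟩).hom y + s.hom z) ?_ ?_ ?_ x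
  · exact ⟨0, 0, 0, by simp⟩
  · rintro ⟨n⟩ y
    exact ⟨n, y, 0, by simp⟩
  · rintro x x' ⟨n, y, z, rfl⟩ ⟨n', y', z', rfl⟩
    obtain ⟨a, b, h⟩ := tele_raise' t s hs n (max n n') (le_max_left _ _) y
    obtain ⟨a', b', h'⟩ := tele_raise' t s hs n' (max n n') (le_max_right _ _) y'
    refine ⟨max n n', a + a', z + z' + b + b', ?_⟩
    rw [h, h']
    simp only [map_add]
    abel
end

variable [HasDerivedCategory.{w} (ModuleCat.{u} R)]
variable {S : Set (DerivedCategory (ModuleCat.{u} R))}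

lemma IsLoc.tele (hS : IsLoc S) {X : Ch R} (F : ℕ → Ch R) (t : ∀ n, F n ⟶ F (n+1))
    (i : ∀ n, F n ⟶ X) (hti : ∀ n, t n ≫ i (n+1) = i n)
    (hi : ∀ n m, Function.Injective ((i n).f m).hom)
    (hsu : ∀ m (x : X.X m), ∃ n y, ((i n).f m).hom y = x)
    (hF : ∀ n, InS S (F n)) : InS S X := by
  let G : ULift.{u} ℕ → Ch R := fun n => F n.down
  let c : Cofan G := colimit.cocone (Discrete.functor G)
  have hc : IsColimit c := colimit.isColimit _
  let s : c.pt ⟶ c.pt := Cofan.IsColimit.desc hc (fun n => c.inj n - t n.down ≫ c.inj ⟨n.down + 1⟩)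
  have hs : ∀ n : ℕ, c.inj ⟨n⟩ ≫ s = c.inj ⟨n⟩ - t n ≫ c.inj ⟨n+1⟩ := fun n =>
    Cofan.IsColimit.fac hc _ _
  let p : c.pt ⟶ X := Cofan.IsColimit.desc hc (fun n => i n.down)
  have hp : ∀ n : ℕ, c.inj ⟨n⟩ ≫ p = i n := fun n => Cofan.IsColimit.fac hc _ _
  have hsp : s ≫ p = 0 := by
    apply Cofan.IsColimit.hom_ext hc
    rintro ⟨n⟩
    rw [reassoc_of% (hs n), Preadditive.sub_comp, Category.assoc, hp, hp, hti, sub_self, comp_zero]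
  have hW := hS.cop hc (fun n => hF n.down)
  refine hS.ses₃ (T := ShortComplex.mk s p hsp) ?_ hW hW
  have hpe : ∀ n m y, (p.f m).hom (((c.inj ⟨n⟩).f m).hom y) = ((i n).f m).hom y := fun n m y =>
    congrArg (fun g => (g.f m).hom y) (hp n)
  let c' := fun m : ℤ => Cofan.mk (c.pt.X m) (fun n : ULift.{u} ℕ => (c.inj n).f m)
  have hc' : ∀ m, IsColimit (c' m) := fun m =>
    Cofan.isColimitMapCoconeEquiv (HomologicalComplex.eval _ _ m) _ c
      (isColimitOfPreserves (HomologicalComplex.eval _ _ m) hc)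
  have hs' : ∀ m n, (c' m).inj ⟨n⟩ ≫ s.f m = (c' m).inj ⟨n⟩ - (t n).f m ≫ (c' m).inj ⟨n+1⟩ :=
    fun m n => HomologicalComplex.congr_hom (hs n) m
  apply ses_mk
  · intro m
    exact tele_inj (fun n => (t n).f m) (hc' m) (s.f m) (hs' m)
  · intro m x
    obtain ⟨n, y, rfl⟩ := hsu m x
    exact ⟨((c.inj ⟨n⟩).f m).hom y, hpe n m y⟩
  · intro m x hx
    obtain ⟨n, y, z, rfl⟩ := tele_ex (fun n => (t n).f m) (hc' m) (s.f m) (hs' m) x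
    have e : (p.f m).hom ((s.f m).hom z) = 0 :=
      congrArg (fun g => (g.f m).hom z) hsp
    have e2 : ((i n).f m).hom y = 0 := by
      rw [← hpe]
      have := hx
      dsimp only at this
      erw [map_add, e, add_zero] at this
      exact this
    have e3 : y = 0 := hi n m (by rw [e2, map_zero])
    refine ⟨z, ?_⟩
    rw [e3, map_zero, zero_add]
end IG
namespace IG

variable {R : Type u} [Ring R]

section
variable (X : Ch R)

/-- stable family of submodules -/
def Stab (N : ∀ n, Submodule R (X.X n)) : Prop :=
  ∀ n x, x ∈ N n → (X.d n (n+1)).hom x ∈ N (n+1)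

variable {X}

lemma Stab.le {N : ∀ n, Submodule R (X.X n)} (h : Stab X N) (n m : ℤ) (x) (hx : x ∈ N n) :
    (X.d n m).hom x ∈ N m := by
  by_cases e : n + 1 = m
  · subst e; exact h n x hx
  · rw [X.shape n m e]; exact zero_mem _

noncomputable def subc {N : ∀ n, Submodule R (X.X n)} (h : Stab X N) : Ch R where
  X n := ModuleCat.of R (N n)
  d n m := ModuleCat.ofHom ((X.d n m).hom.restrict (h.le n m))
  shape n m e := by
    ext x
    have := congrArg (fun f => f.hom x.1) (X.shape n m e)
    exact this
  d_comp_d' n m k _ _ := by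
    ext x
    have := congrArg (fun f => f.hom x.1) (X.d_comp_d n m k)
    exact this

noncomputable def subι {N : ∀ n, Submodule R (X.X n)} (h : Stab X N) : subc h ⟶ X where
  f n := ModuleCat.ofHom (N n).subtype
  comm' n m _ := by ext x; rfl

noncomputable def subincl {N N' : ∀ n, Submodule R (X.X n)} (h : Stab X N) (h' : Stab X N')
    (hle : ∀ n, N n ≤ N' n) : subc h ⟶ subc h' where
  f n := ModuleCat.ofHom (Submodule.inclusion (hle n))
  comm' n m _ := by ext x; rfl

lemma subincl_ι {N N' : ∀ n, Submodule R (X.X n)} (h : Stab X N) (h' : Stab X N')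
    (hle : ∀ n, N n ≤ N' n) : subincl h h' hle ≫ subι h' = subι h := by
  ext n x; rfl
end

section
variable {X Y : Ch R} (i : X ⟶ Y) (a : ℤ) {M : ModuleCat.{u} R} (φ : Y.X a ⟶ M)

noncomputable def ssSC (h0 : i.f a ≫ φ = 0) (hd : ∀ b, Y.d b a ≫ φ = 0) : ShortComplex (Ch R) :=
  ShortComplex.mk i (HomologicalComplex.mkHomToSingle φ (fun b _ => hd b)) (by
    apply HomologicalComplex.hom_ext
    intro n
    by_cases h : n = a
    · subst h
      rw [HomologicalComplex.comp_f, HomologicalComplex.mkHomToSingle_f, ← Category.assoc, h0,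
        zero_comp, HomologicalComplex.zero_f]
    · exact (HomologicalComplex.isZero_single_obj_X _ _ _ _ h).eq_of_tgt _ _)

lemma ssSC_exact (h0 : i.f a ≫ φ = 0) (hd : ∀ b, Y.d b a ≫ φ = 0)
    (hi : ∀ n, Function.Injective (i.f n).hom)
    (hs : ∀ n, n ≠ a → Function.Surjective (i.f n).hom) (hφ : Function.Surjective φ.hom)
    (he : ∀ x, φ.hom x = 0 → ∃ y, (i.f a).hom y = x) :
    (ssSC i a φ h0 hd).ShortExact := by
  have key : ∀ x, ((ssSC i a φ h0 hd).g.f a).hom x =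
      (HomologicalComplex.singleObjXSelf (ComplexShape.up ℤ) a M).inv.hom (φ.hom x) := by
    intro x
    have := HomologicalComplex.mkHomToSingle_f φ (fun b (_ : (ComplexShape.up ℤ).Rel b a) => hd b)
    exact congrArg (fun f => f.hom x) this
  let e := (HomologicalComplex.singleObjXSelf (ComplexShape.up ℤ) a M).symm.toLinearEquiv
  have key' : ∀ x, ((ssSC i a φ h0 hd).g.f a).hom x = e (φ.hom x) := key
  apply ses_mk
  · exact hi
  · intro n
    by_cases h : n = a
    · subst h
      intro y
      obtain ⟨x, hx⟩ := hφ (e.symm y)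
      refine ⟨x, ?_⟩
      exact (key' x).trans ((congrArg e hx).trans (e.apply_symm_apply y))
    · intro y
      have hz := (HomologicalComplex.isZero_single_obj_X (ComplexShape.up ℤ) _ M _ h)
      refine ⟨0, ?_⟩
      have := ModuleCat.subsingleton_of_isZero hz
      exact Subsingleton.elim (α := ((HomologicalComplex.single (ModuleCat R) (ComplexShape.up ℤ) a).obj M).X n) _ _
  · intro n x hx
    by_cases h : n = a
    · subst h
      exact he x (e.injective (((key' x).symm.trans hx).trans (map_zero e).symm))
    · exact hs n h x
end

lemma acyclic_of_subsingleton (X : Ch R) (h : ∀ n, Subsingleton (X.X n)) : X.Acyclic :=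
  fun n => HomologicalComplex.ExactAt.of_isZero (ModuleCat.isZero_of_subsingleton _)


open Classical in
noncomputable def brut (X : Ch R) (a n : ℤ) : Submodule R (X.X n) := if a ≤ n then ⊤ else ⊥

lemma brut_top (X : Ch R) {a n : ℤ} (h : a ≤ n) : brut X a n = ⊤ := if_pos h
lemma brut_bot (X : Ch R) {a n : ℤ} (h : n < a) : brut X a n = ⊥ := if_neg (by omega)

lemma brut_le (X : Ch R) {a b : ℤ} (h : b ≤ a) (n) : brut X a n ≤ brut X b n := by
  by_cases e : a ≤ n
  · rw [brut_top X (h.trans e)]; exact le_top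
  · rw [brut_bot X (by omega : n < a)]; exact bot_le

lemma brut_stab (X : Ch R) (a : ℤ) : Stab X (brut X a) := by
  intro n x hx
  by_cases h : a ≤ n
  · rw [brut_top X (by omega)]; trivial
  · rw [brut_bot X (by omega), Submodule.mem_bot] at hx
    rw [hx, map_zero]; exact zero_mem _

open Classical in
noncomputable def tau (X : Ch R) (a n : ℤ) : Submodule R (X.X n) := if n < a then ⊤ else if n = a then
    LinearMap.ker (X.d n (n+1)).hom else ⊥

lemma tau_top (X : Ch R) {a n : ℤ} (h : n < a) : tau X a n = ⊤ := if_pos h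
lemma tau_mid (X : Ch R) {a n : ℤ} (h : n = a) : tau X a n = LinearMap.ker (X.d n (n+1)).hom := by
  rw [tau, if_neg (by omega), if_pos h]
lemma tau_bot (X : Ch R) {a n : ℤ} (h : a < n) : tau X a n = ⊥ := by
  rw [tau, if_neg (by omega), if_neg (by omega)]

lemma tau_stab (X : Ch R) (a : ℤ) : Stab X (tau X a) := by
  intro n x hx
  rcases lt_trichotomy n a with h | h | h
  · by_cases h' : n + 1 < a
    · rw [tau_top X h']; trivial
    · rw [tau_mid X (by omega), LinearMap.mem_ker]
      exact congrArg (fun f => f.hom x) (X.d_comp_d n (n+1) (n+1+1))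
  · rw [tau_mid X h] at hx
    rw [LinearMap.mem_ker.1 hx]; exact zero_mem _
  · rw [tau_bot X h] at hx
    rw [(Submodule.mem_bot _).1 hx, map_zero]; exact zero_mem _

lemma sub_subsing {M : ModuleCat.{u} R} {N : Submodule R M} (h : N = ⊥) : Subsingleton N := by
  subst h; infer_instance
lemma sub_zero' {M : ModuleCat.{u} R} {N : Submodule R M} (h : N = ⊥) (x : N) : x.1 = 0 := by
  subst h; exact x.2

variable [HasDerivedCategory.{w} (ModuleCat.{u} R)]
variable {S : Set (DerivedCategory (ModuleCat.{u} R))}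

lemma IsLoc.miso (hS : IsLoc S) {M N : ModuleCat.{u} R} (e : M ≅ N) : MInS S M ↔ MInS S N :=
  hS.iso' ((HomologicalComplex.single _ _ (0 : ℤ)).mapIso e)

lemma IsLoc.mzero (hS : IsLoc S) {M : ModuleCat.{u} R} (h : Subsingleton M) : MInS S M := by
  apply hS.zero
  apply Functor.map_isZero
  apply Functor.map_isZero
  exact ModuleCat.isZero_of_subsingleton _


lemma IsLoc.LR (hS : IsLoc S) (X : Ch R) (b : ℤ) (hb : ∀ n, b < n → Subsingleton (X.X n))
    (hX : ∀ n, MInS S (X.X n)) : InS S X := by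
  have key : ∀ k : ℕ, InS S (subc (brut_stab X (b + 1 - k))) := by
    intro k
    induction k with
    | zero =>
      apply hS.acyclic
      apply acyclic_of_subsingleton
      intro n
      change Subsingleton (brut X (b + 1 - (0 : ℕ)) n)
      by_cases h : n ≤ b
      · exact sub_subsing (brut_bot X (by push_cast; omega))
      · have := hb n (by omega)
        infer_instance
    | succ k ih =>
      let a : ℤ := b - k
      have haa : a = b - k := rfl
      have ha : brut X (b + 1 - (k+1 : ℕ)) a = ⊤ := brut_top X (by push_cast; omega)
      let φ : (subc (brut_stab X (b + 1 - (k+1 : ℕ)))).X a ⟶ X.X a :=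
        ModuleCat.ofHom (brut X (b + 1 - (k+1 : ℕ)) a).subtype
      refine hS.ses₂ (T := ssSC (subincl (brut_stab X (b + 1 - k)) (brut_stab X (b + 1 - (k+1 : ℕ)))
        (brut_le X (by push_cast; omega))) a φ ?_ ?_) (ssSC_exact _ _ _ _ _ ?_ ?_ ?_ ?_) ih
          (hS.single 0 a (hX a))
      · ext x
        exact sub_zero' (brut_bot X (by omega)) x
      · intro m
        by_cases e : m + 1 = a
        · ext x
          change (X.d m a).hom x.1 = 0
          have h0 := sub_zero' (brut_bot X (by push_cast; omega)) x
          exact (congrArg (X.d m a).hom h0).trans (map_zero _)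
        · rw [HomologicalComplex.shape _ m a e, zero_comp]
      · intro n
        exact Submodule.inclusion_injective (brut_le X (by push_cast; omega) n)
      · intro n hn x
        refine ⟨⟨x.1, ?_⟩, rfl⟩
        by_cases h : b + 1 - k ≤ n
        · rw [brut_top X h]; trivial
        · have h0 := sub_zero' (brut_bot X (by push_cast; omega)) x
          rw [h0]; exact zero_mem _
      · intro x
        exact ⟨⟨x, by rw [ha]; trivial⟩, rfl⟩
      · intro x hx
        refine ⟨0, ?_⟩
        rw [map_zero]
        exact Subtype.ext hx.symm
  refine hS.tele (fun k : ℕ => subc (brut_stab X (b + 1 - k)))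
    (fun k => subincl _ _ (brut_le X (by push_cast; omega))) (fun k => subι _) (fun k => subincl_ι _ _ _)
    (fun k m => Subtype.val_injective) ?_ key
  intro m x
  exact ⟨(b + 1 - m).toNat, ⟨x, by rw [brut_top X (by omega)]; trivial⟩, rfl⟩

lemma IsLoc.all_of_modules (hS : IsLoc S) (h : ∀ M, MInS S M) (X : Ch R) : InS S X := by
  refine hS.tele (fun k : ℕ => subc (tau_stab X k))
    (fun k => subincl _ _ ?_) (fun k => subι _) (fun k => subincl_ι _ _ _)
    (fun k m => Subtype.val_injective) ?_ ?_
  · intro n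
    by_cases h : n ≤ k
    · rw [tau_top X (by push_cast; omega : n < ((k+1 : ℕ) : ℤ))]; exact le_top
    · rw [tau_bot X (by omega)]; exact bot_le
  · intro m x
    exact ⟨(m + 1).toNat, ⟨x, by rw [tau_top X (by omega)]; trivial⟩, rfl⟩
  · intro k
    refine hS.LR _ k ?_ (fun n => h _)
    intro n hn
    exact sub_subsing (tau_bot X hn)

end IG
namespace IG

variable {R : Type u} [Ring R]
variable [HasDerivedCategory.{w} (ModuleCat.{u} R)]
variable {S : Set (DerivedCategory (ModuleCat.{u} R))}

lemma IsLoc.mcop (hS : IsLoc S) {I : Type u} {Z : I → ModuleCat.{u} R} {c : Cofan Z}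
    (hc : IsColimit c) (h : ∀ i, MInS S (Z i)) : MInS S c.pt := by
  have hc' := Cofan.isColimitMapCoconeEquiv (HomologicalComplex.single (ModuleCat.{u} R)
    (ComplexShape.up ℤ) 0) Z c (isColimitOfPreserves (HomologicalComplex.single (ModuleCat.{u} R)
    (ComplexShape.up ℤ) 0) hc)
  exact hS.cop hc' h

lemma IsLoc.mretract (hS : IsLoc S) {M N : ModuleCat.{u} R} (i : M ⟶ N) (p : N ⟶ M)
    (h : i ≫ p = 𝟙 M) (hN : MInS S N) : MInS S M := by
  let F := (HomologicalComplex.single (ModuleCat.{u} R) (ComplexShape.up ℤ) 0)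
  have : F.map i ≫ F.map p = 𝟙 _ := by rw [← F.map_comp, h, F.map_id]
  have : QuasiIso (F.map i ≫ F.map p) := by rw [this]; infer_instance
  exact hS.retract (F.map i) (F.map p) hN

lemma IsLoc.mses {T : ShortComplex (ModuleCat.{u} R)} (hT : T.ShortExact) :
    (T.map (HomologicalComplex.single (ModuleCat.{u} R) (ComplexShape.up ℤ) 0)).ShortExact :=
  hT.map_of_exact _

lemma IsLoc.mproj (hS : IsLoc S) (h : MInS S (ModuleCat.of R R)) (P : ModuleCat.{u} R)
    [Projective P] : MInS S P := by
  let Z : P → ModuleCat.{u} R := fun _ => ModuleCat.of R R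
  have h1 : MInS S (∐ Z) := hS.mcop (colimit.isColimit _) (fun _ => h)
  let p : (∐ Z) ⟶ P := Sigma.desc (fun x => ModuleCat.ofHom (LinearMap.toSpanSingleton R P x))
  have : Epi p := by
    rw [ModuleCat.epi_iff_surjective]
    intro x
    refine ⟨(Sigma.ι Z x).hom (1 : R), ?_⟩
    have : Sigma.ι Z x ≫ p = ModuleCat.ofHom (LinearMap.toSpanSingleton R P x) := Sigma.ι_desc _ _
    refine (congrArg (fun f => f.hom (1 : R)) this).trans ?_
    exact one_smul R x
  exact hS.mretract (Projective.factorThru (𝟙 P) p) p (Projective.factorThru_comp _ _) h1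

lemma IsLoc.mall (hS : IsLoc S) (h : MInS S (ModuleCat.of R R)) (M : ModuleCat.{u} R) :
    MInS S M := by
  let P := projectiveResolution M
  have : InS S P.cochainComplex := by
    refine hS.LR _ 0 ?_ (fun n => hS.mproj h _)
    intro n hn
    exact ModuleCat.subsingleton_of_isZero (CochainComplex.isZero_of_isStrictlyLE _ 0 _ hn)
  exact (hS.qis P.π').1 this

theorem IsLoc.all (hS : IsLoc S) (h : MInS S (ModuleCat.of R R)) (X) : X ∈ S :=
  hS.iso _ _ (DerivedCategory.Q.objObjPreimageIso X) (hS.all_of_modules (hS.mall h) _)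

end IG
namespace IG

section
variable {R L : Type u} [Ring R] [Ring L] (r : R →+* L)

/-- coextension -/
noncomputable abbrev Phi := ModuleCat.coextendScalars.{u, u, u} r

noncomputable def ev (N : ModuleCat.{u} R) (y : (Phi r).obj N) : N := ModuleCat.CoextendScalars.equiv r N y (1 : L)

lemma ev_add {N : ModuleCat.{u} R} (y z : (Phi r).obj N) : ev r N (y + z) = ev r N y + ev r N z := rfl
lemma ev_zero {N : ModuleCat.{u} R} : ev r N 0 = 0 := rfl

lemma ev_map {N N' : ModuleCat.{u} R} (g : N ⟶ N') (y : (Phi r).obj N) :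
  ev r N' (((Phi r).map g).hom y) = g.hom (ev r N y) := rfl

lemma ev_apply {N : ModuleCat.{u} R} (y : (Phi r).obj N) (x : R) :
    ModuleCat.CoextendScalars.equiv r N y (r x) = x • ev r N y := by
  have := (ModuleCat.CoextendScalars.equiv r N y).map_smul x (1 : L)
  refine Eq.trans ?_ this
  congr 1
  exact (mul_one (r x)).symm

lemma ev_inj (hr : Function.Surjective r) {N : ModuleCat.{u} R} : Function.Injective (ev r N) := by
  intro y z h
  apply ModuleCat.CoextendScalars.ext
  apply LinearMap.ext
  intro (l : L)
  obtain ⟨x, rfl⟩ := hr l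
  rw [ev_apply, ev_apply, h]

lemma ev_e {N : ModuleCat.{u} R} (y : (Phi r).obj N) (e : R) (he : r e = 1) :
    e • ev r N y = ev r N y := by
  rw [← ev_apply, he]; rfl

lemma ev_ex (hr : Function.Surjective r) {N : ModuleCat.{u} R} (e : R) (he : r e = 1)
    (he' : ∀ x, r x = 0 → x * e = 0) (n : N) : ∃ y, ev r N y = e • n := by
  choose s hs using hr
  have key : ∀ x y, r x = r y → x * e = y * e := by
    intro x y h
    have := he' (x - y) (by rw [map_sub, h, sub_self])
    rwa [sub_mul, sub_eq_zero] at this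
  have key' : ∀ x y, r x = r y → x • (e • n) = y • (e • n) := by
    intro x y h
    rw [smul_smul, smul_smul, key x y h]
  let g : (ModuleCat.restrictScalars r).obj (ModuleCat.of L L) →ₗ[R] N :=
    { toFun := fun l : L => s l • (e • n)
      map_add' := fun (l l' : L) => by
        rw [← add_smul]
        apply key'
        rw [map_add, hs, hs]; exact hs _
      map_smul' := fun x (l : L) => by
        rw [RingHom.id_apply, smul_smul x]
        apply key'
        rw [map_mul, hs]; exact hs _ }
  refine ⟨(ModuleCat.CoextendScalars.equiv r N).symm g, ?_⟩
  change s (1 : L) • (e • n) = e • n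
  rw [key' (s 1) 1 (by rw [hs, map_one]), one_smul]

instance : (Phi r).IsRightAdjoint := (ModuleCat.restrictCoextendScalarsAdj r).isRightAdjoint
instance : (Phi r).Additive where
  map_add := by intros; rfl

lemma phi_limits : PreservesFiniteLimits (Phi r) := by
  have : PreservesLimitsOfSize.{0, 0} (Phi r) := (ModuleCat.restrictCoextendScalarsAdj r).rightAdjoint_preservesLimits
  infer_instance

instance : PreservesFiniteLimits (ModuleCat.restrictScalars.{u} r) := by
  rw [Functor.preservesFiniteLimits_iff_forall_exact_map_and_mono]
  intro S hS
  have h1 := (ModuleCat.mono_iff_injective _).1 hS.mono_f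
  have h2 := (ShortComplex.ShortExact.moduleCat_exact_iff_function_exact _).1 hS.exact
  refine ⟨?_, ?_⟩
  · rw [ShortComplex.ShortExact.moduleCat_exact_iff_function_exact]
    exact h2
  · rw [ModuleCat.mono_iff_injective]
    exact h1

lemma phi_colimits (hr : Function.Surjective r) (e : R) (he : r e = 1)
    (he' : ∀ x, r x = 0 → x * e = 0) : PreservesFiniteColimits (Phi r) := by
  rw [Functor.preservesFiniteColimits_iff_forall_exact_map_and_epi]
  intro S hS
  have := phi_limits r
  refine ⟨((Functor.preservesFiniteLimits_iff_forall_exact_map_and_mono (Phi r)).1 this S hS).1, ?_⟩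
  rw [ModuleCat.epi_iff_surjective]
  have h1 := (ModuleCat.epi_iff_surjective _).1 hS.epi_g
  intro y
  obtain ⟨n, hn⟩ := h1 (ev r _ y)
  obtain ⟨z, hz⟩ := ev_ex r hr e he he' n
  refine ⟨z, ev_inj r hr ?_⟩
  refine (ev_map r S.g z).trans ?_
  rw [hz, map_smul]
  exact (congrArg (e • ·) hn).trans (ev_e r y e he)

lemma phi_coprod (hr : Function.Surjective r) (e : R) (he : r e = 1)
    (he' : ∀ x, r x = 0 → x * e = 0) {I : Type u} (Z : I → ModuleCat.{u} R) (c : Cofan Z)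
    (hc : IsColimit c) : Nonempty (IsColimit (Cofan.mk ((Phi r).obj c.pt) (fun i => (Phi r).map (c.inj i)))) := by
  let Z' : I → ModuleCat.{u} L := fun i => (Phi r).obj (Z i)
  let d : Cofan Z' := colimit.cocone (Discrete.functor Z')
  have hd : IsColimit d := colimit.isColimit _
  let F : d.pt ⟶ (Phi r).obj c.pt := Cofan.IsColimit.desc hd (fun i => (Phi r).map (c.inj i))
  have hF : ∀ i, d.inj i ≫ F = (Phi r).map (c.inj i) := fun i => Cofan.IsColimit.fac hd _ i
  have hF' : ∀ i y, F.hom ((d.inj i).hom y) = ((Phi r).map (c.inj i)).hom y :=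
    fun i y => congrArg (fun f => f.hom y) (hF i)
  have hinj : Function.Injective F.hom := by
    rw [injective_iff_map_eq_zero]
    intro x hx
    apply cproj_inj hd
    intro i
    have : F ≫ (Phi r).map (cproj hc i) = cproj hd i := by
      apply Cofan.IsColimit.hom_ext hd
      intro j
      rw [← Category.assoc, hF, ← Functor.map_comp]
      by_cases h : j = i
      · subst h
        have e1 : c.inj j ≫ cproj hc j = 𝟙 _ := by ext y; exact cproj_self hc j y
        have e2 : d.inj j ≫ cproj hd j = 𝟙 _ := by
          apply ModuleCat.hom_ext; apply LinearMap.ext; intro y; exact cproj_self hd j y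
        rw [e1, e2]; exact (Phi r).map_id _
      · have e1 : c.inj j ≫ cproj hc i = 0 := by ext y; exact cproj_ne hc i j h y
        have e2 : d.inj j ≫ cproj hd i = 0 := by
          apply ModuleCat.hom_ext; apply LinearMap.ext; intro y; exact cproj_ne hd i j h y
        rw [e1, e2]; exact (Phi r).map_zero _ _
    rw [← this, ModuleCat.hom_comp, LinearMap.comp_apply, hx, map_zero]
  have hsurj : Function.Surjective F.hom := by
    have key : ∀ n : c.pt, ∃ x, ev r _ (F.hom x) = e • n := by
      intro n
      refine cofan_ind hc (fun n => ∃ x, ev r _ (F.hom x) = e • n) ?_ ?_ ?_ n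
      · exact ⟨0, by rw [map_zero, smul_zero]; rfl⟩
      · intro i y
        obtain ⟨z, hz⟩ := ev_ex r hr e he he' y
        refine ⟨(d.inj i).hom z, ?_⟩
        rw [hF', ev_map, hz, map_smul]
      · rintro x y ⟨x', hx⟩ ⟨y', hy⟩
        exact ⟨x' + y', by rw [map_add, ev_add, hx, hy, smul_add]⟩
    intro y
    obtain ⟨x, hx⟩ := key (ev r _ y)
    exact ⟨x, ev_inj r hr (hx.trans (ev_e r y e he))⟩
  have hiso : IsIso F := (ConcreteCategory.isIso_iff_bijective F).2 ⟨hinj, hsurj⟩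
  refine ⟨IsColimit.ofIsoColimit hd (Cofan.ext (asIso F) ?_)⟩
  intro i
  exact hF i

end
end IG
namespace IG

def GenR (R : Type u) [Ring R] : Prop :=
  letI : HasDerivedCategory (ModuleCat.{u} R) := HasDerivedCategory.standard _
  ∀ S : Set (DerivedCategory (ModuleCat.{u} R)), IsLoc S →
    (∀ M : ModuleCat.{u} R, Injective M → MInS S M) → ∀ X, X ∈ S

section
variable {R L : Type u} [Ring R] [Ring L] (r : R →+* L)

lemma phi_coprod' (hr : Function.Surjective r) (e : R) (he : r e = 1)
    (he' : ∀ x, r x = 0 → x * e = 0) {I : Type u} (X : I → Ch R) (c : Cofan X)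
    (hc : IsColimit c) : Nonempty (IsColimit (Cofan.mk
      (((Phi r).mapHomologicalComplex (ComplexShape.up ℤ)).obj c.pt)
        (fun i => ((Phi r).mapHomologicalComplex (ComplexShape.up ℤ)).map (c.inj i)))) := by
  refine ⟨HomologicalComplex.isColimitOfEval _ _ (fun n => ?_)⟩
  have h1 := Cofan.isColimitMapCoconeEquiv (HomologicalComplex.eval (ModuleCat.{u} R)
    (ComplexShape.up ℤ) n) X c (isColimitOfPreserves (HomologicalComplex.eval (ModuleCat.{u} R)
    (ComplexShape.up ℤ) n) hc)
  have h2 := (phi_coprod r hr e he he' _ _ h1).some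
  exact (Cofan.isColimitMapCoconeEquiv (HomologicalComplex.eval (ModuleCat.{u} L)
    (ComplexShape.up ℤ) n) (fun i => ((Phi r).mapHomologicalComplex (ComplexShape.up ℤ)).obj (X i))
      (Cofan.mk
      (((Phi r).mapHomologicalComplex (ComplexShape.up ℤ)).obj c.pt)
        (fun i => ((Phi r).mapHomologicalComplex (ComplexShape.up ℤ)).map (c.inj i)))).symm h2

lemma phi_unit_iso (hr : Function.Surjective r) (N : ModuleCat.{u} L) :
    IsIso ((ModuleCat.restrictCoextendScalarsAdj r).unit.app N) := by
  rw [ConcreteCategory.isIso_iff_bijective]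
  have key : ∀ y : N, ev r _ (((ModuleCat.restrictCoextendScalarsAdj.{u} r).unit.app N).hom y) = y := by
    intro y
    change (1 : L) • y = y
    exact one_smul _ _
  constructor
  · intro y z h
    exact ((key y).symm.trans (congrArg (ev r ((ModuleCat.restrictScalars r).obj N)) h)).trans (key z)
  · intro y
    exact ⟨ev r ((ModuleCat.restrictScalars r).obj N) y, ev_inj r hr (key _)⟩

theorem lemmaA (hr : Function.Surjective r) (e : R) (he : r e = 1)
    (he' : ∀ x, r x = 0 → x * e = 0) (hR : GenR R) : GenR L := by
  letI : HasDerivedCategory (ModuleCat.{u} R) := HasDerivedCategory.standard _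
  letI : HasDerivedCategory (ModuleCat.{u} L) := HasDerivedCategory.standard _
  have := phi_limits r
  have := phi_colimits r hr e he he'
  intro S hS hinj
  let F := (Phi r).mapDerivedCategory
  let G := (Phi r).mapHomologicalComplex (ComplexShape.up ℤ)
  have hQ : ∀ K : Ch R, F.obj (DerivedCategory.Q.obj K) ∈ S ↔ InS S (G.obj K) := fun K =>
    ⟨hS.iso _ _ ((Phi r).mapDerivedCategoryFactors.app K),
      hS.iso _ _ ((Phi r).mapDerivedCategoryFactors.app K).symm⟩
  have hS' : IsLoc {X | F.obj X ∈ S} := by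
    constructor
    · intro X Y f hX
      exact hS.iso _ _ (F.mapIso f) hX
    · intro X hX m
      exact hS.iso _ _ ((F.commShiftIso m).app X).symm (hS.shift _ hX m)
    · intro T hT h1 h3
      exact hS.ext _ (F.map_distinguished T hT) h1 h3
    · intro I f c hc h
      let X : I → Ch R := fun i => DerivedCategory.Q.objPreimage (f i)
      let d : Cofan X := colimit.cocone (Discrete.functor X)
      have hd : IsColimit d := colimit.isColimit _
      let f1 : c.pt ≅ DerivedCategory.Q.obj d.pt :=
        IsColimit.coconePointsIsoOfNatIso hc (QCofanIsColimit hd)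
          (Discrete.natIso (fun i => (DerivedCategory.Q.objObjPreimageIso (f i.as)).symm))
      refine hS.iso _ _ (F.mapIso f1.symm) ?_
      refine (hQ d.pt).2 ?_
      refine hS.cop (phi_coprod' r hr e he he' X d hd).some ?_
      intro i
      refine (hQ _).1 ?_
      exact hS.iso _ _ (F.mapIso (DerivedCategory.Q.objObjPreimageIso (f i)).symm) (h i)
  have hall := hR _ hS' (by
    intro M hM
    refine hS.iso _ _ (((Phi r).mapDerivedCategorySingleFunctor 0).app M).symm ?_
    refine hinj _ ?_
    exact Injective.injective_of_adjoint (ModuleCat.restrictCoextendScalarsAdj r) M)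
  intro X
  refine hS.iso _ _ (DerivedCategory.Q.objObjPreimageIso X) ?_
  let K := DerivedCategory.Q.objPreimage X
  let K' := ((ModuleCat.restrictScalars.{u} r).mapHomologicalComplex (ComplexShape.up ℤ)).obj K
  have h1 : InS S (G.obj K') := (hQ K').1 (hall _)
  let f : K ⟶ G.obj K' :=
    { f := fun n => (ModuleCat.restrictCoextendScalarsAdj r).unit.app (K.X n)
      comm' := fun n m _ => ((ModuleCat.restrictCoextendScalarsAdj.{u} r).unit.naturality (K.d n m)).symm }
  have : ∀ n, IsIso (f.f n) := fun n => phi_unit_iso r hr _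
  have : IsIso f := HomologicalComplex.Hom.isIso_of_components f
  exact (hS.iso' (asIso f)).2 h1
end
end IG
namespace IG

section
variable (k Λ : Type u) [Field k] [Ring Λ] [Algebra k Λ]

def Gam : Type u := k × k × Module.Dual k Λ × Λ

noncomputable instance : AddCommGroup (Gam k Λ) :=
  inferInstanceAs (AddCommGroup (k × k × Module.Dual k Λ × Λ))
noncomputable instance : Module k (Gam k Λ) :=
  inferInstanceAs (Module k (k × k × Module.Dual k Λ × Λ))
instance [FiniteDimensional k Λ] : FiniteDimensional k (Gam k Λ) :=
  inferInstanceAs (FiniteDimensional k (k × k × Module.Dual k Λ × Λ))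

variable {k Λ}
namespace Gam
def a (g : Gam k Λ) : k := g.1
def t (g : Gam k Λ) : k := g.2.1
def m (g : Gam k Λ) : Module.Dual k Λ := g.2.2.1
def l (g : Gam k Λ) : Λ := g.2.2.2
def mk (a t : k) (m : Module.Dual k Λ) (l : Λ) : Gam k Λ := (a, t, m, l)

@[simp] lemma mk_a (a t : k) (m : Module.Dual k Λ) (l : Λ) : (mk a t m l).a = a := rfl
@[simp] lemma mk_t (a t : k) (m : Module.Dual k Λ) (l : Λ) : (mk a t m l).t = t := rfl
@[simp] lemma mk_m (a t : k) (m : Module.Dual k Λ) (l : Λ) : (mk a t m l).m = m := rfl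
@[simp] lemma mk_l (a t : k) (m : Module.Dual k Λ) (l : Λ) : (mk a t m l).l = l := rfl
@[simp] lemma add_a (x y : Gam k Λ) : (x + y).a = x.a + y.a := rfl
@[simp] lemma add_t (x y : Gam k Λ) : (x + y).t = x.t + y.t := rfl
@[simp] lemma add_m (x y : Gam k Λ) : (x + y).m = x.m + y.m := rfl
@[simp] lemma add_l (x y : Gam k Λ) : (x + y).l = x.l + y.l := rfl
@[simp] lemma zero_a : (0 : Gam k Λ).a = 0 := rfl
@[simp] lemma zero_t : (0 : Gam k Λ).t = 0 := rfl
@[simp] lemma zero_m : (0 : Gam k Λ).m = 0 := rfl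
@[simp] lemma zero_l : (0 : Gam k Λ).l = 0 := rfl
@[simp] lemma smul_a (c : k) (y : Gam k Λ) : (c • y).a = c * y.a := rfl
@[simp] lemma smul_t (c : k) (y : Gam k Λ) : (c • y).t = c * y.t := rfl
@[simp] lemma smul_m (c : k) (y : Gam k Λ) : (c • y).m = c • y.m := rfl
@[simp] lemma smul_l (c : k) (y : Gam k Λ) : (c • y).l = c • y.l := rfl

lemma ext' {x y : Gam k Λ} (h1 : x.a = y.a) (h2 : x.t = y.t) (h3 : ∀ z, x.m z = y.m z) (h4 : x.l = y.l) :
    x = y :=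
  Prod.ext h1 (Prod.ext h2 (Prod.ext (LinearMap.ext h3) h4))

noncomputable instance : Mul (Gam k Λ) :=
  ⟨fun x y => mk (x.a * y.a) (x.a * y.t + x.t * y.a) (x.a • y.m + x.m.comp (LinearMap.mulLeft k y.l))
    (x.l * y.l)⟩
noncomputable instance : One (Gam k Λ) := ⟨mk 1 0 0 1⟩
@[simp] lemma mul_a (x y : Gam k Λ) : (x * y).a = x.a * y.a := rfl
@[simp] lemma mul_t (x y : Gam k Λ) : (x * y).t = x.a * y.t + x.t * y.a := rfl
@[simp] lemma mul_m (x y : Gam k Λ) (z : Λ) : (x * y).m z = x.a * y.m z + x.m (y.l * z) := rfl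
@[simp] lemma mul_l (x y : Gam k Λ) : (x * y).l = x.l * y.l := rfl
@[simp] lemma one_a : (1 : Gam k Λ).a = 1 := rfl
@[simp] lemma one_t : (1 : Gam k Λ).t = 0 := rfl
@[simp] lemma one_m : (1 : Gam k Λ).m = 0 := rfl
@[simp] lemma one_l : (1 : Gam k Λ).l = 1 := rfl

noncomputable instance : Ring (Gam k Λ) :=
  { (inferInstance : AddCommGroup (Gam k Λ)), (inferInstance : Mul (Gam k Λ)),
    (inferInstance : One (Gam k Λ)) with
    left_distrib := fun x y z => by
      apply ext'
      · simp; ring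
      · simp; ring
      · intro w; simp [add_mul]; ring
      · simp [mul_add]
    right_distrib := fun x y z => by
      apply ext'
      · simp; ring
      · simp; ring
      · intro w; simp; ring
      · simp [add_mul]
    zero_mul := fun x => by apply ext' <;> intros <;> simp
    mul_zero := fun x => by apply ext' <;> intros <;> simp
    one_mul := fun x => by apply ext' <;> intros <;> simp
    mul_one := fun x => by apply ext' <;> intros <;> simp
    mul_assoc := fun x y z => by
      apply ext'
      · simp; ring
      · simp; ring
      · intro w; simp [mul_assoc]; ring
      · simp [mul_assoc] }

noncomputable instance : Algebra k (Gam k Λ) := Algebra.ofModule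
  (fun c x y => by
      apply ext'
      · simp; ring
      · simp; ring
      · intro w; simp; ring
      · simp)
  (fun c x y => by
      apply ext'
      · simp; ring
      · simp; ring
      · intro w; simp; ring
      · simp)

end Gam

variable (k Λ) in
def EE : Type u := k × k × Λ

noncomputable instance : AddCommGroup (EE k Λ) :=
  inferInstanceAs (AddCommGroup (k × k × Λ))

namespace EE
def p (x : EE k Λ) : k := x.1
def s (x : EE k Λ) : k := x.2.1
def v (x : EE k Λ) : Λ := x.2.2
def mk (p s : k) (v : Λ) : EE k Λ := (p, s, v)
@[simp] lemma mk_p (p s : k) (v : Λ) : (mk p s v).p = p := rfl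
@[simp] lemma mk_s (p s : k) (v : Λ) : (mk p s v).s = s := rfl
@[simp] lemma mk_v (p s : k) (v : Λ) : (mk p s v).v = v := rfl
@[simp] lemma add_p (x y : EE k Λ) : (x + y).p = x.p + y.p := rfl
@[simp] lemma add_s (x y : EE k Λ) : (x + y).s = x.s + y.s := rfl
@[simp] lemma add_v (x y : EE k Λ) : (x + y).v = x.v + y.v := rfl
@[simp] lemma zero_p : (0 : EE k Λ).p = 0 := rfl
@[simp] lemma zero_s : (0 : EE k Λ).s = 0 := rfl
@[simp] lemma zero_v : (0 : EE k Λ).v = 0 := rfl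
lemma ext' {x y : EE k Λ} (h1 : x.p = y.p) (h2 : x.s = y.s) (h3 : x.v = y.v) : x = y :=
  Prod.ext h1 (Prod.ext h2 h3)

noncomputable instance : SMul (Gam k Λ) (EE k Λ) :=
  ⟨fun g x => mk (g.a * x.p + g.t * x.s + g.m x.v) (g.a * x.s) (g.l * x.v)⟩
@[simp] lemma smul_p (g : Gam k Λ) (x : EE k Λ) : (g • x).p = g.a * x.p + g.t * x.s + g.m x.v := rfl
@[simp] lemma smul_s (g : Gam k Λ) (x : EE k Λ) : (g • x).s = g.a * x.s := rfl
@[simp] lemma smul_v (g : Gam k Λ) (x : EE k Λ) : (g • x).v = g.l * x.v := rfl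

noncomputable instance : Module (Gam k Λ) (EE k Λ) where
  one_smul x := by apply ext' <;> simp
  mul_smul g h x := by
    apply ext'
    · simp; ring
    · simp; ring
    · simp [mul_assoc]
  smul_zero g := by apply ext' <;> simp
  zero_smul g := by apply ext' <;> simp
  smul_add g x y := by
    apply ext'
    · simp; ring
    · simp; ring
    · simp [mul_add]
  add_smul g h x := by
    apply ext'
    · simp; ring
    · simp; ring
    · simp [add_mul]
end EE
end
end IG
namespace IG

section
variable {k Λ : Type u} [Field k] [Ring Λ] [Algebra k Λ]

def e1 : Gam k Λ := Gam.mk 1 0 0 0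
def ep : Gam k Λ := Gam.mk 0 1 0 0
def mm (m : Module.Dual k Λ) : Gam k Λ := Gam.mk 0 0 m 0

lemma am (c : k) : algebraMap k (Gam k Λ) c = Gam.mk c 0 0 (c • 1) := by
  rw [Algebra.algebraMap_eq_smul_one]
  apply Gam.ext' <;> intros <;> simp

lemma e1_mul (g : Gam k Λ) : e1 * g = algebraMap k _ g.a * e1 + algebraMap k _ g.t * ep + mm g.m := by
  rw [am, am]
  apply Gam.ext' <;> intros <;> simp [e1, ep, mm]
lemma ep_mul (g : Gam k Λ) : ep * g = algebraMap k _ g.a * ep := by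
  rw [am]
  apply Gam.ext' <;> intros <;> simp [ep]
lemma mm_mul (m) (g : Gam k Λ) : mm m * g = mm (m.comp (LinearMap.mulLeft k g.l)) := by
  apply Gam.ext' <;> intros <;> simp [mm]
lemma mm_add (m m' : Module.Dual k Λ) : mm (m + m') = mm m + mm m' := by
  apply Gam.ext' <;> intros <;> simp [mm]
lemma mm_smul (c : k) (m : Module.Dual k Λ) : mm (c • m) = algebraMap k _ c * mm m := by
  rw [am]
  apply Gam.ext' <;> intros <;> simp [mm]

instance EE_inj [FiniteDimensional k Λ] : Module.Injective (Gam k Λ) (EE k Λ) where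
  out {X Y} _ _ _ _ f hf g := by
    letI : Module k X := Module.compHom X (algebraMap k (Gam k Λ))
    letI : Module k Y := Module.compHom Y (algebraMap k (Gam k Λ))
    let fk : X →ₗ[k] Y := { toFun := f, map_add' := f.map_add, map_smul' := fun c x => f.map_smul (algebraMap k _ c) x }
    let ψ : X →ₗ[k] k :=
      { toFun := fun x => (g x).p
        map_add' := fun x y => by rw [map_add]; rfl
        map_smul' := fun c x => by
          change (g (algebraMap k (Gam k Λ) c • x)).p = c * (g x).p
          rw [map_smul, am]
          simp }
    obtain ⟨q, hq⟩ := fk.exists_leftInverse_of_injective (LinearMap.ker_eq_bot.2 hf)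
    have hq' : ∀ x, q (f x) = x := fun x => congrArg (fun h => h x) hq
    let ψ' : Y →ₗ[k] k := ψ.comp q
    have hψ : ∀ x, ψ' (f x) = (g x).p := fun x => congrArg (fun z => (g z).p) (hq' x)
    have hψs : ∀ (c : k) (y : Y), ψ' (algebraMap k (Gam k Λ) c • y) = c * ψ' y := fun c y => ψ'.map_smul c y
    clear_value ψ'
    let φ : Y → Module.Dual k (Module.Dual k Λ) := fun y =>
      { toFun := fun m => ψ' (mm m • y)
        map_add' := fun m m' => by rw [mm_add, add_smul, map_add]
        map_smul' := fun c m => by rw [mm_smul, mul_smul, hψs]; rfl }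
    let vv : Y → Λ := fun y => (Module.evalEquiv k Λ).symm (φ y)
    have hv : ∀ (m : Module.Dual k Λ) y, m (vv y) = ψ' (mm m • y) := by
      intro m y
      have : Module.evalEquiv k Λ (vv y) = φ y := LinearEquiv.apply_symm_apply _ _
      exact congrArg (fun h => h m) this
    have sep : ∀ x y : Λ, (∀ m : Module.Dual k Λ, m x = m y) → x = y := by
      intro x y h
      apply (Module.evalEquiv k Λ).injective
      apply LinearMap.ext
      exact h
    clear_value vv
    refine ⟨{ toFun := fun y => EE.mk (ψ' ((e1 : Gam k Λ) • y)) (ψ' ((ep : Gam k Λ) • y)) (vv y)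
              map_add' := ?_
              map_smul' := ?_ }, ?_⟩
    · intro x y
      apply EE.ext'
      · simp
      · simp
      · apply sep
        intro m
        simp [hv]
    · intro c y
      apply EE.ext'
      · simp only [RingHom.id_apply, EE.smul_p, EE.mk_p, EE.mk_s, EE.mk_v, hv]
        rw [smul_smul, e1_mul, add_smul, add_smul, map_add, map_add, mul_smul, mul_smul, hψs, hψs]
      · simp only [RingHom.id_apply, EE.smul_s, EE.mk_s]
        rw [smul_smul, ep_mul, mul_smul, hψs]
      · apply sep
        intro m
        simp only [RingHom.id_apply, EE.smul_v, EE.mk_v, hv]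
        rw [smul_smul, mm_mul, ← hv]
        rfl
    · intro x
      apply EE.ext'
      · simp only [LinearMap.coe_mk, AddHom.coe_mk, EE.mk_p]
        rw [← map_smul, hψ, map_smul]
        simp [e1]
      · simp only [LinearMap.coe_mk, AddHom.coe_mk, EE.mk_s]
        rw [← map_smul, hψ, map_smul]
        simp [ep]
      · apply sep
        intro m
        simp only [LinearMap.coe_mk, AddHom.coe_mk, EE.mk_v, hv]
        rw [← map_smul, hψ, map_smul]
        simp [mm]

lemma EE_injective [FiniteDimensional k Λ] : Injective (ModuleCat.of (Gam k Λ) (EE k Λ)) :=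
  Module.injective_object_of_injective_module _ _
end
end IG
namespace IG

section
variable {R : Type u} [Ring R]

lemma acyclic_of (X : Ch R) (h : ∀ (n : ℤ) (x : X.X n), (X.d n (n+1)).hom x = 0 →
    ∃ y, (X.d (n-1) n).hom y = x) : X.Acyclic := by
  intro n
  rw [HomologicalComplex.exactAt_iff' X (n-1) n (n+1) (by simp) (by simp),
    ShortComplex.moduleCat_exact_iff]
  exact h n

variable [HasDerivedCategory.{w} (ModuleCat.{u} R)]
variable {S : Set (DerivedCategory (ModuleCat.{u} R))}

lemma ses_qis {T : ShortComplex (Ch R)} (hT : T.ShortExact) (h : T.X₁.Acyclic) : QuasiIso T.g := by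
  rw [← DerivedCategory.isIso_Q_map_iff_quasiIso]
  exact (Triangle.isZero₁_iff_isIso₂ _ (DerivedCategory.triangleOfSES_distinguished hT)).1
    ((acyclic_iff_isZero_Q _).1 h)

lemma mses' {A B C : Type u} [AddCommGroup A] [Module R A] [AddCommGroup B] [Module R B]
    [AddCommGroup C] [Module R C] (f : A →ₗ[R] B) (g : B →ₗ[R] C) (hf : Function.Injective f)
    (hg : Function.Surjective g) (h : ∀ x, g (f x) = 0) (hfg : ∀ x, g x = 0 → ∃ y, f y = x) :
    ((ShortComplex.mk (ModuleCat.ofHom f) (ModuleCat.ofHom g) (by ext x; exact h x)).map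
      (HomologicalComplex.single (ModuleCat.{u} R) (ComplexShape.up ℤ) 0)).ShortExact := by
  apply IsLoc.mses
  have := (ModuleCat.mono_iff_injective (ModuleCat.ofHom f)).2 hf
  have := (ModuleCat.epi_iff_surjective (ModuleCat.ofHom g)).2 hg
  exact { exact := (ShortComplex.moduleCat_exact_iff _).2 hfg
          mono_f := by assumption
          epi_g := by assumption }

noncomputable def mkTo (Y : Ch R) {M : ModuleCat.{u} R} (φ : Y.X 0 ⟶ M) (hd : ∀ b, Y.d b 0 ≫ φ = 0) :
    Y ⟶ (HomologicalComplex.single _ (ComplexShape.up ℤ) 0).obj M :=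
  HomologicalComplex.mkHomToSingle φ (fun b _ => hd b)
lemma mkTo_f (Y : Ch R) {M : ModuleCat.{u} R} (φ : Y.X 0 ⟶ M) (hd : ∀ b, Y.d b 0 ≫ φ = 0) :
    (mkTo Y φ hd).f 0 = φ ≫ (HomologicalComplex.singleObjXSelf (ComplexShape.up ℤ) 0 M).inv :=
  HomologicalComplex.mkHomToSingle_f φ (fun b _ => hd b)

/-- constant complex -/
noncomputable def per (E : Type u) [AddCommGroup E] [Module R E] (f : E →ₗ[R] E) (hf : ∀ x, f (f x) = 0) : Ch R where
  X _ := ModuleCat.of R E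
  d n m := ModuleCat.ofHom (open Classical in if n + 1 = m ∧ m ≤ 0 then f else 0)
  shape n m h := by
    have h' : ¬ (n + 1 = m) := h
    rw [if_neg (fun hh => h' hh.1)]; rfl
  d_comp_d' n m l h h' := by
    have h1 : n + 1 = m := h
    have h2 : m + 1 = l := h'
    by_cases h3 : l ≤ 0
    · rw [if_pos ⟨h1, by omega⟩, if_pos ⟨h2, h3⟩]
      ext x
      exact hf x
    · rw [if_neg (c := m + 1 = l ∧ l ≤ 0) (fun hh => h3 hh.2)]
      ext x
      rfl

section
variable {E : Type u} [AddCommGroup E] [Module R E] (f : E →ₗ[R] E) (hf : ∀ x, f (f x) = 0)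

lemma per_d (n m : ℤ) (h : n + 1 = m) (hm : m ≤ 0) (x : E) : ((per E f hf).d n m).hom x = f x := by
  have : (per E f hf).d n m = ModuleCat.ofHom f := by
    change ModuleCat.ofHom (open Classical in if n + 1 = m ∧ m ≤ 0 then f else 0) = _
    rw [if_pos ⟨h, hm⟩]
  exact congrArg (fun g => g.hom x) this
lemma per_d0 (n m : ℤ) (hm : ¬ (n + 1 = m ∧ m ≤ 0)) (x : E) : ((per E f hf).d n m).hom x = (0 : E) := by
  have : (per E f hf).d n m = 0 := by
    change ModuleCat.ofHom (open Classical in if n + 1 = m ∧ m ≤ 0 then f else 0) = _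
    rw [if_neg hm]; rfl
  exact congrArg (fun g => g.hom x) this

open Classical in
noncomputable def fam (P Q : Submodule R E) (n : ℤ) : Submodule R E :=
  if n < 0 then P else if n = 0 then Q else ⊥

variable (P Q : Submodule R E)
lemma fam_neg {n : ℤ} (h : n < 0) : fam P Q n = P := if_pos h
lemma fam_zero {n : ℤ} (h : n = 0) : fam P Q n = Q := by rw [fam, if_neg (by omega), if_pos h]
lemma fam_pos {n : ℤ} (h : 0 < n) : fam P Q n = ⊥ := by
  rw [fam, if_neg (by omega), if_neg (by omega)]
variable {P Q}
lemma fam_stab' (hP : ∀ x ∈ P, f x ∈ P) (hQ : ∀ x ∈ P, f x ∈ Q) (n : ℤ) (h : n + 1 ≤ 0) (x : E)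
    (hx : x ∈ fam P Q n) : f x ∈ fam P Q (n+1) := by
  rw [fam_neg P Q (by omega)] at hx
  by_cases h' : n + 1 = 0
  · rw [fam_zero P Q h']; exact hQ x hx
  · rw [fam_neg P Q (by omega)]; exact hP x hx

lemma fam_stab (hP : ∀ x ∈ P, f x ∈ P) (hQ : ∀ x ∈ P, f x ∈ Q) : Stab (per E f hf) (fam P Q) := by
  intro n x hx
  by_cases h : n + 1 ≤ 0
  · have := fam_stab' f hP hQ n h x hx
    exact (congrArg (· ∈ fam P Q (n+1)) (per_d f hf n (n+1) rfl h x)).mpr this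
  · exact (congrArg (· ∈ fam P Q (n+1)) (per_d0 f hf n (n+1) (fun h' => h h'.2) x)).mpr (zero_mem _)

lemma fam_acyclic (hP : ∀ x ∈ P, f x ∈ P) (hQ : ∀ x ∈ P, f x ∈ Q)
    (h1 : ∀ x ∈ P, f x = 0 → ∃ y ∈ P, f y = x) (h2 : ∀ x ∈ Q, ∃ y ∈ P, f y = x) :
    (subc (fam_stab f hf hP hQ)).Acyclic := by
  apply acyclic_of
  intro n x hx
  obtain ⟨x, hx'⟩ := x
  have hx0 : ((per E f hf).d n (n+1)).hom x = (0 : E) := congrArg Subtype.val hx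
  have key : n ≤ 0 → ∀ y : E, y ∈ P → f y = x → ∃ y, ((subc (fam_stab f hf hP hQ)).d (n-1) n).hom y = ⟨x, hx'⟩ := by
    intro hn y hy hyx
    refine ⟨⟨y, ?_⟩, ?_⟩
    · have : y ∈ fam P Q (n-1) := by rw [fam_neg P Q (by omega)]; exact hy
      exact this
    · apply Subtype.ext
      exact (per_d f hf (n-1) n (by omega) hn y).trans hyx
  have hx'' : (show E from x) ∈ fam P Q n := hx'
  rcases lt_trichotomy n 0 with h | h | h
  · rw [fam_neg P Q h] at hx''
    have := (per_d f hf n (n+1) rfl (by omega) x).symm.trans hx0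
    obtain ⟨y, hy, hyx⟩ := h1 x hx'' this
    exact key (by omega) y hy hyx
  · rw [fam_zero P Q h] at hx''
    obtain ⟨y, hy, hyx⟩ := h2 x hx''
    exact key (by omega) y hy hyx
  · rw [fam_pos P Q h] at hx''
    refine ⟨0, ?_⟩
    apply Subtype.ext
    exact (congrArg Subtype.val (map_zero ((subc (fam_stab f hf hP hQ)).d (n-1) n).hom)).trans ((Submodule.mem_bot R).1 hx'').symm

lemma fam_InS (hS : IsLoc S) (hP : ∀ x ∈ P, f x ∈ P) (hQ : ∀ x ∈ P, f x ∈ Q)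
    (h1 : MInS S (ModuleCat.of R P)) (h2 : MInS S (ModuleCat.of R Q)) :
    InS S (subc (fam_stab f hf hP hQ)) := by
  have key : ∀ n, 0 < n → Subsingleton (fam P Q n) := by
    intro n hn
    rw [fam_pos P Q hn]; infer_instance
  apply hS.LR _ 0
  · exact key
  · intro n
    change MInS S (ModuleCat.of R (fam P Q n))
    rcases lt_trichotomy n 0 with h | h | h
    · rw [fam_neg P Q h]; exact h1
    · rw [fam_zero P Q h]; exact h2
    · exact hS.mzero (key n h)

lemma fam_le {P' Q' : Submodule R E} (h : P ≤ P') (h' : Q ≤ Q') (n : ℤ) : fam P Q n ≤ fam P' Q' n := by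
  unfold fam
  split_ifs
  · exact h
  · exact h'
  · exact le_rfl

/-- the comparison map of a `fam` complex to the single complex -/
noncomputable def famφ (P : Submodule R E) {M : Type u} [AddCommGroup M] [Module R M] (g : Q →ₗ[R] M) :
    ModuleCat.of R (fam P Q 0) ⟶ ModuleCat.of R M :=
  ModuleCat.ofHom (g.comp (LinearEquiv.ofEq _ _ (fam_zero P Q rfl)).toLinearMap)

lemma famφ_d (hP : ∀ x ∈ P, f x ∈ P) (hQ : ∀ x ∈ P, f x ∈ Q)
    {M : Type u} [AddCommGroup M] [Module R M] (g : Q →ₗ[R] M)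
    (hg : ∀ x (hx : x ∈ P), g ⟨f x, hQ x hx⟩ = 0) (b : ℤ) :
    (subc (fam_stab f hf hP hQ)).d b 0 ≫ famφ P g = 0 := by
  ext x
  obtain ⟨x, hx⟩ := x
  by_cases h : b + 1 = 0
  · have hx' : (show E from x) ∈ fam P Q b := hx
    rw [fam_neg P Q (by omega)] at hx'
    refine Eq.trans ?_ (hg x hx')
    change g _ = _
    congr 1
    apply Subtype.ext
    exact per_d f hf b 0 h le_rfl x
  · have := congrArg (fun f => (famφ P g).hom (f.hom ⟨x, hx⟩)) ((subc (fam_stab f hf hP hQ)).shape b 0 h)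
    exact this.trans (map_zero (famφ P g).hom)

noncomputable def famTo (hP : ∀ x ∈ P, f x ∈ P) (hQ : ∀ x ∈ P, f x ∈ Q)
    {M : Type u} [AddCommGroup M] [Module R M] (g : Q →ₗ[R] M)
    (hg : ∀ x (hx : x ∈ P), g ⟨f x, hQ x hx⟩ = 0) :
    subc (fam_stab f hf hP hQ) ⟶
      (HomologicalComplex.single _ (ComplexShape.up ℤ) 0).obj (ModuleCat.of R M) :=
  mkTo (subc (fam_stab f hf hP hQ)) (famφ P g) (famφ_d f hf hP hQ g hg)

lemma famTo_comp (hP : ∀ x ∈ P, f x ∈ P) (hQ : ∀ x ∈ P, f x ∈ Q)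
    {M : Type u} [AddCommGroup M] [Module R M] (g : Q →ₗ[R] M)
    (hg : ∀ x (hx : x ∈ P), g ⟨f x, hQ x hx⟩ = 0)
    {P' Q' : Submodule R E} (hP' : ∀ x ∈ P', f x ∈ P') (hQ' : ∀ x ∈ P', f x ∈ Q')
    (hP1 : P ≤ P') (hQ1 : Q ≤ Q') (g' : Q' →ₗ[R] M)
    (hg' : ∀ x (hx : x ∈ P'), g' ⟨f x, hQ' x hx⟩ = 0) (hgg : ∀ x, g' (Submodule.inclusion hQ1 x) = g x) :
    subincl (fam_stab f hf hP hQ) (fam_stab f hf hP' hQ') (fam_le hP1 hQ1) ≫ famTo f hf hP' hQ' g' hg' =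
      famTo f hf hP hQ g hg := by
  apply HomologicalComplex.to_single_hom_ext
  have h1 := mkTo_f (subc (fam_stab f hf hP hQ)) (famφ P g) (famφ_d f hf hP hQ g hg)
  have h2 := mkTo_f (subc (fam_stab f hf hP' hQ')) (famφ P' g') (famφ_d f hf hP' hQ' g' hg')
  refine Eq.trans ?_ h1.symm
  refine (congrArg (fun z => (subincl (fam_stab f hf hP hQ) (fam_stab f hf hP' hQ') (fam_le hP1 hQ1)).f 0 ≫ z) h2).trans ?_
  ext x
  exact congrArg (HomologicalComplex.singleObjXSelf (ComplexShape.up ℤ) 0 (ModuleCat.of R M)).inv.hom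
    (hgg (LinearEquiv.ofEq _ _ (fam_zero P Q rfl) x))

lemma fam_ses (hP : ∀ x ∈ P, f x ∈ P) (hQ : ∀ x ∈ P, f x ∈ Q) {Q' : Submodule R E} (hle : Q' ≤ Q)
    (hQ' : ∀ x ∈ P, f x ∈ Q')
    {M : Type u} [AddCommGroup M] [Module R M] (g : Q →ₗ[R] M)
    (hg : ∀ x, g x = 0 ↔ x.1 ∈ Q') (hs : Function.Surjective g) :
    ∃ h0, (ssSC (subincl (fam_stab f hf hP hQ') (fam_stab f hf hP hQ) (fam_le le_rfl hle)) 0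
      (famφ P g) h0 (famφ_d f hf hP hQ g (fun x hx => (hg _).2 (hQ' x hx)))).ShortExact := by
  refine ⟨?_, ?_⟩
  · ext x
    obtain ⟨x, hx⟩ := x
    have hx' : (show E from x) ∈ fam P Q' 0 := hx
    rw [fam_zero P Q' rfl] at hx'
    exact (hg ⟨x, hle hx'⟩).2 hx'
  apply ssSC_exact
  · intro n
    exact Submodule.inclusion_injective (fam_le le_rfl hle n)
  · intro n hn x
    obtain ⟨x, hx⟩ := x
    have hx' : (show E from x) ∈ fam P Q n := hx
    have : (show E from x) ∈ fam P Q' n := by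
      unfold fam at hx' ⊢
      rw [if_neg hn] at hx' ⊢
      exact hx'
    exact ⟨⟨x, this⟩, rfl⟩
  · intro m
    obtain ⟨x, hx⟩ := hs m
    have : x.1 ∈ fam P Q 0 := by rw [fam_zero P Q rfl]; exact x.2
    exact ⟨⟨x.1, this⟩, hx⟩
  · intro x hx
    obtain ⟨x, hx'⟩ := x
    have hx'' : (show E from x) ∈ fam P Q 0 := hx'
    rw [fam_zero P Q rfl] at hx''
    have := (hg ⟨x, hx''⟩).1 hx
    have : (show E from x) ∈ fam P Q' 0 := by rw [fam_zero P Q' rfl]; exact this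
    exact ⟨⟨x, this⟩, rfl⟩
end
end
end IG
namespace IG

section
variable {R : Type u} [Ring R] [HasDerivedCategory.{w} (ModuleCat.{u} R)]
variable {S : Set (DerivedCategory (ModuleCat.{u} R))}
lemma retractq (hS : IsLoc S) {A X T : Ch R} {i : A ⟶ X} {p : X ⟶ T} {q : A ⟶ T} (e : i ≫ p = q)
    (hq : QuasiIso q) (hX : InS S X) : InS S T := by
  subst e
  exact hS.retract i p hX
end

section
variable {k Λ : Type u} [Field k] [Ring Λ] [Algebra k Λ]
variable (k Λ)
noncomputable def ff : EE k Λ →ₗ[Gam k Λ] EE k Λ where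
  toFun x := EE.mk x.s 0 0
  map_add' x y := by apply EE.ext' <;> simp
  map_smul' g x := by apply EE.ext' <;> simp
lemma ff_ff (x : EE k Λ) : ff k Λ (ff k Λ x) = 0 := by apply EE.ext' <;> simp [ff]

def sU : Submodule (Gam k Λ) (EE k Λ) where
  carrier := {x | x.v = 0}
  zero_mem' := rfl
  add_mem' {x y} hx hy := by simp only [Set.mem_ofPred_eq] at *; simp [hx, hy]
  smul_mem' g x hx := by simp only [Set.mem_ofPred_eq] at *; simp [hx]
def sK : Submodule (Gam k Λ) (EE k Λ) where
  carrier := {x | x.s = 0}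
  zero_mem' := rfl
  add_mem' {x y} hx hy := by simp only [Set.mem_ofPred_eq] at *; simp [hx, hy]
  smul_mem' g x hx := by simp only [Set.mem_ofPred_eq] at *; simp [hx]
noncomputable def s0 : Submodule (Gam k Λ) (EE k Λ) := sU k Λ ⊓ sK k Λ

lemma mem_U {x : EE k Λ} : x ∈ sU k Λ ↔ x.v = 0 := Iff.rfl
lemma mem_K {x : EE k Λ} : x ∈ sK k Λ ↔ x.s = 0 := Iff.rfl
lemma mem_0 {x : EE k Λ} : x ∈ s0 k Λ ↔ x.v = 0 ∧ x.s = 0 := Iff.rfl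
lemma ff_0 (x : EE k Λ) : ff k Λ x ∈ s0 k Λ := ⟨rfl, rfl⟩

/-- the ring map to k -/
noncomputable def qq : Gam k Λ →+* k where
  toFun g := g.a
  map_one' := rfl
  map_zero' := rfl
  map_add' _ _ := rfl
  map_mul' _ _ := rfl

variable [HasDerivedCategory.{w} (ModuleCat.{u} (Gam k Λ))]
lemma Z_acyclic : (subc (fam_stab (ff k Λ) (ff_ff k Λ) (P := sU k Λ) (Q := s0 k Λ) (fun x _ => (ff_0 k Λ x).1)
    (fun x _ => ff_0 k Λ x))).Acyclic := by
  have key : ∀ x : EE k Λ, x.v = 0 → x.s = 0 → ∃ y ∈ sU k Λ, ff k Λ y = x := by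
    intro x h1 h2
    refine ⟨EE.mk 0 x.p 0, rfl, ?_⟩
    apply EE.ext'
    · rfl
    · exact h2.symm
    · exact h1.symm
  refine fam_acyclic (ff k Λ) (ff_ff k Λ) (P := sU k Λ) (Q := s0 k Λ) (fun x _ => (ff_0 k Λ x).1)
    (fun x _ => ff_0 k Λ x) ?_ ?_
  · intro x hx h
    exact key x hx (congrArg EE.p h)
  · intro x hx
    exact key x hx.1 hx.2

variable {S : Set (DerivedCategory (ModuleCat.{u} (Gam k Λ)))}

lemma step1 (hS : IsLoc S) (hE : MInS S (ModuleCat.of (Gam k Λ) (EE k Λ))) :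
    MInS S (ModuleCat.of (Gam k Λ) (EE k Λ ⧸ sU k Λ)) := by
  have hT : MInS S (ModuleCat.of (Gam k Λ) (⊤ : Submodule (Gam k Λ) (EE k Λ))) :=
    (hS.miso (LinearEquiv.toModuleIso (Submodule.topEquiv (R := Gam k Λ) (M := EE k Λ)))).2 hE
  have hC := fam_InS (ff k Λ) (ff_ff k Λ) hS (P := ⊤) (Q := ⊤) (fun _ _ => trivial)
    (fun _ _ => trivial) hT hT
  have hgK : ∀ x : sK k Λ, ((sU k Λ).mkQ.comp (sK k Λ).subtype) x = 0 ↔ x.1 ∈ s0 k Λ := by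
    intro x
    rw [LinearMap.comp_apply, Submodule.subtype_apply, Submodule.mkQ_apply, Submodule.Quotient.mk_eq_zero]
    exact ⟨fun h => ⟨h, x.2⟩, fun h => h.1⟩
  have hsK : Function.Surjective ((sU k Λ).mkQ.comp (sK k Λ).subtype) := by
    intro z
    obtain ⟨x, rfl⟩ := Submodule.Quotient.mk_surjective _ z
    refine ⟨⟨EE.mk x.p 0 x.v, rfl⟩, ?_⟩
    rw [LinearMap.comp_apply, Submodule.subtype_apply, Submodule.mkQ_apply, Submodule.Quotient.eq]
    rw [sub_eq_add_neg]
    change x.v + -x.v = 0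
    simp
  obtain ⟨h0, hse⟩ := fam_ses (ff k Λ) (ff_ff k Λ) (P := sU k Λ) (Q := sK k Λ) (Q' := s0 k Λ)
    (fun x _ => (ff_0 k Λ x).1) (fun x _ => (ff_0 k Λ x).2) inf_le_right (fun x _ => ff_0 k Λ x)
    ((sU k Λ).mkQ.comp (sK k Λ).subtype) hgK hsK
  have hq := ses_qis hse (Z_acyclic k Λ)
  have e := famTo_comp (ff k Λ) (ff_ff k Λ) (P := sU k Λ) (Q := sK k Λ)
    (fun x _ => (ff_0 k Λ x).1) (fun x _ => (ff_0 k Λ x).2) ((sU k Λ).mkQ.comp (sK k Λ).subtype)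
    (fun x hx => (hgK _).2 (ff_0 k Λ x)) (P' := ⊤) (Q' := ⊤)
      (fun _ _ => trivial) (fun _ _ => trivial) le_top le_top
      ((sU k Λ).mkQ.comp (⊤ : Submodule (Gam k Λ) (EE k Λ)).subtype)
      (fun x _ => (Submodule.Quotient.mk_eq_zero _).2 (ff_0 k Λ x).1) (fun _ => rfl)
  exact retractq hS e hq hC

lemma step2 (hS : IsLoc S) (hE : MInS S (ModuleCat.of (Gam k Λ) (EE k Λ))) :
    MInS S (ModuleCat.of (Gam k Λ) (sU k Λ)) :=
  hS.ses₁ (mses' (sU k Λ).subtype (sU k Λ).mkQ Subtype.val_injective (Submodule.mkQ_surjective _)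
    (fun x => (Submodule.Quotient.mk_eq_zero _).2 x.2)
    (fun x h => ⟨⟨x, (Submodule.Quotient.mk_eq_zero _).1 h⟩, rfl⟩)) hE (step1 k Λ hS hE)

lemma step3 (hS : IsLoc S) (hE : MInS S (ModuleCat.of (Gam k Λ) (EE k Λ))) :
    MInS S ((ModuleCat.restrictScalars (qq k Λ)).obj (ModuleCat.of k k)) := by
  let _ : Module (Gam k Λ) k := Module.compHom k (qq k Λ)
  have hU := step2 k Λ hS hE
  have hW := fam_InS (ff k Λ) (ff_ff k Λ) hS (P := sU k Λ) (Q := sU k Λ) (fun x _ => (ff_0 k Λ x).1)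
    (fun x _ => (ff_0 k Λ x).1) hU hU
  let g : sU k Λ →ₗ[Gam k Λ] k :=
    { toFun := fun x => x.1.s
      map_add' := fun _ _ => rfl
      map_smul' := fun _ _ => rfl }
  obtain ⟨h0, hse⟩ := fam_ses (ff k Λ) (ff_ff k Λ) (P := sU k Λ) (Q := sU k Λ) (Q' := s0 k Λ)
    (fun x _ => (ff_0 k Λ x).1) (fun x _ => (ff_0 k Λ x).1) inf_le_left (fun x _ => ff_0 k Λ x)
    g (fun x => ⟨fun h => ⟨x.2, h⟩, fun h => h.2⟩) (fun c => ⟨⟨EE.mk 0 c 0, rfl⟩, rfl⟩)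
  exact hS.ses₃ hse (hS.acyclic (Z_acyclic k Λ)) hW

end
end IG
namespace IG

section
variable (k Λ : Type u) [Field k] [Ring Λ] [Algebra k Λ]

noncomputable def N1 : Submodule (Gam k Λ) (Gam k Λ) where
  carrier := {x | x.l = 0}
  zero_mem' := rfl
  add_mem' {x y} hx hy := by simp only [Set.mem_ofPred_eq] at *; simp [hx, hy]
  smul_mem' g x hx := by simp only [Set.mem_ofPred_eq, smul_eq_mul] at *; simp [hx]

noncomputable def b1 : Gam k Λ →ₗ[Gam k Λ] (EE k Λ ⧸ sU k Λ) :=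
  (sU k Λ).mkQ.comp (LinearMap.toSpanSingleton (Gam k Λ) (EE k Λ) (EE.mk 0 0 1))

noncomputable def b2 : N1 k Λ →ₗ[Gam k Λ] sU k Λ :=
  ((LinearMap.toSpanSingleton (Gam k Λ) (EE k Λ) (EE.mk 0 1 0)).comp (N1 k Λ).subtype).codRestrict _
    (fun x => by
      change (x.1 • EE.mk (Λ := Λ) (0:k) 1 0).v = 0
      simp)

variable [HasDerivedCategory.{w} (ModuleCat.{u} (Gam k Λ))]
variable {S : Set (DerivedCategory (ModuleCat.{u} (Gam k Λ)))}

lemma step4 (hS : IsLoc S) (h : MInS S ((ModuleCat.restrictScalars (qq k Λ)).obj (ModuleCat.of k k)))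
    (P : ModuleCat.{u} k) : MInS S ((ModuleCat.restrictScalars (qq k Λ)).obj P) := by
  let Z : P → ModuleCat.{u} k := fun _ => ModuleCat.of k k
  let F := ModuleCat.restrictScalars.{u} (qq k Λ)
  have : PreservesColimitsOfSize.{u, u} F :=
    (ModuleCat.restrictCoextendScalarsAdj.{u, u, u} (qq k Λ)).leftAdjoint_preservesColimits
  have h1 : MInS S (F.obj (∐ Z)) := by
    have hc := isColimitCofanMkObjOfIsColimit F Z _ (coproductIsCoproduct Z)
    exact hS.mcop hc (fun _ => h)
  let p : (∐ Z) ⟶ P := Sigma.desc (fun x => ModuleCat.ofHom (LinearMap.toSpanSingleton k P x))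
  have : Epi p := by
    rw [ModuleCat.epi_iff_surjective]
    intro x
    refine ⟨(Sigma.ι Z x).hom (1 : k), ?_⟩
    have : Sigma.ι Z x ≫ p = ModuleCat.ofHom (LinearMap.toSpanSingleton k P x) := Sigma.ι_desc _ _
    refine (congrArg (fun f => f.hom (1 : k)) this).trans ?_
    exact one_smul k x
  have : Projective P := ModuleCat.projective_of_free (Module.Basis.ofVectorSpace k P)
  refine hS.mretract (F.map (Projective.factorThru (𝟙 P) p)) (F.map p) ?_ h1
  rw [← F.map_comp, Projective.factorThru_comp, F.map_id]

lemma step5 (hS : IsLoc S) (hE : MInS S (ModuleCat.of (Gam k Λ) (EE k Λ))) :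
    MInS S (ModuleCat.of (Gam k Λ) (Gam k Λ)) := by
  have hD := step4 k Λ hS (step3 k Λ hS hE) (ModuleCat.of k (Module.Dual k Λ))
  let _ : Module (Gam k Λ) (Module.Dual k Λ) := Module.compHom _ (qq k Λ)
  let i : Module.Dual k Λ →ₗ[Gam k Λ] N1 k Λ :=
    { toFun := fun m => ⟨mm m, rfl⟩
      map_add' := fun m m' => Subtype.ext (mm_add m m')
      map_smul' := fun g m => Subtype.ext (by
        change mm (g.a • m) = g * mm m
        apply Gam.ext' <;> intros <;> simp [mm]) }
  have hN : MInS S (ModuleCat.of (Gam k Λ) (N1 k Λ)) := by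
    refine hS.ses₂ (mses' i (b2 k Λ) ?_ ?_ ?_ ?_) hD (step2 k Λ hS hE)
    · intro m m' h
      exact congrArg (fun x => x.1.m) h
    · intro x
      refine ⟨⟨Gam.mk x.1.s x.1.p 0 0, rfl⟩, Subtype.ext ?_⟩
      change Gam.mk (Λ := Λ) x.1.s x.1.p 0 0 • EE.mk (Λ := Λ) (0:k) 1 0 = x.1
      have := (mem_U k Λ).1 x.2
      apply EE.ext' <;> simp [this]
    · intro x
      apply Subtype.ext
      change mm x • EE.mk (Λ := Λ) (0:k) 1 0 = 0
      apply EE.ext' <;> simp [mm]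
    · intro x hx
      have h : x.1 • EE.mk (Λ := Λ) (0:k) 1 0 = 0 := congrArg Subtype.val hx
      have h1 := congrArg EE.p h
      have h2 := congrArg EE.s h
      have h3 : x.1.l = 0 := x.2
      simp at h1 h2
      refine ⟨x.1.m, Subtype.ext ?_⟩
      change mm x.1.m = x.1
      apply Gam.ext' <;> intros <;> simp [mm, h1, h2, h3]
  refine hS.ses₂ (mses' (N1 k Λ).subtype (b1 k Λ) Subtype.val_injective ?_ ?_ ?_) hN (step1 k Λ hS hE)
  · intro z
    obtain ⟨x, rfl⟩ := Submodule.Quotient.mk_surjective _ z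
    refine ⟨Gam.mk 0 0 0 x.v, ?_⟩
    refine (Submodule.Quotient.eq _).2 ?_
    rw [sub_eq_add_neg]
    change (x.v * 1) + -x.v = 0
    simp
  · intro x
    refine (Submodule.Quotient.mk_eq_zero _).2 ?_
    change x.1.l * 1 = 0
    rw [mul_one]; exact x.2
  · intro x hx
    have h : x.l * 1 = 0 := (Submodule.Quotient.mk_eq_zero _).1 hx
    rw [mul_one] at h
    exact ⟨⟨x, h⟩, rfl⟩
end

theorem GenR_Gam (k Λ : Type u) [Field k] [Ring Λ] [Algebra k Λ] [FiniteDimensional k Λ] :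
    GenR (Gam k Λ) := by
  letI : HasDerivedCategory (ModuleCat.{u} (Gam k Λ)) := HasDerivedCategory.standard _
  intro S hS hI X
  exact hS.all (step5 k Λ hS (hI _ EE_injective)) X

end IG

namespace IG
lemma IG_iff (Λ : Type u) [Ring Λ] : InjectivesGenerate Λ ↔ GenR Λᵐᵒᵖ := by
  letI : HasDerivedCategory (ModuleCat.{u} Λᵐᵒᵖ) := HasDerivedCategory.standard _
  have key : ∀ (S : Set (DerivedCategory (ModuleCat.{u} Λᵐᵒᵖ))) (hS : IsLoc S) (M : ModuleCat.{u} Λᵐᵒᵖ),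
      MInS S M ↔ (DerivedCategory.singleFunctor (ModuleCat.{u} Λᵐᵒᵖ) 0).obj M ∈ S := by
    intro S hS M
    have e := (DerivedCategory.singleFunctorIsoCompQ (ModuleCat.{u} Λᵐᵒᵖ) 0).app M
    exact ⟨fun h => hS.iso _ _ e.symm h, fun h => hS.iso _ _ e h⟩
  constructor
  · intro h S hS hI
    exact h S hS.iso hS.shift hS.ext hS.coprod (fun M hM => (key S hS M).1 (hI M hM))
  · intro h S h1 h2 h3 h4 hI
    have hS : IsLoc S := ⟨h1, h2, h3, h4⟩
    exact h S hS (fun M hM => (key S hS M).2 (hI M hM))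

lemma GenR_equiv {R L : Type u} [Ring R] [Ring L] (r : R ≃+* L) (h : GenR R) : GenR L :=
  lemmaA r.toRingHom r.surjective 1 (map_one r) (fun x hx => by
    have : x = 0 := (map_eq_zero_iff r r.injective).1 hx
    rw [this, zero_mul]) h

noncomputable def rr (k Λ : Type u) [Field k] [Ring Λ] [Algebra k Λ] : (Gam k Λ)ᵐᵒᵖ →+* Λᵐᵒᵖ where
  toFun g := MulOpposite.op g.unop.l
  map_one' := rfl
  map_zero' := rfl
  map_add' _ _ := rfl
  map_mul' _ _ := rfl

lemma GenR_last (k Λ : Type u) [Field k] [Ring Λ] [Algebra k Λ] (h : GenR (Gam k Λ)ᵐᵒᵖ) : GenR Λᵐᵒᵖ :=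
  lemmaA (rr k Λ) (fun x => ⟨MulOpposite.op (Gam.mk 0 0 0 x.unop), rfl⟩)
    (MulOpposite.op (Gam.mk 0 0 0 1)) rfl (fun x hx => by
      have hx' : x.unop.l = 0 := congrArg MulOpposite.unop hx
      apply MulOpposite.unop_injective
      apply Gam.ext' <;> intros <;> simp [hx']) h
end IG

/-- **Theorem.** Injectives generate for all finite dimensional algebras if and only
if, for all finite dimensional algebras `Λ`, injectives generate for `Λ` implies that
injectives generate for `Λᵒᵖ`. -/
theorem injectives_generate_iff_left_right_symmetric :
    (∀ (k Λ : Type u) [Field k] [Ring Λ] [Algebra k Λ] [FiniteDimensional k Λ],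
      InjectivesGenerate Λ) ↔
    (∀ (k Λ : Type u) [Field k] [Ring Λ] [Algebra k Λ] [FiniteDimensional k Λ],
      InjectivesGenerate Λ → InjectivesGenerate Λᵐᵒᵖ) := by
  constructor
  · intro h k Λ _ _ _ _ _
    exact h k Λᵐᵒᵖ
  · intro h k Λ _ _ _ _
    have h1 : InjectivesGenerate (IG.Gam k Λ)ᵐᵒᵖ :=
      (IG.IG_iff _).2 (IG.GenR_equiv (RingEquiv.opOp _) (IG.GenR_Gam k Λ))
    have h2 := (IG.IG_iff _).1 (h k (IG.Gam k Λ)ᵐᵒᵖ h1)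
    have h3 : IG.GenR (IG.Gam k Λ)ᵐᵒᵖ := IG.GenR_equiv (RingEquiv.opOp _).symm h2
    exact (IG.IG_iff Λ).2 (IG.GenR_last k Λ h3)
end
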